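/- arXiv:2110.14178 — 2 statements merged into one kernel-verified Lean document; each statement's English description precedes it below -/
import Mathlib

section
/- Assume GRH for χ, i.e. every zero s of L(s,χ) with 0 < Re(s) < 1 satisfies Re(s) = 1/2. Then there exists a constant C > 0 (depending only on q and χ) such that for all reals T ≥ 4 and all s = σ + it with σ ≥ 1 and T ≤ t ≤ 2T, one has |(L'/L)(s,χ) + ∑_{1 ≤ n ≤ (log T)²} Λ(n)·χ(n)/n^s| ≤ C·(log T)^{2−2σ}, where L'(s,χ) is the derivative of L(·,χ) at s. -/
open Complex DirichletCharacter Finset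

lemma norm_logDeriv_le_of_norm_le {g : ℂ → ℂ} {R r L : ℝ} (hr : 0 ≤ r) (hrR : r < R) (hL : 0 ≤ L)
    (hg : DifferentiableOn ℂ g (Metric.ball 0 R)) (hne : ∀ z ∈ Metric.ball (0 : ℂ) R, g z ≠ 0)
    (hb : ∀ z ∈ Metric.ball (0 : ℂ) R, ‖g z‖ ≤ ‖g 0‖ * Real.exp L) {z : ℂ} (hz : ‖z‖ ≤ r) :
    ‖deriv g z / g z‖ ≤ 8 * R / (R - r) ^ 2 * L := by
  have hR : 0 < R := by linarith
  suffices H : ∀ L' > L, ‖deriv g z / g z‖ ≤ 8 * R / (R - r) ^ 2 * L' by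
    have h1 : Filter.Tendsto (fun L' : ℝ ↦ 8 * R / (R - r) ^ 2 * L') (nhdsWithin L (Set.Ioi L))
        (nhds (8 * R / (R - r) ^ 2 * L)) :=
      ((continuous_const.mul continuous_id).tendsto L).mono_left nhdsWithin_le_nhds
    exact ge_of_tendsto h1 (Filter.eventually_of_mem self_mem_nhdsWithin H)
  intro L' hL'
  have hL'0 : 0 < L' := by linarith
  have h0 : (0 : ℂ) ∈ Metric.ball (0 : ℂ) R := by simpa using hR
  have hd : DifferentiableOn ℂ (fun z ↦ deriv g z / g z) (Metric.ball 0 R) :=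
    (hg.deriv Metric.isOpen_ball).div hg hne
  obtain ⟨k, hk0, hk⟩ := hd.isExactOn_ball.with_val_at 0 0
  have hconst : ∀ w ∈ Metric.ball (0 : ℂ) R, g w = g 0 * cexp (k w) := by
    have hF : ∀ w ∈ Metric.ball (0 : ℂ) R,
        HasDerivWithinAt (fun w ↦ g w * cexp (-k w)) 0 (Metric.ball 0 R) w := by
      intro w hw
      have h1 := (hg.differentiableAt (Metric.isOpen_ball.mem_nhds hw)).hasDerivAt
      have h2 := h1.mul (hk w hw).neg.cexp
      refine (h2.congr_deriv ?_).hasDerivWithinAt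
      have := hne w hw
      field_simp
      ring
    intro w hw
    have := (convex_ball (0 : ℂ) R).is_const_of_fderivWithin_eq_zero
      (𝕜 := ℂ) (f := fun w ↦ g w * cexp (-k w)) (fun x hx ↦ (hF x hx).differentiableWithinAt)
      (fun x hx ↦ by
        have := (hF x hx).hasFDerivWithinAt.fderivWithin
          (Metric.isOpen_ball.uniqueDiffWithinAt hx)
        rw [this]; ext; simp) hw h0
    simp only [hk0, neg_zero, Complex.exp_zero, mul_one] at this
    rw [← this, mul_assoc, ← Complex.exp_add]; simp
  have hre : Set.MapsTo k (Metric.ball 0 R) {z | z.re ≤ L'} := by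
    intro w hw
    have h1 := hb w hw
    rw [hconst w hw, norm_mul, Complex.norm_exp] at h1
    have h2 := le_of_mul_le_mul_left h1 (norm_pos_iff.2 (hne 0 h0))
    have := Real.exp_le_exp.1 h2
    simp only [Set.mem_ofPred_eq]; linarith
  have hkd : DifferentiableOn ℂ k (Metric.ball 0 R) :=
    fun w hw ↦ (hk w hw).differentiableAt.differentiableWithinAt
  have hzR : z ∈ Metric.ball (0 : ℂ) R := by simpa using lt_of_le_of_lt hz hrR
  rw [← (hk z hzR).deriv]
  have hδ : 0 < (R - r) / 2 := by linarith
  have hsub : Metric.closedBall z ((R - r) / 2) ⊆ Metric.ball 0 R := by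
    intro w hw
    simp only [Metric.mem_closedBall, dist_eq_norm, mem_ball_zero_iff] at hw ⊢
    have : ‖w‖ ≤ ‖w - z‖ + ‖z‖ := by simpa using norm_add_le (w - z) z
    linarith
  have := Complex.norm_deriv_le_of_forall_mem_sphere_norm_le (c := z) (R := (R - r) / 2)
    (C := 4 * L' * R / (R - r)) hδ
    ((hkd.mono (by rw [closure_ball z hδ.ne']; exact hsub)).diffContOnCl) (by
      intro w hw
      have hw' := hsub (Metric.sphere_subset_closedBall hw)
      refine (borelCaratheodory_zero hL'0 hkd hre hR hw' hk0).trans ?_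
      simp only [mem_sphere_iff_norm] at hw
      have h1 : ‖w‖ ≤ ‖w - z‖ + ‖z‖ := by simpa using norm_add_le (w - z) z
      have h2 : (R - r) / 2 ≤ R - ‖w‖ := by linarith
      have h3 : ‖w‖ ≤ R := by linarith
      calc 2 * L' * ‖w‖ / (R - ‖w‖) ≤ 2 * L' * R / ((R - r) / 2) := by gcongr
        _ = 4 * L' * R / (R - r) := by field_simp; norm_num)
  refine this.trans (le_of_eq ?_)
  have : R - r ≠ 0 := by linarith
  field_simp
  norm_num

lemma neg_mul_le_re_logDeriv {R R' r : ℝ} (hr : 0 < r) (hrR' : r < R') (hR' : R' < R) :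
    ∃ C : ℝ, 0 < C ∧ ∀ (g : ℂ → ℂ) (L : ℝ), Differentiable ℂ g → 0 ≤ L → g 0 ≠ 0 →
      (∀ z ∈ Metric.closedBall (0 : ℂ) R, ‖g z‖ ≤ ‖g 0‖ * Real.exp L) →
      (∀ z, ‖z‖ ≤ R' → g z = 0 → z.re ≤ -r) → ∀ x : ℝ, -r < x → x ≤ 0 →
      -C * L ≤ (deriv g x / g x).re := by
  set d := Real.log (R / R') with hd
  have hd0 : 0 < d := Real.log_pos (by rw [lt_div_iff₀ (by linarith)]; linarith)
  set E := R' / (R ^ 2 - R' * r) with hE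
  have hE0 : 0 < R ^ 2 - R' * r := by nlinarith
  set C := 8 * R' / (R' - r) ^ 2 + E / d with hC
  have hR'0 : 0 < R' := by linarith
  have hR0 : 0 < R := by linarith
  have hE1 : 0 < E := by positivity
  have hCd : E ≤ C * d := by
    rw [hC, add_mul, div_mul_cancel₀ _ hd0.ne']
    have : 0 ≤ 8 * R' / (R' - r) ^ 2 * d := by positivity
    linarith
  have hCpos : 0 < C := by
    have : 0 ≤ 8 * R' / (R' - r) ^ 2 := by positivity
    have : 0 < E / d := by positivity
    linarith
  refine ⟨C, hCpos, ?_⟩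
  suffices H : ∀ (n : ℕ) (g : ℂ → ℂ) (L : ℝ), L ≤ n * d → Differentiable ℂ g → 0 ≤ L → g 0 ≠ 0 →
      (∀ z ∈ Metric.closedBall (0 : ℂ) R, ‖g z‖ ≤ ‖g 0‖ * Real.exp L) →
      (∀ z, ‖z‖ ≤ R' → g z = 0 → z.re ≤ -r) → ∀ x : ℝ, -r < x → x ≤ 0 →
      -C * L ≤ (deriv g x / g x).re by
    intro g L
    obtain ⟨n, hn⟩ := exists_nat_ge (L / d)
    exact H n g L (by rwa [div_le_iff₀ hd0] at hn)
  intro n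
  induction n with
  | zero => ?_
  | succ n ih => ?_
  all_goals
    intro g L hLn hg hL hg0 hb hz x hx hx0
    by_cases hzero : ∃ ρ, ‖ρ‖ ≤ R' ∧ g ρ = 0
    swap
    · push Not at hzero
      have h1 := norm_logDeriv_le_of_norm_le (z := x) hr.le hrR' hL hg.differentiableOn
        (fun z hz ↦ hzero z (by simpa using (mem_ball_zero_iff.1 hz).le))
        (fun z hz ↦ hb z (by
          simp only [mem_closedBall_zero_iff, mem_ball_zero_iff] at hz ⊢; linarith))
        (by rw [Complex.norm_real, Real.norm_eq_abs, abs_le]; constructor <;> linarith)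
      have h2 := (abs_le.1 ((Complex.abs_re_le_norm (deriv g x / g x)).trans h1)).1
      refine le_trans ?_ h2
      rw [neg_mul, neg_le_neg_iff]
      gcongr
      rw [hC]
      have : 0 ≤ E / d := by positivity
      linarith
    obtain ⟨ρ, hρ, hgρ⟩ := hzero
    have hρ0 : ρ ≠ 0 := fun h ↦ hg0 (h ▸ hgρ)
    have hρr := hz ρ hρ hgρ
    set D := dslope g ρ with hD
    have hDd : Differentiable ℂ D := by
      rw [← differentiableOn_univ] at hg ⊢
      exact (differentiableOn_dslope Filter.univ_mem).2 hg
    have hgD : ∀ z, g z = (z - ρ) * D z := fun z ↦ by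
      have := sub_smul_dslope g ρ z
      rw [hgρ, sub_zero, smul_eq_mul] at this
      exact this.symm
    set h : ℂ → ℂ := fun z ↦ D z * (R ^ 2 - (starRingEnd ℂ) ρ * z) / R with hh
    have hhd : Differentiable ℂ h := by fun_prop
    have hRc : (R : ℂ) ≠ 0 := by exact_mod_cast hR0.ne'
    have hh0 : h 0 = D 0 * R := by simp only [hh]; field_simp; ring
    have hg00 : g 0 = -ρ * D 0 := by rw [hgD]; ring
    have hD0 : D 0 ≠ 0 := fun h ↦ hg0 (by rw [hg00, h, mul_zero])
    have hh00 : h 0 ≠ 0 := by rw [hh0]; exact mul_ne_zero hD0 hRc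
    have hnorm0 : ‖g 0‖ * Real.exp d ≤ ‖h 0‖ := by
      rw [hh0, hg00, hd, Real.exp_log (by positivity), norm_mul, norm_mul, norm_neg,
        Complex.norm_real, Real.norm_of_nonneg hR0.le]
      calc ‖ρ‖ * ‖D 0‖ * (R / R') ≤ R' * ‖D 0‖ * (R / R') := by gcongr
        _ = ‖D 0‖ * R := by field_simp
    have hbs : ∀ z ∈ Metric.closedBall (0 : ℂ) R, ‖h z‖ ≤ ‖h 0‖ * Real.exp (L - d) := by
      intro z hz
      refine Complex.norm_le_of_forall_mem_frontier_norm_le (U := Metric.ball (0 : ℂ) R)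
        Metric.isBounded_ball hhd.diffContOnCl ?_ (by rwa [closure_ball _ hR0.ne'])
      intro w hw
      rw [frontier_ball _ hR0.ne', mem_sphere_zero_iff_norm] at hw
      have hw2 : (starRingEnd ℂ) w * w = R ^ 2 := by
        rw [← Complex.normSq_eq_conj_mul_self, Complex.normSq_eq_norm_sq, hw]; push_cast; ring
      have e1 : ‖(R : ℂ) ^ 2 - (starRingEnd ℂ) ρ * w‖ = R * ‖w - ρ‖ := by
        rw [← hw2, ← sub_mul, ← map_sub, norm_mul, RCLike.norm_conj, hw, mul_comm]
      have e2 : ‖h w‖ = ‖g w‖ := by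
        simp only [hh]
        rw [norm_div, norm_mul, e1, hgD, norm_mul, Complex.norm_real, Real.norm_of_nonneg hR0.le]
        field_simp
      rw [e2]
      calc ‖g w‖ ≤ ‖g 0‖ * Real.exp L := hb w (by simp [hw])
        _ = (‖g 0‖ * Real.exp d) * Real.exp (L - d) := by
          rw [mul_assoc, ← Real.exp_add]; ring_nf
        _ ≤ _ := by gcongr
    have hLd : 0 ≤ L - d := by
      have := hbs 0 (by simp [hR0.le])
      have h1 : 1 ≤ Real.exp (L - d) := by
        have hp := norm_pos_iff.2 hh00
        nlinarith
      exact Real.one_le_exp_iff.1 h1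
  · exfalso
    simp only [Nat.cast_zero, zero_mul] at hLn
    linarith
  have hsmall : ∀ z : ℂ, ‖z‖ ≤ R' → (R : ℂ) ^ 2 - (starRingEnd ℂ) ρ * z ≠ 0 := by
    intro z hz h0
    have : ‖(R : ℂ) ^ 2‖ = ‖(starRingEnd ℂ) ρ * z‖ := by rw [sub_eq_zero.1 h0]
    rw [norm_mul, norm_pow, RCLike.norm_conj, Complex.norm_real, Real.norm_of_nonneg hR0.le] at this
    nlinarith [norm_nonneg ρ, norm_nonneg z, mul_le_mul hρ hz (norm_nonneg z) hR'0.le]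
  have ih' := ih h (L - d) (by push_cast at hLn; linarith) hhd hLd hh00 hbs (by
    intro z hz' h0
    refine hz z hz' ?_
    simp only [hh, div_eq_zero_iff, mul_eq_zero, hRc, hsmall z hz', or_false] at h0
    rw [hgD, h0, mul_zero]) x hx hx0
  have hxn : ‖(x : ℂ)‖ ≤ r := by
    rw [Complex.norm_real, Real.norm_eq_abs, abs_le]; constructor <;> linarith
  have hxs := hsmall x (by linarith)
  have hxρ : (x : ℂ) - ρ ≠ 0 := fun h0 ↦ by
    have := congrArg Complex.re h0
    simp at this; linarith
  have hDx : D x ≠ 0 := by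
    intro h0
    have := hz x (by linarith) (by rw [hgD, h0, mul_zero])
    simp at this; linarith
  have dg : deriv g x = D x + (x - ρ) * deriv D x := by
    have : g = fun z ↦ (z - ρ) * D z := funext hgD
    rw [this]
    have h1 := (((hasDerivAt_id (x : ℂ)).sub_const ρ).mul (hDd x).hasDerivAt).deriv
    simp only [id, one_mul] at h1
    exact h1
  have dh : deriv h x = (deriv D x * (R ^ 2 - (starRingEnd ℂ) ρ * x) -
      D x * (starRingEnd ℂ) ρ) / R := by
    have h1 := (((hDd x).hasDerivAt.mul
      (((hasDerivAt_id (x : ℂ)).const_mul ((starRingEnd ℂ) ρ)).const_sub ((R : ℂ) ^ 2))).div_const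
      (R : ℂ)).deriv
    simp only [id, mul_one] at h1
    refine Eq.trans h1 ?_
    ring
  have hkey : deriv g x / g x = deriv h x / h x + 1 / (x - ρ) +
      (starRingEnd ℂ) ρ / (R ^ 2 - (starRingEnd ℂ) ρ * x) := by
    rw [dg, dh, hgD]
    simp only [hh]
    generalize (R : ℂ) ^ 2 - (starRingEnd ℂ) ρ * x = Q at hxs ⊢
    field_simp
    ring
  have hpos : 0 ≤ (1 / ((x : ℂ) - ρ)).re := by
    rw [one_div, Complex.inv_re]
    apply div_nonneg _ (Complex.normSq_nonneg _)
    simp; linarith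
  have hsec : -E ≤ ((starRingEnd ℂ) ρ / (R ^ 2 - (starRingEnd ℂ) ρ * x)).re := by
    refine (abs_le.1 ((Complex.abs_re_le_norm _).trans ?_)).1
    rw [norm_div, RCLike.norm_conj, hE]
    have : R ^ 2 - R' * r ≤ ‖(R : ℂ) ^ 2 - (starRingEnd ℂ) ρ * x‖ := by
      have h1 := norm_sub_norm_le ((R : ℂ) ^ 2) ((starRingEnd ℂ) ρ * x)
      rw [norm_mul, norm_pow, RCLike.norm_conj, Complex.norm_real R,
        Real.norm_of_nonneg hR0.le] at h1
      have := mul_le_mul hρ hxn (norm_nonneg _) hR'0.le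
      linarith
    gcongr
  rw [hkey, Complex.add_re, Complex.add_re]
  nlinarith

lemma DirichletCharacter.sum_range_level {q : ℕ} [NeZero q] {χ : DirichletCharacter ℂ q}
    (hχ : χ ≠ 1) : ∑ k ∈ Finset.range q, χ (k : ZMod q) = 0 := by
  rw [← MulChar.sum_eq_zero_of_ne_one hχ]
  refine Finset.sum_nbij' (fun k ↦ (k : ZMod q)) ZMod.val ?_ ?_ ?_ ?_ ?_
  · simp
  · intro a _; simpa using ZMod.val_lt a
  · intro k hk; exact ZMod.val_cast_of_lt (by simpa using hk)
  · intro a _; exact ZMod.natCast_zmod_val a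
  · simp

lemma DirichletCharacter.norm_sum_range_le {q : ℕ} [NeZero q] {χ : DirichletCharacter ℂ q}
    (hχ : χ ≠ 1) (n : ℕ) : ‖∑ k ∈ Finset.range n, χ (k : ZMod q)‖ ≤ q := by
  induction n using Nat.strong_induction_on with
  | _ n ih =>
    rcases lt_or_ge n q with h | h
    · refine (norm_sum_le_of_le _ (fun k _ ↦ χ.norm_le_one _)).trans ?_
      simpa using h.le
    · obtain ⟨m, rfl⟩ := Nat.exists_eq_add_of_le h
      rw [Finset.sum_range_add, DirichletCharacter.sum_range_level hχ, zero_add]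
      simpa using ih m (by have := NeZero.pos q; omega)

lemma DirichletCharacter.norm_sum_Icc_le {q : ℕ} [NeZero q] {χ : DirichletCharacter ℂ q}
    (hq : 1 < q) (hχ : χ ≠ 1) (n : ℕ) : ‖∑ k ∈ Finset.Icc 1 n, χ (k : ZMod q)‖ ≤ q := by
  have : Fact (1 < q) := ⟨hq⟩
  have h : ∑ k ∈ Finset.Icc 1 n, χ (k : ZMod q) = ∑ k ∈ Finset.range (n + 1), χ (k : ZMod q) := by
    refine Finset.sum_subset (fun k hk ↦ ?_) (fun k hk hk' ↦ ?_)
    · simp only [Finset.mem_Icc, Finset.mem_range] at hk ⊢; omega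
    · have : k = 0 := by simp only [Finset.mem_Icc, Finset.mem_range] at hk hk'; omega
      subst this
      simp [MulChar.map_zero]
  rw [h]
  exact norm_sum_range_le hχ _

open MeasureTheory Asymptotics in
lemma DirichletCharacter.norm_LFunction_le {q : ℕ} [NeZero q] {χ : DirichletCharacter ℂ q}
    (hq : 1 < q) (hχ : χ ≠ 1) {s : ℂ} (hs : 0 < s.re) :
    ‖LFunction χ s‖ ≤ q * ‖s‖ / s.re := by
  set A : ℝ → ℂ := fun t ↦ ∑ k ∈ Finset.Icc 1 ⌊t⌋₊, χ (k : ZMod q) with hA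
  have hAb : ∀ t, ‖A t‖ ≤ q := fun t ↦ norm_sum_Icc_le hq hχ _
  have hA0 : ∀ t < 1, A t = 0 := fun t ht ↦ by simp [hA, Nat.floor_eq_zero.2 ht]
  have hloc : LocallyIntegrableOn A (Set.Ioi 0) := by
    have := locallyIntegrableOn_mul_sum_Icc (fun k : ℕ ↦ χ (k : ZMod q)) (m := 1) le_rfl
      (g := fun _ ↦ (1 : ℂ)) (a := 0)
      (continuousOn_const.locallyIntegrableOn measurableSet_Ici)
    simpa [hA] using this.mono_set Set.Ioi_subset_Ici_self
  have htop : A =O[Filter.atTop] (fun t : ℝ ↦ t ^ (-(0 : ℝ))) := by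
    refine IsBigO.of_bound q (Filter.Eventually.of_forall fun t ↦ ?_)
    simpa using hAb t
  have hbot : ∀ b : ℝ, A =O[nhdsWithin 0 (Set.Ioi 0)] (fun t : ℝ ↦ t ^ (-b)) := fun b ↦ by
    refine IsBigO.of_bound 1 ?_
    filter_upwards [nhdsWithin_le_nhds (Iio_mem_nhds (zero_lt_one' ℝ))] with t ht
    rw [hA0 t ht]; simp
  have hdiff : ∀ s : ℂ, 0 < s.re → DifferentiableAt ℂ (fun s ↦ s * mellin A (-s)) s := by
    intro s hs
    have := mellin_differentiableAt_of_isBigO_rpow (s := -s) hloc htop (by simpa using hs)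
      (hbot ((-s).re - 1)) (by linarith)
    have h2 : DifferentiableAt ℂ (mellin A ∘ fun s ↦ -s) s :=
      DifferentiableAt.comp (g := mellin A) (f := fun s ↦ -s) s this differentiableAt_id.neg
    exact differentiableAt_id.mul h2
  have h_integr : ∀ s : ℂ, mellin A (-s) = ∫ t in Set.Ioi (1 : ℝ), A t * t ^ (-(s + 1)) := by
    intro s
    rw [← integral_Ici_eq_integral_Ioi]
    calc mellin A (-s) = ∫ t in Set.Ioi (0 : ℝ), A t * t ^ (-(s + 1)) := by
          refine setIntegral_congr_fun measurableSet_Ioi fun t _ ↦ ?_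
          simp only [smul_eq_mul]
          rw [mul_comm, show -s - 1 = -(s + 1) by ring]
      _ = _ := by
          refine setIntegral_eq_of_subset_of_forall_sdiff_eq_zero measurableSet_Ioi
            (fun t (ht : 1 ≤ t) ↦ zero_lt_one.trans_le ht) (fun t ht ↦ ?_)
          rw [hA0 t (by simpa using ht.2), zero_mul]
  have heq : ∀ s : ℂ, 1 < s.re → LFunction χ s = s * mellin A (-s) := by
    intro s hs
    rw [LFunction_eq_LSeries χ hs, h_integr]
    refine LSeries_eq_mul_integral _ le_rfl (by linarith) (χ.LSeriesSummable_of_one_lt_re hs) ?_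
    refine IsBigO.of_bound q (Filter.Eventually.of_forall fun n ↦ ?_)
    simpa using norm_sum_Icc_le hq hχ n
  have hopen : IsOpen {s : ℂ | 0 < s.re} := isOpen_lt continuous_const continuous_re
  have hEqOn : Set.EqOn (LFunction χ) (fun s ↦ s * mellin A (-s)) {s : ℂ | 0 < s.re} := by
    refine AnalyticOnNhd.eqOn_of_preconnected_of_eventuallyEq (z₀ := 2)
      ((differentiable_LFunction hχ).differentiableOn.analyticOnNhd hopen)
      (DifferentiableOn.analyticOnNhd (fun s hs ↦ (hdiff s hs).differentiableWithinAt) hopen)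
      (convex_halfSpace_re_gt 0).isPreconnected (by simp) ?_
    filter_upwards [(isOpen_lt continuous_const continuous_re).mem_nhds
      (show (1 : ℝ) < (2 : ℂ).re by norm_num)] with s hs using heq s hs
  rw [hEqOn hs]
  beta_reduce
  rw [h_integr, norm_mul]
  have hb : ‖∫ t in Set.Ioi (1 : ℝ), A t * t ^ (-(s + 1))‖ ≤
      ∫ t in Set.Ioi (1 : ℝ), (q : ℝ) * t ^ (-s.re - 1) := by
    refine norm_integral_le_of_norm_le
      ((integrableOn_Ioi_rpow_of_lt (by linarith) one_pos).const_mul _) ?_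
    refine (ae_restrict_iff' measurableSet_Ioi).2 (Filter.Eventually.of_forall fun t ht ↦ ?_)
    have ht0 : (0 : ℝ) < t := by simp at ht; linarith
    rw [norm_mul, norm_cpow_eq_rpow_re_of_pos ht0]
    have : (-(s + 1)).re = -s.re - 1 := by simp; ring
    rw [this]
    gcongr
    exact hAb t
  rw [integral_const_mul, integral_Ioi_rpow_of_lt (by linarith) one_pos] at hb
  refine (mul_le_mul_of_nonneg_left hb (norm_nonneg s)).trans (le_of_eq ?_)
  simp
  field_simp

lemma DirichletCharacter.norm_LFunction_two_add_ge {q : ℕ} [NeZero q] (χ : DirichletCharacter ℂ q)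
    {s : ℂ} (hs : s.re = 2) : 2 - Real.pi ^ 2 / 6 ≤ ‖LFunction χ s‖ := by
  rw [LFunction_eq_LSeries χ (by linarith)]
  have hsum : LSeriesSummable (χ ·) s := χ.LSeriesSummable_of_one_lt_re (by linarith)
  have hz := hasSum_zeta_two
  have hb : ∀ n, ‖LSeries.term (χ ·) s n‖ ≤ 1 / (n : ℝ) ^ 2 := by
    intro n
    refine (LSeries.norm_term_le s (g := 1) (by simpa using χ.norm_le_one _)).trans ?_
    rw [LSeries.norm_term_eq]
    split_ifs with h
    · simp [h]
    · simp [hs]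
  have h1 : LSeries (χ ·) s = LSeries.term (χ ·) s 1 +
      ∑' n, ite (n = 1) 0 (LSeries.term (χ ·) s n) := Summable.tsum_eq_add_tsum_ite hsum 1
  have h2 : ∑' n : ℕ, (1 / (n : ℝ) ^ 2) = 1 + ∑' n : ℕ, ite (n = 1) 0 (1 / (n : ℝ) ^ 2) := by
    simpa using Summable.tsum_eq_add_tsum_ite hz.summable 1
  have h3 : ‖∑' n, ite (n = 1) 0 (LSeries.term (χ ·) s n)‖ ≤
      ∑' n : ℕ, ite (n = 1) 0 (1 / (n : ℝ) ^ 2) := by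
    refine tsum_of_norm_bounded (Summable.hasSum ?_) fun n ↦ ?_
    · refine Summable.of_nonneg_of_le (fun n ↦ ?_) (fun n ↦ ?_) hz.summable
      · split_ifs <;> positivity
      · split_ifs
        · positivity
        · exact le_rfl
    · split_ifs
      · simp
      · exact hb n
  have h4 : LSeries.term (χ ·) s 1 = 1 := by simp [LSeries.term]
  rw [hz.tsum_eq] at h2
  rw [h1, h4]
  have h5 := norm_sub_norm_le (1 : ℂ) (-∑' n, ite (n = 1) 0 (LSeries.term (χ ·) s n))
  rw [norm_neg, sub_neg_eq_add, norm_one] at h5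
  linarith

lemma one_le_log_abs_add_four (u : ℝ) : 1 ≤ Real.log (|u| + 4) := by
  rw [Real.le_log_iff_exp_le (by positivity)]
  have := Real.exp_one_lt_d9
  have := abs_nonneg u
  linarith

lemma DirichletCharacter.exists_norm_LFunction_le_exp_log {q : ℕ} [NeZero q]
    {χ : DirichletCharacter ℂ q} (hq : 1 < q) (hχ : χ ≠ 1) :
    ∃ κ : ℝ, 0 < κ ∧ ∀ (u : ℝ) (z : ℂ), ‖z‖ ≤ 7 / 4 →
      ‖LFunction χ (z + (2 + u * I))‖ ≤
        ‖LFunction χ (2 + u * I)‖ * Real.exp (κ * Real.log (|u| + 4)) := by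
  set c : ℝ := 2 - Real.pi ^ 2 / 6 with hc
  have hc0 : 0 < c := by
    have := Real.pi_lt_d2
    have := Real.pi_pos
    nlinarith
  set M : ℝ := 4 * q / c with hM
  have hM0 : 0 ≤ M := by positivity
  refine ⟨1 + M, by positivity, fun u z hz ↦ ?_⟩
  have hlog := one_le_log_abs_add_four u
  have hre : 1 / 4 ≤ (z + (2 + u * I)).re := by
    have := (abs_le.1 (abs_re_le_norm z)).1
    simp; linarith
  have hnorm : ‖z + (2 + u * I)‖ ≤ |u| + 4 := by
    have h1 := norm_add_le z (2 + u * I)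
    have h2 := norm_add_le (2 : ℂ) (u * I)
    have h3 : ‖(u * I : ℂ)‖ = |u| := by simp
    have h4 : ‖(2 : ℂ)‖ = 2 := by simp
    linarith
  have hlow : c ≤ ‖LFunction χ (2 + u * I)‖ := norm_LFunction_two_add_ge χ (by simp)
  have hexp : M * (|u| + 4) ≤ Real.exp ((1 + M) * Real.log (|u| + 4)) := by
    rw [add_mul, one_mul, Real.exp_add, Real.exp_log (by positivity), mul_comm]
    gcongr
    calc M ≤ M * Real.log (|u| + 4) := le_mul_of_one_le_right hM0 hlog
      _ ≤ _ := by have := Real.add_one_le_exp (M * Real.log (|u| + 4)); linarith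
  calc ‖LFunction χ (z + (2 + u * I))‖ ≤ q * ‖z + (2 + u * I)‖ / (z + (2 + u * I)).re :=
        norm_LFunction_le hq hχ (by linarith)
    _ ≤ q * (|u| + 4) / (1 / 4) := by gcongr
    _ = c * (M * (|u| + 4)) := by rw [hM]; field_simp
    _ ≤ _ := by gcongr

lemma deriv_div_comp_add_const (f : ℂ → ℂ) (w z : ℂ) :
    deriv (fun z ↦ f (z + w)) z / f (z + w) = deriv f (z + w) / f (z + w) := by
  rw [deriv_comp_add_const]

lemma DirichletCharacter.exists_neg_log_le_re_logDeriv {q : ℕ} [NeZero q]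
    {χ : DirichletCharacter ℂ q} (hq : 1 < q) (hχ : χ ≠ 1)
    (hne : ∀ s : ℂ, 1 / 2 < s.re → LFunction χ s ≠ 0) :
    ∃ A : ℝ, 0 < A ∧ ∀ s : ℂ, 1 / 2 < s.re → s.re ≤ 2 →
      -A * Real.log (|s.im| + 4) ≤ (deriv (LFunction χ) s / LFunction χ s).re := by
  obtain ⟨κ, hκ, hbd⟩ := exists_norm_LFunction_le_exp_log hq hχ
  obtain ⟨C, hC, h⟩ := neg_mul_le_re_logDeriv (R := 7 / 4) (R' := 13 / 8) (r := 3 / 2)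
    (by norm_num) (by norm_num) (by norm_num)
  refine ⟨C * κ, by positivity, fun s hs1 hs2 ↦ ?_⟩
  have hlog := one_le_log_abs_add_four s.im
  have hsw : ((s.re - 2 : ℝ) : ℂ) + (2 + s.im * I) = s := by
    apply Complex.ext <;> simp
  have := h (fun z ↦ LFunction χ (z + (2 + s.im * I))) (κ * Real.log (|s.im| + 4))
    ((differentiable_LFunction hχ).comp (differentiable_id.add_const _)) (by positivity)
    (hne _ (by simp; norm_num))
    (fun z hz ↦ by simpa using hbd s.im z (by simpa using hz))
    (fun z _ hz0 ↦ by
      by_contra! hcon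
      exact hne _ (by simp; linarith) hz0)
    (s.re - 2) (by linarith) (by linarith)
  rw [deriv_div_comp_add_const, hsw] at this
  linarith

lemma DirichletCharacter.exists_norm_logDeriv_le_log {q : ℕ} [NeZero q]
    {χ : DirichletCharacter ℂ q} (hq : 1 < q) (hχ : χ ≠ 1)
    (hne : ∀ s : ℂ, 1 / 2 < s.re → LFunction χ s ≠ 0) {σ : ℝ} (hσ : 1 / 2 < σ) :
    ∃ C : ℝ, 0 ≤ C ∧ ∀ s : ℂ, σ ≤ s.re → s.re ≤ 2 →
      ‖deriv (LFunction χ) s / LFunction χ s‖ ≤ C * Real.log (|s.im| + 4) := by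
  obtain ⟨κ, hκ, hbd⟩ := exists_norm_LFunction_le_exp_log hq hχ
  rcases le_or_gt σ 2 with hσ2 | hσ2
  swap
  · exact ⟨0, le_rfl, fun s h1 h2 ↦ by linarith⟩
  refine ⟨8 * (3 / 2) / (3 / 2 - (2 - σ)) ^ 2 * κ, by positivity, fun s hs1 hs2 ↦ ?_⟩
  have hlog := one_le_log_abs_add_four s.im
  have hsw : ((s.re - 2 : ℝ) : ℂ) + (2 + s.im * I) = s := by
    apply Complex.ext <;> simp
  have := norm_logDeriv_le_of_norm_le (g := fun z ↦ LFunction χ (z + (2 + s.im * I)))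
    (R := 3 / 2) (r := 2 - σ) (L := κ * Real.log (|s.im| + 4)) (by linarith) (by linarith)
    (by positivity)
    ((differentiable_LFunction hχ).comp (differentiable_id.add_const _)).differentiableOn
    (fun z hz ↦ by
      refine hne _ ?_
      have := (abs_le.1 (abs_re_le_norm z)).1
      rw [mem_ball_zero_iff] at hz
      simp; linarith)
    (fun z hz ↦ by
      rw [mem_ball_zero_iff] at hz
      simpa using hbd s.im z (by linarith))
    (z := ((s.re - 2 : ℝ) : ℂ)) (by
      rw [norm_real, Real.norm_eq_abs, abs_le]; constructor <;> linarith)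
  rw [deriv_div_comp_add_const, hsw] at this
  linarith

open ArithmeticFunction in
lemma summable_vonMangoldt_div_rpow {σ : ℝ} (hσ : 1 < σ) :
    Summable fun n : ℕ ↦ vonMangoldt n / (n : ℝ) ^ σ := by
  have h := (LSeriesSummable_vonMangoldt (s := σ) (by simpa using hσ)).norm
  refine h.congr fun n ↦ ?_
  rw [LSeries.norm_term_eq]
  split_ifs with hn
  · simp [hn]
  · simp [abs_of_nonneg vonMangoldt_nonneg]

open ArithmeticFunction in
lemma norm_vonMangoldt_mul_div_cpow_le {q : ℕ} (χ : DirichletCharacter ℂ q) (s : ℂ) (n : ℕ) :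
    ‖(vonMangoldt n : ℂ) * χ (n : ZMod q) / (n : ℂ) ^ s‖ ≤ vonMangoldt n / (n : ℝ) ^ s.re := by
  rcases n.eq_zero_or_pos with rfl | hn
  · simp
  · rw [norm_div, norm_mul, norm_natCast_cpow_of_pos hn, norm_real, Real.norm_eq_abs,
      abs_of_nonneg vonMangoldt_nonneg]
    gcongr
    exact mul_le_of_le_one_right vonMangoldt_nonneg (χ.norm_le_one _)

open ArithmeticFunction in
lemma DirichletCharacter.hasSum_vonMangoldt_logDeriv {q : ℕ} [NeZero q]
    (χ : DirichletCharacter ℂ q) {s : ℂ} (hs : 1 < s.re) :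
    HasSum (fun n : ℕ ↦ (vonMangoldt n : ℂ) * χ (n : ZMod q) / (n : ℂ) ^ s)
      (-(deriv (LFunction χ) s / LFunction χ s)) := by
  have h1 := (DirichletCharacter.LSeriesSummable_twist_vonMangoldt χ hs).hasSum
  have h2 := DirichletCharacter.LSeries_twist_vonMangoldt_eq χ hs
  rw [LSeries] at h2
  rw [h2, ← deriv_LFunction_eq_deriv_LSeries χ hs, ← LFunction_eq_LSeries χ hs, neg_div] at h1
  refine h1.congr_fun fun n ↦ ?_
  rcases n.eq_zero_or_pos with rfl | hn
  · simp
  · simp [LSeries.term_of_ne_zero hn.ne', mul_comm]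

open ArithmeticFunction in
lemma DirichletCharacter.exists_norm_logDeriv_le_of_re_eq_two {q : ℕ} [NeZero q]
    (χ : DirichletCharacter ℂ q) :
    ∃ B : ℝ, 0 ≤ B ∧ ∀ s : ℂ, s.re = 2 → ‖deriv (LFunction χ) s / LFunction χ s‖ ≤ B := by
  refine ⟨∑' n : ℕ, vonMangoldt n / (n : ℝ) ^ (2 : ℝ),
    tsum_nonneg fun n ↦ div_nonneg vonMangoldt_nonneg (by positivity), fun s hs ↦ ?_⟩
  have h := hasSum_vonMangoldt_logDeriv χ (s := s) (by linarith)
  rw [← norm_neg, ← h.tsum_eq]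
  refine tsum_of_norm_bounded (summable_vonMangoldt_div_rpow one_lt_two).hasSum fun n ↦ ?_
  simpa [hs] using norm_vonMangoldt_mul_div_cpow_le χ s n

lemma integrable_exp_neg_sq_div_two : MeasureTheory.Integrable fun v : ℝ ↦ Real.exp (-(v ^ 2 / 2)) :=
  (integrable_exp_neg_mul_sq (b := 1 / 2) (by norm_num)).congr
    (Filter.Eventually.of_forall fun v ↦ by beta_reduce; congr 1; ring)

open MeasureTheory Filter in
/-- Vertical contour shift for a function with Gaussian decay in a strip. -/
lemma integral_vertical_eq_of_norm_le_gaussian {F : ℂ → ℂ} {a b K : ℝ} (hab : a ≤ b)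
    (hF : DifferentiableOn ℂ F (Complex.re ⁻¹' Set.Icc a b))
    (hK : ∀ x ∈ Set.Icc a b, ∀ v : ℝ, ‖F (x + v * I)‖ ≤ K * Real.exp (-(v ^ 2 / 2))) :
    ∫ v : ℝ, F (a + v * I) = ∫ v : ℝ, F (b + v * I) := by
  have h_integr : ∀ x ∈ Set.Icc a b, Integrable fun v : ℝ ↦ F (x + v * I) := by
    intro x hx
    refine Integrable.mono' (integrable_exp_neg_sq_div_two.const_mul K) ?_
      (Eventually.of_forall (hK x hx))
    refine Continuous.aestronglyMeasurable ?_
    exact hF.continuousOn.comp_continuous (by fun_prop) (fun v ↦ by simpa using hx)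
  have hgauss : Tendsto (fun T : ℝ ↦ K * Real.exp (-(T ^ 2 / 2)) * (b - a)) atTop (nhds 0) := by
    have h1 : Tendsto (fun T : ℝ ↦ T ^ 2 / 2) atTop atTop :=
      (tendsto_pow_atTop two_ne_zero).atTop_div_const two_pos
    have := (((Real.tendsto_exp_neg_atTop_nhds_zero).comp h1).const_mul K).mul_const (b - a)
    simpa using this
  have hhor : ∀ v : ℝ, ‖∫ x in a..b, F (x + v * I)‖ ≤ K * Real.exp (-(v ^ 2 / 2)) * (b - a) := by
    intro v
    have := intervalIntegral.norm_integral_le_of_norm_le_const (a := a) (b := b)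
      (f := fun x : ℝ ↦ F (x + v * I)) (C := K * Real.exp (-(v ^ 2 / 2))) (fun x hx ↦ by
        rw [Set.uIoc_of_le hab] at hx
        exact hK x ⟨hx.1.le, hx.2⟩ v)
    rwa [abs_of_nonneg (by linarith)] at this
  have hrect : ∀ T : ℝ, (∫ v in (-T)..T, F (b + v * I)) - ∫ v in (-T)..T, F (a + v * I) =
      I * ((∫ x in a..b, F (x + ((-T : ℝ) : ℂ) * I)) - ∫ x in a..b, F (x + (T : ℂ) * I)) := by
    intro T
    have := integral_boundary_rect_eq_zero_of_differentiableOn F (a + ((-T : ℝ) : ℂ) * I)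
      (b + (T : ℂ) * I) (hF.mono (fun z hz ↦ by
        have := (mem_reProdIm.1 hz).1
        simpa [Set.uIcc_of_le hab] using this))
    simp only [add_re, ofReal_re, mul_re, I_re, mul_zero, ofReal_im, I_im, mul_one, sub_self,
      add_zero, add_im, mul_im, zero_add, smul_eq_mul] at this
    linear_combination (-I) * this +
      ((∫ v in (-T)..T, F (b + v * I)) - ∫ v in (-T)..T, F (a + v * I)) * (I_mul_I)
  have hlim : ∀ x ∈ Set.Icc a b, Tendsto (fun T : ℝ ↦ ∫ v in (-T)..T, F (x + v * I)) atTop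
      (nhds (∫ v : ℝ, F (x + v * I))) := fun x hx ↦
    intervalIntegral_tendsto_integral (h_integr x hx) tendsto_neg_atTop_atBot tendsto_id
  have hzero : Tendsto (fun T : ℝ ↦ (∫ v in (-T)..T, F (b + v * I)) -
      ∫ v in (-T)..T, F (a + v * I)) atTop (nhds 0) := by
    refine squeeze_zero_norm (fun T ↦ ?_) (by simpa using hgauss.const_mul 2)
    rw [hrect, norm_mul, norm_I, one_mul]
    have h1 := hhor T
    have h2 := hhor (-T)
    rw [neg_sq] at h2
    refine (norm_sub_le _ _).trans ?_
    linarith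
  have := tendsto_nhds_unique hzero ((hlim b ⟨hab, le_rfl⟩).sub (hlim a ⟨le_rfl, hab⟩))
  exact (sub_eq_zero.1 this.symm).symm

lemma norm_cexp_gaussian_weight (d y v : ℝ) :
    ‖cexp ((d + v * I) * y + (d + v * I) ^ 2)‖ = Real.exp (d * y + d ^ 2) * Real.exp (-v ^ 2) := by
  rw [norm_exp, ← Real.exp_add]
  congr 1
  simp [sq]
  ring

open MeasureTheory in
lemma norm_integral_mul_gaussian_weight_le {h : ℝ → ℂ} {B : ℝ} (hB : ∀ v, ‖h v‖ ≤ B) (d y : ℝ) :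
    ‖∫ v : ℝ, h v * cexp ((d + v * I) * y + (d + v * I) ^ 2)‖ ≤
      B * √Real.pi * Real.exp (d * y + d ^ 2) := by
  have hg : Integrable fun v : ℝ ↦ Real.exp (-1 * v ^ 2) := integrable_exp_neg_mul_sq one_pos
  have := norm_integral_le_of_norm_le (μ := volume)
    (f := fun v : ℝ ↦ h v * cexp ((d + v * I) * y + (d + v * I) ^ 2))
    (hg.const_mul (B * Real.exp (d * y + d ^ 2))) (Filter.Eventually.of_forall fun v ↦ by
      rw [norm_mul, norm_cexp_gaussian_weight, mul_assoc]
      simp only [neg_mul, one_mul]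
      gcongr
      exact hB v)
  rw [integral_const_mul, integral_gaussian, div_one] at this
  linarith

open MeasureTheory in
lemma shift_gaussian_weight {g : ℂ → ℂ} {σ b K : ℝ} (hσ : σ ≤ b)
    (hg : DifferentiableOn ℂ g (Complex.re ⁻¹' Set.Icc σ b))
    (hK : ∀ x ∈ Set.Icc σ b, ∀ v : ℝ, ‖g (x + v * I)‖ ≤ K * Real.exp (v ^ 2 / 2)) (y : ℝ) :
    ∫ v : ℝ, g (σ + v * I) * cexp (I * y * v - v ^ 2) =
      ∫ v : ℝ, g (b + v * I) *
        cexp (((b - σ : ℝ) + v * I) * y + ((b - σ : ℝ) + v * I) ^ 2) := by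
  have := integral_vertical_eq_of_norm_le_gaussian
    (F := fun w ↦ g w * cexp ((w - σ) * y + (w - σ) ^ 2))
    (K := K * Real.exp ((b - σ) * |y| + (b - σ) ^ 2)) hσ
    (hg.mul (by fun_prop)) (fun x hx v ↦ by
      have h1 : (x : ℂ) + v * I - σ = ((x - σ : ℝ) : ℂ) + v * I := by push_cast; ring
      have hxσ : 0 ≤ x - σ := by linarith [hx.1]
      have hK0 : 0 ≤ K * Real.exp (v ^ 2 / 2) := (norm_nonneg _).trans (hK x hx v)
      rw [norm_mul, h1, norm_cexp_gaussian_weight]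
      have h2 : (x - σ) * y ≤ (b - σ) * |y| :=
        (mul_le_mul_of_nonneg_left (le_abs_self y) hxσ).trans
          (mul_le_mul_of_nonneg_right (by linarith [hx.2]) (abs_nonneg y))
      have h3 : (x - σ) ^ 2 ≤ (b - σ) ^ 2 := pow_le_pow_left₀ hxσ (by linarith [hx.2]) 2
      calc ‖g (x + v * I)‖ * (Real.exp ((x - σ) * y + (x - σ) ^ 2) * Real.exp (-v ^ 2))
          ≤ K * Real.exp (v ^ 2 / 2) *
            (Real.exp ((b - σ) * |y| + (b - σ) ^ 2) * Real.exp (-v ^ 2)) := by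
            gcongr
            exact hK x hx v
        _ = K * Real.exp ((b - σ) * |y| + (b - σ) ^ 2) *
            (Real.exp (v ^ 2 / 2) * Real.exp (-v ^ 2)) := by ring
        _ = _ := by
            rw [← Real.exp_add]
            congr 2
            ring)
  convert this using 4 with v v
  · congr 1
    linear_combination (-(v : ℂ) ^ 2) * I_sq
  · congr 1
    push_cast
    ring

open MeasureTheory in
lemma integrable_mul_gaussian_phase {h : ℝ → ℂ} (hc : Continuous h) {K : ℝ}
    (hK : ∀ v : ℝ, ‖h v‖ ≤ K * Real.exp (v ^ 2 / 2)) (y : ℝ) :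
    Integrable fun v : ℝ ↦ h v * cexp (I * y * v - v ^ 2) := by
  refine Integrable.mono' (integrable_exp_neg_sq_div_two.const_mul K)
    (Continuous.aestronglyMeasurable (by fun_prop)) (Filter.Eventually.of_forall fun v ↦ ?_)
  have h1 : ‖cexp (I * y * v - v ^ 2)‖ = Real.exp (-v ^ 2) := by
    rw [norm_exp]; congr 1; simp [sq]
  rw [norm_mul, h1]
  calc ‖h v‖ * Real.exp (-v ^ 2) ≤ K * Real.exp (v ^ 2 / 2) * Real.exp (-v ^ 2) := by
        gcongr
        exact hK v
    _ = _ := by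
        rw [mul_assoc, ← Real.exp_add]
        congr 2
        ring

open MeasureTheory in
/-- A lower bound for the real part together with bounds at frequencies `0` and `-y` bounds the
Gaussian-weighted Fourier integral at frequency `y`. -/
lemma norm_integral_gaussian_phase_le {h : ℝ → ℂ} (hc : Continuous h) {K A M : ℝ}
    (hK : ∀ v : ℝ, ‖h v‖ ≤ K * Real.exp (v ^ 2 / 2))
    (hA : ∀ v : ℝ, -(A * Real.exp (v ^ 2 / 2)) ≤ (h v).re) {y : ℝ}
    (h0 : ‖∫ v : ℝ, h v * cexp (I * (0 : ℝ) * v - v ^ 2)‖ ≤ M)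
    (hy : ‖∫ v : ℝ, h v * cexp (I * (-y : ℝ) * v - v ^ 2)‖ ≤ M) (hA0 : 0 ≤ A) :
    ‖∫ v : ℝ, h v * cexp (I * y * v - v ^ 2)‖ ≤ 3 * M + 4 * A * √(2 * Real.pi) := by
  have hi0 := integrable_mul_gaussian_phase hc hK 0
  have hiy := integrable_mul_gaussian_phase hc hK y
  have hiy' := integrable_mul_gaussian_phase hc hK (-y)
  have hcong : ∀ v : ℝ, h v * cexp (I * y * v - v ^ 2) +
      (starRingEnd ℂ) (h v * cexp (I * (-y : ℝ) * v - v ^ 2)) =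
      2 * ((h v).re : ℂ) * cexp (I * y * v - v ^ 2) := by
    intro v
    have h1 : (starRingEnd ℂ) (cexp (I * (-y : ℝ) * v - v ^ 2)) = cexp (I * y * v - v ^ 2) := by
      rw [← exp_conj]; congr 1; simp
    have h2 : h v + (starRingEnd ℂ) (h v) = 2 * ((h v).re : ℂ) := by
      rw [add_conj]; push_cast; ring
    rw [map_mul, h1, ← h2]
    ring
  have hre0 : ∀ v : ℝ, (h v * cexp (I * (0 : ℝ) * v - v ^ 2)).re = (h v).re * Real.exp (-v ^ 2) := by
    intro v
    have : cexp (I * (0 : ℝ) * v - v ^ 2) = ((Real.exp (-v ^ 2) : ℝ) : ℂ) := by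
      push_cast; congr 1; simp
    rw [this, re_mul_ofReal]
  have hnorm : ∀ v : ℝ, ‖2 * ((h v).re : ℂ) * cexp (I * y * v - v ^ 2)‖ ≤
      2 * ((h v * cexp (I * (0 : ℝ) * v - v ^ 2)).re + 2 * A * Real.exp (-(v ^ 2 / 2))) := by
    intro v
    have h1 : ‖cexp (I * y * v - v ^ 2)‖ = Real.exp (-v ^ 2) := by
      rw [norm_exp]; congr 1; simp [sq]
    have h2 : Real.exp (-(v ^ 2 / 2)) = Real.exp (v ^ 2 / 2) * Real.exp (-v ^ 2) := by
      rw [← Real.exp_add]; congr 1; ring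
    have h3 : |(h v).re| ≤ (h v).re + 2 * (A * Real.exp (v ^ 2 / 2)) := by
      have := hA v
      have : 0 ≤ A * Real.exp (v ^ 2 / 2) := by positivity
      rw [abs_le]; constructor <;> linarith
    rw [norm_mul, norm_mul, h1, norm_real, Real.norm_eq_abs, hre0, h2]
    have := mul_le_mul_of_nonneg_right h3 (Real.exp_pos (-v ^ 2)).le
    simp only [RCLike.norm_ofNat]
    linarith
  have hsum : ∫ v : ℝ, h v * cexp (I * y * v - v ^ 2) =
      (∫ v : ℝ, 2 * ((h v).re : ℂ) * cexp (I * y * v - v ^ 2)) -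
      (starRingEnd ℂ) (∫ v : ℝ, h v * cexp (I * (-y : ℝ) * v - v ^ 2)) := by
    rw [← integral_conj, eq_sub_iff_add_eq, ← integral_add hiy]
    · exact integral_congr_ae (Filter.Eventually.of_forall hcong)
    · exact (LinearIsometryEquiv.integrable_comp_iff conjLIE).2 hiy'
  have hbd : ‖∫ v : ℝ, 2 * ((h v).re : ℂ) * cexp (I * y * v - v ^ 2)‖ ≤
      2 * (M + 2 * A * √(2 * Real.pi)) := by
    have hir : Integrable fun v : ℝ ↦ (h v * cexp (I * (0 : ℝ) * v - v ^ 2)).re := hi0.re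
    refine (norm_integral_le_of_norm_le
      ((hir.add (integrable_exp_neg_sq_div_two.const_mul (2 * A))).const_mul 2)
      (Filter.Eventually.of_forall hnorm)).trans ?_
    have h1 : ∫ v : ℝ, (h v * cexp (I * (0 : ℝ) * v - v ^ 2)).re =
      (∫ v : ℝ, h v * cexp (I * (0 : ℝ) * v - v ^ 2)).re := integral_re hi0
    have h2 : ∫ v : ℝ, Real.exp (-(v ^ 2 / 2)) = √(2 * Real.pi) := by
      have := integral_gaussian (1 / 2)
      rw [show Real.pi / (1 / 2) = 2 * Real.pi by ring] at this
      rw [← this]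
      congr 1 with v
      ring_nf
    simp only [Pi.add_apply]
    rw [integral_const_mul, integral_add hir (integrable_exp_neg_sq_div_two.const_mul (2 * A)),
      integral_const_mul, h1, h2]
    have := (re_le_norm (∫ v : ℝ, h v * cexp (I * (0 : ℝ) * v - v ^ 2))).trans h0
    linarith
  rw [hsum]
  refine (norm_sub_le _ _).trans ?_
  rw [RCLike.norm_conj]
  linarith

lemma log_abs_add_add_four_le (t v : ℝ) :
    Real.log (|t + v| + 4) ≤ 2 * Real.log (|t| + 4) * Real.exp (v ^ 2 / 2) := by
  have h1 := one_le_log_abs_add_four t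
  have h2 : |t + v| + 4 ≤ (|t| + 4) * (1 + |v|) := by
    have := abs_add_le t v
    nlinarith [abs_nonneg t, abs_nonneg v]
  have h3 : Real.log (1 + |v|) ≤ |v| := by
    have := Real.log_le_sub_one_of_pos (x := 1 + |v|) (by positivity)
    linarith
  have h4 : 1 + |v| ≤ 2 * Real.exp (v ^ 2 / 2) := by
    have := Real.add_one_le_exp (v ^ 2 / 2)
    nlinarith [sq_nonneg (|v| - 1), sq_abs v]
  calc Real.log (|t + v| + 4) ≤ Real.log ((|t| + 4) * (1 + |v|)) :=
        Real.log_le_log (by positivity) h2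
    _ = Real.log (|t| + 4) + Real.log (1 + |v|) := Real.log_mul (by positivity) (by positivity)
    _ ≤ Real.log (|t| + 4) * (1 + |v|) := by nlinarith [abs_nonneg v]
    _ ≤ Real.log (|t| + 4) * (2 * Real.exp (v ^ 2 / 2)) := by gcongr
    _ = _ := by ring

open MeasureTheory in
lemma integral_cexp_gaussian_weight (d y : ℝ) :
    ∫ v : ℝ, cexp ((d + v * I) * y + (d + v * I) ^ 2) =
      ((√Real.pi * Real.exp (-(y ^ 2 / 4)) : ℝ) : ℂ) := by
  have h := integral_cexp_quadratic (b := -1) (by simp) (I * (y + 2 * d)) (d * y + d ^ 2)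
  have h1 : ∀ v : ℝ, cexp ((d + v * I) * y + (d + v * I) ^ 2) =
      cexp (-1 * (v : ℂ) ^ 2 + I * (y + 2 * d) * v + (d * y + d ^ 2)) := by
    intro v
    congr 1
    linear_combination (v : ℂ) ^ 2 * I_sq
  simp_rw [h1]
  rw [h]
  push_cast
  congr 1
  · rw [neg_neg, div_one, Real.sqrt_eq_rpow, ofReal_cpow Real.pi_pos.le]
    norm_num
  · congr 1
    linear_combination ((y + 2 * d : ℂ) ^ 2 / 4) * I_sq

open MeasureTheory in
lemma integrable_cexp_gaussian_weight (d y : ℝ) :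
    Integrable fun v : ℝ ↦ cexp ((d + v * I) * y + (d + v * I) ^ 2) := by
  refine Integrable.mono' ((integrable_exp_neg_mul_sq one_pos).const_mul (Real.exp (d * y + d ^ 2)))
    (Continuous.aestronglyMeasurable (by fun_prop)) (Filter.Eventually.of_forall fun v ↦ ?_)
  rw [norm_cexp_gaussian_weight]
  simp

open MeasureTheory in
lemma integral_norm_cexp_gaussian_weight (d y : ℝ) :
    ∫ v : ℝ, ‖cexp ((d + v * I) * y + (d + v * I) ^ 2)‖ =
      √Real.pi * Real.exp (d * y + d ^ 2) := by
  have := integral_gaussian 1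
  simp_rw [norm_cexp_gaussian_weight]
  rw [integral_const_mul]
  simp only [neg_mul, one_mul, div_one] at this
  rw [this, mul_comm]

open ArithmeticFunction MeasureTheory in
/-- Mellin-type expansion of the logarithmic derivative against a Gaussian weight. -/
lemma DirichletCharacter.hasSum_vonMangoldt_gaussian {q : ℕ} [NeZero q]
    (χ : DirichletCharacter ℂ q) (s : ℂ) {b : ℝ} (hb : 1 < b) (y : ℝ) :
    HasSum (fun n : ℕ ↦ (vonMangoldt n : ℂ) * χ (n : ZMod q) / (n : ℂ) ^ s *
        ((√Real.pi * Real.exp (-((y - Real.log n) ^ 2 / 4)) : ℝ) : ℂ))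
      (∫ v : ℝ, -(deriv (LFunction χ) (b + v * I + s.im * I) / LFunction χ (b + v * I + s.im * I)) *
        cexp (((b - s.re : ℝ) + v * I) * y + ((b - s.re : ℝ) + v * I) ^ 2)) := by
  set d : ℝ := b - s.re with hd
  set a : ℕ → ℂ := fun n ↦ (vonMangoldt n : ℂ) * χ (n : ZMod q) / (n : ℂ) ^ s with ha
  set F : ℕ → ℝ → ℂ := fun n v ↦
    a n * cexp ((d + v * I) * (y - Real.log n : ℝ) + (d + v * I) ^ 2) with hF
  have hFint : ∀ n, Integrable (F n) := fun n ↦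
    (integrable_cexp_gaussian_weight d (y - Real.log n)).const_mul (a n)
  have hFsum : Summable fun n ↦ ∫ v, ‖F n v‖ := by
    have hE := (summable_vonMangoldt_div_rpow hb).mul_right
      (√Real.pi * Real.exp (d * y + d ^ 2))
    refine Summable.of_nonneg_of_le (fun n ↦ integral_nonneg fun v ↦ norm_nonneg _) (fun n ↦ ?_) hE
    simp only [hF, norm_mul]
    rw [integral_const_mul, integral_norm_cexp_gaussian_weight]
    rcases n.eq_zero_or_pos with rfl | hn
    · simp [ha]
    have hn' : (0 : ℝ) < n := by exact_mod_cast hn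
    have h1 : Real.exp (d * (y - Real.log n) + d ^ 2) =
        Real.exp (d * y + d ^ 2) / (n : ℝ) ^ d := by
      rw [Real.rpow_def_of_pos hn', ← Real.exp_sub]
      congr 1
      ring
    have h2 : (n : ℝ) ^ b = (n : ℝ) ^ s.re * (n : ℝ) ^ d := by
      rw [← Real.rpow_add hn', hd]; congr 1; ring
    rw [h1]
    calc ‖a n‖ * (√Real.pi * (Real.exp (d * y + d ^ 2) / (n : ℝ) ^ d))
        ≤ vonMangoldt n / (n : ℝ) ^ s.re * (√Real.pi * (Real.exp (d * y + d ^ 2) / (n : ℝ) ^ d)) := by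
          gcongr
          exact norm_vonMangoldt_mul_div_cpow_le χ s n
      _ = _ := by rw [h2]; field_simp
  have key := hasSum_integral_of_summable_integral_norm hFint hFsum
  have hterm : ∀ n, ∫ v, F n v =
      a n * ((√Real.pi * Real.exp (-((y - Real.log n) ^ 2 / 4)) : ℝ) : ℂ) := by
    intro n
    simp only [hF]
    rw [integral_const_mul, integral_cexp_gaussian_weight]
  have htsum : ∀ v : ℝ, ∑' n, F n v =
      -(deriv (LFunction χ) (b + v * I + s.im * I) / LFunction χ (b + v * I + s.im * I)) *
        cexp ((d + v * I) * y + (d + v * I) ^ 2) := by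
    intro v
    have h1 := (hasSum_vonMangoldt_logDeriv χ (s := b + v * I + s.im * I)
      (by simpa using hb)).mul_right (cexp ((d + v * I) * y + (d + v * I) ^ 2))
    rw [← h1.tsum_eq]
    refine tsum_congr fun n ↦ ?_
    rcases n.eq_zero_or_pos with rfl | hn
    · simp [hF, ha]
    have hn0 : (n : ℂ) ≠ 0 := by exact_mod_cast hn.ne'
    have h2 : (n : ℂ) ^ ((b : ℂ) + v * I + s.im * I) =
        (n : ℂ) ^ s * cexp (Real.log n * (d + v * I)) := by
      rw [natCast_log, ← cpow_def_of_ne_zero hn0, ← cpow_add _ _ hn0]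
      congr 1
      apply Complex.ext <;> simp [hd]
      ring
    have h3 : cexp ((d + v * I) * (y - Real.log n : ℝ) + (d + v * I) ^ 2) =
        cexp ((d + v * I) * y + (d + v * I) ^ 2) / cexp (Real.log n * (d + v * I)) := by
      rw [← exp_sub]
      congr 1
      push_cast
      ring
    simp only [hF, ha]
    rw [h2, h3]
    field_simp
  simp_rw [hterm, htsum] at key
  exact key

open ArithmeticFunction MeasureTheory in
lemma DirichletCharacter.exists_norm_sum_vonMangoldt_gaussian_le {q : ℕ} [NeZero q]
    {χ : DirichletCharacter ℂ q} (hq : 1 < q) (hχ : χ ≠ 1)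
    (hne : ∀ s : ℂ, 1 / 2 < s.re → LFunction χ s ≠ 0) :
    ∃ C : ℝ, 0 < C ∧ ∀ s : ℂ, 1 / 2 < s.re → s.re ≤ 1 → ∀ y : ℝ, -3 ≤ y →
      ∃ S : ℂ, ‖S‖ ≤ C * Real.log (|s.im| + 4) ∧
        HasSum (fun n : ℕ ↦ (vonMangoldt n : ℂ) * χ (n : ZMod q) / (n : ℂ) ^ s *
          ((Real.exp (-((y - Real.log n) ^ 2 / 4)) : ℝ) : ℂ)) S := by
  obtain ⟨A, hA, hAb⟩ := exists_neg_log_le_re_logDeriv hq hχ hne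
  obtain ⟨B, hB, hBb⟩ := exists_norm_logDeriv_le_of_re_eq_two χ
  set M : ℝ := B * √Real.pi * Real.exp 10 with hM
  have hM0 : 0 ≤ M := by positivity
  have hpi : 0 < √Real.pi := Real.sqrt_pos.2 Real.pi_pos
  refine ⟨(3 * M + 4 * (2 * A) * √(2 * Real.pi)) / √Real.pi, by positivity,
    fun s hs1 hs2 y hy ↦ ?_⟩
  set σ := s.re with hσ
  set t := s.im with ht
  set ℓ := Real.log (|t| + 4) with hℓ
  have hℓ1 : 1 ≤ ℓ := one_le_log_abs_add_four t
  obtain ⟨K, hK, hKb⟩ := exists_norm_logDeriv_le_log hq hχ hne hs1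
  set g : ℂ → ℂ := fun w ↦ deriv (LFunction χ) (w + t * I) / LFunction χ (w + t * I) with hg
  have hgd : DifferentiableOn ℂ g (Complex.re ⁻¹' Set.Icc σ 2) := by
    intro w hw
    have hw1 : σ ≤ w.re := hw.1
    refine DifferentiableAt.differentiableWithinAt ?_
    refine DifferentiableAt.div ?_ ?_ (hne _ (by simp; linarith))
    · exact ((differentiable_LFunction hχ).deriv.comp (differentiable_id.add_const _)) w
    · exact ((differentiable_LFunction hχ).comp (differentiable_id.add_const _)) w
  have hgK : ∀ x ∈ Set.Icc σ 2, ∀ v : ℝ, ‖g (x + v * I)‖ ≤ K * (2 * ℓ) * Real.exp (v ^ 2 / 2) := by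
    intro x hx v
    refine (hKb _ (by simpa using hx.1) (by simpa using hx.2)).trans ?_
    have := log_abs_add_add_four_le t v
    rw [mul_assoc]
    gcongr
    simpa [add_comm v t] using this
  have hgA : ∀ v : ℝ, -(2 * A * ℓ * Real.exp (v ^ 2 / 2)) ≤ (g (σ + v * I)).re := by
    intro v
    refine le_trans ?_ (hAb _ (by simpa using hs1) (by simp; linarith))
    have := log_abs_add_add_four_le t v
    have h2 : (σ + v * I + t * I : ℂ).im = t + v := by simp [add_comm]
    rw [h2]
    nlinarith
  have hgB : ∀ v : ℝ, ‖g ((2 : ℝ) + v * I)‖ ≤ B := fun v ↦ hBb _ (by simp)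
  have hH : ∀ y : ℝ, y ≤ 3 → ‖∫ v : ℝ, g (σ + v * I) * cexp (I * y * v - v ^ 2)‖ ≤ M := by
    intro y hy
    rw [shift_gaussian_weight (by linarith) hgd hgK y]
    refine (norm_integral_mul_gaussian_weight_le hgB (2 - σ) y).trans ?_
    rw [hM]
    gcongr
    nlinarith
  have hmain := norm_integral_gaussian_phase_le (h := fun v : ℝ ↦ g (σ + v * I))
    (hgd.continuousOn.comp_continuous (by fun_prop) (fun v ↦ by simp; linarith))
    (hgK σ ⟨le_rfl, by linarith⟩) hgA (y := y) (hH 0 (by norm_num)) (hH (-y) (by linarith))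
    (by positivity)
  have hsum := hasSum_vonMangoldt_gaussian χ s (b := 2) one_lt_two y
  have hshift := shift_gaussian_weight (by linarith) hgd hgK y
  set J := ∫ v : ℝ, g (σ + v * I) * cexp (I * y * v - v ^ 2) with hJ
  simp only [neg_mul] at hsum
  rw [integral_neg] at hsum
  rw [← hσ, ← ht, ← hshift] at hsum
  refine ⟨-J / (√Real.pi : ℝ), ?_, ?_⟩
  · rw [norm_div, norm_neg, norm_real, Real.norm_eq_abs, abs_of_pos hpi, div_mul_eq_mul_div]
    gcongr
    refine hmain.trans ?_
    nlinarith
  · refine (hsum.div_const ((√Real.pi : ℝ) : ℂ)).congr_fun fun n ↦ ?_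
    have : ((√Real.pi : ℝ) : ℂ) ≠ 0 := by exact_mod_cast hpi.ne'
    push_cast
    field_simp

open ArithmeticFunction Chebyshev in
lemma sum_range_vonMangoldt_div_sq_le {M : ℕ} (hM : 0 < M) (N : ℕ) :
    ∑ n ∈ range N, (if M < n then vonMangoldt n / (n : ℝ) ^ 2 else 0) ≤
      2 * (Real.log 4 + 4) / M := by
  set c := Real.log 4 + 4 with hc
  have hc0 : 0 < c := by have := Real.log_pos (x := 4) (by norm_num); positivity
  have hM' : (0 : ℝ) < M := by exact_mod_cast hM
  have key : ∀ k : ℕ, ∑ n ∈ range (M + k + 1), (if M < n then vonMangoldt n / (n : ℝ) ^ 2 else 0) ≤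
      psi (M + k : ℕ) / ((M + k : ℕ) : ℝ) ^ 2 + 2 * c * (1 / (M : ℝ) - 1 / ((M + k : ℕ) : ℝ)) := by
    intro k
    induction k with
    | zero =>
      rw [Finset.sum_eq_zero (fun n hn ↦ if_neg (by simp at hn; omega))]
      have := psi_nonneg (M + 0 : ℕ)
      simp only [add_zero, sub_self, mul_zero]
      positivity
    | succ k ih =>
      rw [← add_assoc, Finset.sum_range_succ, if_pos (by omega)]
      set K := M + k with hK
      have hK0 : (0 : ℝ) < K := by positivity
      have hpsi : psi (K + 1 : ℕ) = psi K + vonMangoldt (K + 1) := by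
        rw [psi_eq_sum_Icc, psi_eq_sum_Icc, Nat.floor_natCast, Nat.floor_natCast,
          Finset.sum_Icc_succ_top (by omega)]
      have hle : psi K ≤ c * K := psi_le_const_mul_self hK0.le
      have hdiff : psi K * (1 / (K : ℝ) ^ 2 - 1 / ((K + 1 : ℕ) : ℝ) ^ 2) ≤
          2 * c * (1 / (K : ℝ) - 1 / ((K + 1 : ℕ) : ℝ)) := by
        push_cast
        have h1 : 0 ≤ 1 / (K : ℝ) ^ 2 - 1 / ((K : ℝ) + 1) ^ 2 := by
          rw [sub_nonneg]; gcongr; linarith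
        refine (mul_le_mul_of_nonneg_right hle h1).trans ?_
        rw [div_sub_div _ _ (by positivity) (by positivity),
          div_sub_div _ _ (by positivity) (by positivity), mul_div_assoc', mul_div_assoc',
          div_le_div_iff₀ (by positivity) (by positivity)]
        have : 0 ≤ c * (K : ℝ) ^ 2 * (K + 1) := by positivity
        nlinarith
      rw [hpsi, add_div]
      have e : psi K * (1 / (K : ℝ) ^ 2 - 1 / ((K + 1 : ℕ) : ℝ) ^ 2) =
        psi K / (K : ℝ) ^ 2 - psi K / ((K + 1 : ℕ) : ℝ) ^ 2 := by ring
      rw [e] at hdiff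
      linarith
  have hmono : ∑ n ∈ range N, (if M < n then vonMangoldt n / (n : ℝ) ^ 2 else 0) ≤
      ∑ n ∈ range (M + N + 1), (if M < n then vonMangoldt n / (n : ℝ) ^ 2 else 0) := by
    refine Finset.sum_le_sum_of_subset_of_nonneg (range_mono (by omega)) fun n _ _ ↦ ?_
    split_ifs
    · exact div_nonneg vonMangoldt_nonneg (by positivity)
    · exact le_rfl
  refine (hmono.trans (key N)).trans ?_
  have hN : (0 : ℝ) < (M + N : ℕ) := by positivity
  have h1 : psi (M + N : ℕ) / ((M + N : ℕ) : ℝ) ^ 2 ≤ c / (M + N : ℕ) := by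
    rw [div_le_div_iff₀ (by positivity) hN]
    nlinarith [psi_le_const_mul_self hN.le]
  have h2 : 0 ≤ c / (M + N : ℕ) := by positivity
  have e : 2 * c * (1 / (M : ℝ) - 1 / ((M + N : ℕ) : ℝ)) =
    2 * c / M - 2 * (c / (M + N : ℕ)) := by ring
  rw [e]
  linarith

open ArithmeticFunction in
lemma sum_range_vonMangoldt_div_sq_floor_le {x : ℝ} (hx : 1 ≤ x) (N : ℕ) :
    ∑ n ∈ range N, (if x < n then vonMangoldt n / (n : ℝ) ^ 2 else 0) ≤
      4 * (Real.log 4 + 4) / x := by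
  have hM : 0 < ⌊x⌋₊ := Nat.floor_pos.2 hx
  have hc0 : 0 < Real.log 4 + 4 := by have := Real.log_pos (x := 4) (by norm_num); positivity
  have h := sum_range_vonMangoldt_div_sq_le hM N
  simp_rw [Nat.floor_lt (zero_le_one.trans hx)] at h
  refine h.trans ?_
  rw [div_le_div_iff₀ (by exact_mod_cast hM) (by linarith)]
  have h1 := (Nat.lt_floor_add_one x).le
  have h2 : (1 : ℝ) ≤ ⌊x⌋₊ := by exact_mod_cast hM
  nlinarith

open ArithmeticFunction in
/-- The tail of the Dirichlet series of `Λ` at `σ ≥ 2`. -/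
lemma sum_range_vonMangoldt_div_rpow_le {x : ℝ} (hx : 1 ≤ x) {σ : ℝ} (hσ : 2 ≤ σ) (N : ℕ) :
    ∑ n ∈ range N, (if x < n then vonMangoldt n / (n : ℝ) ^ σ else 0) ≤
      4 * (Real.log 4 + 4) * x ^ (1 - σ) := by
  have hx0 : 0 < x := by linarith
  have h := mul_le_mul_of_nonneg_left (sum_range_vonMangoldt_div_sq_floor_le hx N)
    (Real.rpow_nonneg hx0.le (2 - σ))
  have e : x ^ (2 - σ) * (4 * (Real.log 4 + 4) / x) = 4 * (Real.log 4 + 4) * x ^ (1 - σ) := by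
    rw [show 1 - σ = (2 - σ) - 1 by ring, Real.rpow_sub_one hx0.ne']
    ring
  rw [e, Finset.mul_sum] at h
  refine (Finset.sum_le_sum fun n _ ↦ ?_).trans h
  split_ifs with hn
  · have hn0 : (0 : ℝ) < n := hx0.trans hn
    have h1 : (n : ℝ) ^ (2 - σ) ≤ x ^ (2 - σ) :=
      Real.rpow_le_rpow_of_nonpos hx0 hn.le (by linarith)
    have h2 : (1 : ℝ) / (n : ℝ) ^ σ = (n : ℝ) ^ (2 - σ) / (n : ℝ) ^ 2 := by
      rw [Real.rpow_sub hn0, Real.rpow_two]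
      field_simp
    calc vonMangoldt n / (n : ℝ) ^ σ = vonMangoldt n * ((n : ℝ) ^ (2 - σ) / (n : ℝ) ^ 2) := by
          rw [← h2]; ring
      _ ≤ vonMangoldt n * (x ^ (2 - σ) / (n : ℝ) ^ 2) := by
          have := @vonMangoldt_nonneg n
          gcongr
      _ = _ := by ring
  · simp

open ArithmeticFunction in
lemma sum_range_vonMangoldt_mul_exp_le {x : ℝ} (hx : 1 ≤ x) {σ : ℝ} (hσ0 : 0 ≤ σ) (hσ : σ ≤ 2)
    (N : ℕ) :
    ∑ n ∈ range N, vonMangoldt n / (n : ℝ) ^ σ * Real.exp (-2 * |Real.log x - Real.log n|) ≤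
      5 * (Real.log 4 + 4) * x ^ (1 - σ) := by
  set c := Real.log 4 + 4 with hc
  have hc0 : 0 < c := by have := Real.log_pos (x := 4) (by norm_num); positivity
  have hx0 : 0 < x := by linarith
  have hterm : ∀ n : ℕ, vonMangoldt n / (n : ℝ) ^ σ * Real.exp (-2 * |Real.log x - Real.log n|) ≤
      (if (n : ℝ) ≤ x then x ^ (-σ) * vonMangoldt n else 0) +
      x ^ (2 - σ) * (if x < n then vonMangoldt n / (n : ℝ) ^ 2 else 0) := by
    intro n
    rcases n.eq_zero_or_pos with rfl | hn
    · simp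
    have hn0 : (0 : ℝ) < n := by exact_mod_cast hn
    have hΛ : 0 ≤ vonMangoldt n := vonMangoldt_nonneg
    rcases le_or_gt (n : ℝ) x with h | h
    · have h1 : Real.exp (-2 * |Real.log x - Real.log n|) = (n : ℝ) ^ 2 / x ^ 2 := by
        rw [abs_of_nonneg (sub_nonneg.2 (Real.log_le_log hn0 h)),
          show -2 * (Real.log x - Real.log n) = 2 * Real.log n - 2 * Real.log x by ring,
          Real.exp_sub]
        congr 1 <;> rw [mul_comm, Real.exp_mul, Real.exp_log ‹_›, Real.rpow_two]
      rw [if_pos h, if_neg h.not_gt, mul_zero, add_zero, h1]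
      have h2 : (n : ℝ) ^ (2 - σ) ≤ x ^ (2 - σ) := Real.rpow_le_rpow hn0.le h (by linarith)
      calc vonMangoldt n / (n : ℝ) ^ σ * ((n : ℝ) ^ 2 / x ^ 2)
          = vonMangoldt n * ((n : ℝ) ^ (2 - σ) / x ^ 2) := by
            rw [Real.rpow_sub hn0, Real.rpow_two]; ring
        _ ≤ vonMangoldt n * (x ^ (2 - σ) / x ^ 2) := by gcongr
        _ = _ := by
            rw [show -σ = (2 - σ) - 2 by ring, Real.rpow_sub hx0 (2 - σ), Real.rpow_two]; ring
    · have h1 : Real.exp (-2 * |Real.log x - Real.log n|) = x ^ 2 / (n : ℝ) ^ 2 := by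
        rw [abs_of_nonpos (sub_nonpos.2 (Real.log_le_log hx0 h.le)),
          show -2 * -(Real.log x - Real.log n) = 2 * Real.log x - 2 * Real.log n by ring,
          Real.exp_sub]
        congr 1 <;> rw [mul_comm, Real.exp_mul, Real.exp_log ‹_›, Real.rpow_two]
      rw [if_neg h.not_ge, if_pos h, zero_add, h1]
      have h2 : x ^ σ ≤ (n : ℝ) ^ σ := Real.rpow_le_rpow hx0.le h.le hσ0
      calc vonMangoldt n / (n : ℝ) ^ σ * (x ^ 2 / (n : ℝ) ^ 2)
          ≤ vonMangoldt n / x ^ σ * (x ^ 2 / (n : ℝ) ^ 2) := by gcongr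
        _ = _ := by rw [Real.rpow_sub hx0, Real.rpow_two]; ring
  refine (Finset.sum_le_sum fun n _ ↦ hterm n).trans ?_
  rw [Finset.sum_add_distrib, ← Finset.mul_sum]
  have h1 : ∑ n ∈ range N, (if (n : ℝ) ≤ x then x ^ (-σ) * vonMangoldt n else 0) ≤
      x ^ (-σ) * (c * x) := by
    rw [← Finset.sum_filter, ← Finset.mul_sum]
    gcongr
    refine le_trans ?_ (Chebyshev.psi_le_const_mul_self hx0.le)
    rw [Chebyshev.psi_eq_sum_Icc]
    refine Finset.sum_le_sum_of_subset_of_nonneg (fun n hn ↦ ?_) fun n _ _ ↦ vonMangoldt_nonneg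
    simp only [Finset.mem_filter, Finset.mem_Icc] at hn ⊢
    exact ⟨Nat.zero_le _, Nat.le_floor hn.2⟩
  have h2 := mul_le_mul_of_nonneg_left (sum_range_vonMangoldt_div_sq_floor_le hx N)
    (Real.rpow_nonneg hx0.le (2 - σ))
  have e1 : x ^ (-σ) * (c * x) = c * x ^ (1 - σ) := by
    rw [show 1 - σ = -σ + 1 by ring, Real.rpow_add_one hx0.ne']; ring
  have e2 : x ^ (2 - σ) * (4 * (Real.log 4 + 4) / x) = 4 * c * x ^ (1 - σ) := by
    rw [show 1 - σ = (2 - σ) - 1 by ring, Real.rpow_sub_one hx0.ne']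
    ring
  linarith

lemma integrable_exp_neg_sub_sq_div_four (ℓ : ℝ) :
    MeasureTheory.Integrable fun y : ℝ ↦ Real.exp (-((y - ℓ) ^ 2 / 4)) :=
  ((integrable_exp_neg_mul_sq (b := 1 / 4) (by norm_num)).comp_sub_right ℓ).congr
    (Filter.Eventually.of_forall fun y ↦ by beta_reduce; congr 1; ring)

lemma integral_exp_neg_sub_sq_div_four (ℓ : ℝ) :
    ∫ y : ℝ, Real.exp (-((y - ℓ) ^ 2 / 4)) = 2 * √Real.pi := by
  have h := integral_gaussian (1 / 4)
  rw [← MeasureTheory.integral_sub_right_eq_self _ ℓ,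
    show Real.pi / (1 / 4) = 2 ^ 2 * Real.pi by ring, Real.sqrt_mul (by norm_num),
    Real.sqrt_sq (by norm_num)] at h
  rw [← h]
  congr 1 with y
  ring_nf

open MeasureTheory in
/-- A Gaussian-smoothed indicator function is exponentially close to the sharp one. -/
lemma abs_integral_Ioi_gaussian_sub_ite_le (Y ℓ : ℝ) :
    |(∫ y in Set.Ioi Y, Real.exp (-((y - ℓ) ^ 2 / 4))) - (if Y < ℓ then 2 * √Real.pi else 0)| ≤
      Real.exp 4 * Real.exp (-2 * |Y - ℓ|) := by
  have h_integr := integrable_exp_neg_sub_sq_div_four ℓ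
  have hpos : ∀ y : ℝ, 0 ≤ Real.exp (-((y - ℓ) ^ 2 / 4)) := fun y ↦ (Real.exp_pos _).le
  split_ifs with h
  · have hsplit := intervalIntegral.integral_Iic_add_Ioi (b := Y) h_integr.integrableOn h_integr.integrableOn
    rw [integral_exp_neg_sub_sq_div_four] at hsplit
    have hle : ∫ y in Set.Iic Y, Real.exp (-((y - ℓ) ^ 2 / 4)) ≤
        ∫ y in Set.Iic Y, Real.exp (4 - 2 * ℓ) * Real.exp (2 * y) := by
      refine setIntegral_mono h_integr.integrableOn
        ((integrableOn_exp_mul_Iic two_pos Y).const_mul _) fun y ↦ ?_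
      rw [← Real.exp_add, Real.exp_le_exp]
      nlinarith [sq_nonneg ((y - ℓ) / 2 + 2)]
    rw [integral_const_mul, integral_exp_mul_Iic two_pos, ← mul_div_assoc, ← Real.exp_add] at hle
    have hnn : 0 ≤ ∫ y in Set.Iic Y, Real.exp (-((y - ℓ) ^ 2 / 4)) := integral_nonneg hpos
    rw [← hsplit, sub_add_cancel_right, abs_neg, abs_of_nonneg hnn, abs_of_neg (by linarith),
      ← Real.exp_add, show 4 + -2 * -(Y - ℓ) = 4 - 2 * ℓ + 2 * Y by ring]
    linarith [Real.exp_pos (4 - 2 * ℓ + 2 * Y)]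
  · push Not at h
    have hle : ∫ y in Set.Ioi Y, Real.exp (-((y - ℓ) ^ 2 / 4)) ≤
        ∫ y in Set.Ioi Y, Real.exp (4 + 2 * ℓ) * Real.exp (-2 * y) := by
      refine setIntegral_mono h_integr.integrableOn
        ((integrableOn_exp_mul_Ioi (by norm_num) Y).const_mul _) fun y ↦ ?_
      rw [← Real.exp_add, Real.exp_le_exp]
      nlinarith [sq_nonneg ((y - ℓ) / 2 - 2)]
    rw [integral_const_mul, integral_exp_mul_Ioi (by norm_num), neg_div_neg_eq, ← mul_div_assoc,
      ← Real.exp_add] at hle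
    rw [sub_zero, abs_of_nonneg (integral_nonneg hpos), abs_of_nonneg (by linarith),
      ← Real.exp_add, show 4 + -2 * (Y - ℓ) = 4 + 2 * ℓ + -2 * Y by ring]
    linarith [Real.exp_pos (4 + 2 * ℓ + -2 * Y)]

open ArithmeticFunction MeasureTheory in
lemma DirichletCharacter.exists_norm_sum_vonMangoldt_smoothed_le {q : ℕ} [NeZero q]
    {χ : DirichletCharacter ℂ q} (hq : 1 < q) (hχ : χ ≠ 1)
    (hne : ∀ s : ℂ, 1 / 2 < s.re → LFunction χ s ≠ 0) :
    ∃ C : ℝ, 0 < C ∧ ∀ s : ℂ, 1 < s.re → s.re ≤ 2 → ∀ Y : ℝ, 0 ≤ Y →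
      ∃ S : ℂ, ‖S‖ ≤ C * Real.log (|s.im| + 4) * Real.exp (-(s.re - 1 / 2) * Y) ∧
        HasSum (fun n : ℕ ↦ (vonMangoldt n : ℂ) * χ (n : ZMod q) / (n : ℂ) ^ s *
          ((∫ y in Set.Ioi Y, Real.exp (-((y - Real.log n) ^ 2 / 4)) : ℝ) : ℂ)) S := by
  obtain ⟨C, hC, h⟩ := exists_norm_sum_vonMangoldt_gaussian_le hq hχ hne
  refine ⟨4 * Real.exp 4 * C, by positivity, fun s hs1 hs2 Y hY ↦ ?_⟩
  set L := Real.log (|s.im| + 4) with hL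
  have hL1 : 1 ≤ L := one_le_log_abs_add_four s.im
  set σ₀ : ℝ := 1 / 2 + 1 / (4 * (1 + Y)) with hσ₀
  have hσ₀1 : 1 / 2 < σ₀ := lt_add_of_pos_right _ (by positivity)
  have hfrac : 1 / (4 * (1 + Y)) ≤ 1 / 4 := by
    apply one_div_le_one_div_of_le <;> linarith
  have hσ₀2 : σ₀ ≤ 3 / 4 := by rw [hσ₀]; linarith
  have hσ₀Y : (σ₀ - 1 / 2) * Y ≤ 1 := by
    rw [hσ₀, add_sub_cancel_left, one_div_mul_eq_div, div_le_one (by positivity)]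
    linarith
  set δ : ℝ := s.re - σ₀ with hδ
  have hδ1 : 1 / 4 ≤ δ := by linarith
  have hδ2 : δ ≤ 3 / 2 := by linarith
  set a : ℕ → ℂ := fun n ↦ (vonMangoldt n : ℂ) * χ (n : ZMod q) / (n : ℂ) ^ s with ha
  set F : ℕ → ℝ → ℂ := fun n y ↦ a n * ((Real.exp (-((y - Real.log n) ^ 2 / 4)) : ℝ) : ℂ) with hF
  have h_integr : ∀ n : ℕ, IntegrableOn
      (fun y : ℝ ↦ Real.exp (-((y - Real.log n) ^ 2 / 4))) (Set.Ioi Y) := fun n ↦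
    (integrable_exp_neg_sub_sq_div_four _).integrableOn
  have hFint : ∀ n, IntegrableOn (F n) (Set.Ioi Y) := fun n ↦ ((h_integr n).ofReal).const_mul (a n)
  have hFsum : Summable fun n ↦ ∫ y in Set.Ioi Y, ‖F n y‖ := by
    refine Summable.of_nonneg_of_le (fun n ↦ integral_nonneg fun v ↦ norm_nonneg _) (fun n ↦ ?_)
      ((summable_vonMangoldt_div_rpow hs1).mul_right (2 * √Real.pi))
    simp only [hF, norm_mul, norm_real, Real.norm_eq_abs, Real.abs_exp]
    rw [integral_const_mul]
    gcongr
    · exact norm_vonMangoldt_mul_div_cpow_le χ s n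
    · rw [← integral_exp_neg_sub_sq_div_four (Real.log n)]
      exact setIntegral_le_integral (integrable_exp_neg_sub_sq_div_four _)
        (Filter.Eventually.of_forall fun y ↦ (Real.exp_pos _).le)
  have key := hasSum_integral_of_summable_integral_norm hFint hFsum
  have hterm : ∀ n, ∫ y in Set.Ioi Y, F n y =
      a n * ((∫ y in Set.Ioi Y, Real.exp (-((y - Real.log n) ^ 2 / 4)) : ℝ) : ℂ) := by
    intro n
    simp only [hF]
    rw [integral_const_mul, integral_complex_ofReal]
  simp_rw [hterm] at key
  refine ⟨_, ?_, key⟩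
  have hbound : ∀ y ∈ Set.Ioi Y, ‖∑' n, F n y‖ ≤
      C * L * Real.exp 3 * Real.exp (-δ * y) := by
    intro y hy
    have hy0 : 0 ≤ y := hY.trans (le_of_lt hy)
    obtain ⟨S, hS, hsum⟩ := h (s - δ) (by simp [hδ]; linarith) (by simp [hδ]; linarith) (y - 2 * δ)
      (by linarith)
    have hsum' := hsum.mul_right ((Real.exp (δ ^ 2 - δ * y) : ℝ) : ℂ)
    have hcongr : ∀ n, F n y = (vonMangoldt n : ℂ) * χ (n : ZMod q) / (n : ℂ) ^ (s - δ) *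
        ((Real.exp (-((y - 2 * δ - Real.log n) ^ 2 / 4)) : ℝ) : ℂ) *
        ((Real.exp (δ ^ 2 - δ * y) : ℝ) : ℂ) := by
      intro n
      rcases n.eq_zero_or_pos with rfl | hn
      · simp [hF, ha]
      have hn0 : (n : ℂ) ≠ 0 := by exact_mod_cast hn.ne'
      have h1 : (n : ℂ) ^ s = (n : ℂ) ^ (s - δ) * cexp (Real.log n * δ) := by
        rw [natCast_log, ← cpow_def_of_ne_zero hn0, ← cpow_add _ _ hn0, sub_add_cancel]
      have h2 : Real.exp (-((y - Real.log n) ^ 2 / 4)) =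
          Real.exp (-((y - 2 * δ - Real.log n) ^ 2 / 4)) * Real.exp (δ ^ 2 - δ * y) *
            Real.exp (Real.log n * δ) := by
        rw [← Real.exp_add, ← Real.exp_add]
        congr 1
        ring
      simp only [hF, ha]
      rw [h1, h2]
      push_cast
      field_simp
    rw [tsum_congr hcongr, hsum'.tsum_eq, norm_mul, norm_real, Real.norm_eq_abs, Real.abs_exp,
      show δ ^ 2 - δ * y = δ ^ 2 + -δ * y by ring, Real.exp_add]
    have hS' : ‖S‖ ≤ C * L := by simpa using hS
    rw [mul_assoc]
    gcongr
    nlinarith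
  have hδY : Real.exp (-δ * Y) ≤ Real.exp 1 * Real.exp (-(s.re - 1 / 2) * Y) := by
    rw [← Real.exp_add, Real.exp_le_exp]
    have : -δ * Y = (σ₀ - 1 / 2) * Y + -(s.re - 1 / 2) * Y := by rw [hδ]; ring
    linarith
  refine (norm_integral_le_of_norm_le
    ((integrableOn_exp_mul_Ioi (a := -δ) (by linarith) Y).const_mul (C * L * Real.exp 3))
    ((ae_restrict_iff' measurableSet_Ioi).2 (Filter.Eventually.of_forall hbound))).trans ?_
  rw [integral_const_mul, integral_exp_mul_Ioi (by linarith), neg_div_neg_eq]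
  calc C * L * Real.exp 3 * (Real.exp (-δ * Y) / δ)
      ≤ C * L * Real.exp 3 * (Real.exp 1 * Real.exp (-(s.re - 1 / 2) * Y) / (1 / 4)) := by gcongr
    _ = 4 * (Real.exp 3 * Real.exp 1) * C * L * Real.exp (-(s.re - 1 / 2) * Y) := by ring
    _ = _ := by rw [← Real.exp_add]; norm_num

lemma norm_le_of_hasSum_of_norm_sum_range_le {f : ℕ → ℂ} {S : ℂ} (h : HasSum f S) {g : ℕ → ℝ}
    {B : ℝ} (hfg : ∀ n, ‖f n‖ ≤ g n) (hg : ∀ N, ∑ n ∈ range N, g n ≤ B) : ‖S‖ ≤ B :=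
  le_of_tendsto' h.tendsto_sum_nat.norm fun N ↦
    (norm_sum_le_of_le _ fun n _ ↦ hfg n).trans (hg N)

open ArithmeticFunction in
lemma DirichletCharacter.hasSum_vonMangoldt_tail {q : ℕ} [NeZero q]
    (χ : DirichletCharacter ℂ q) {s : ℂ} (hs : 1 < s.re) {x : ℝ} (hx : 0 ≤ x) :
    HasSum (fun n : ℕ ↦ if x < n then (vonMangoldt n : ℂ) * χ (n : ZMod q) / (n : ℂ) ^ s else 0)
      (-(deriv (LFunction χ) s / LFunction χ s +
        ∑ n ∈ Finset.Icc 1 ⌊x⌋₊, (vonMangoldt n : ℂ) * χ (n : ZMod q) / (n : ℂ) ^ s)) := by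
  set a : ℕ → ℂ := fun n ↦ (vonMangoldt n : ℂ) * χ (n : ZMod q) / (n : ℂ) ^ s with ha
  have h1 : HasSum a (-(deriv (LFunction χ) s / LFunction χ s)) :=
    hasSum_vonMangoldt_logDeriv χ hs
  have h2 : HasSum (fun n : ℕ ↦ if x < n then 0 else a n) (∑ n ∈ Finset.Icc 1 ⌊x⌋₊, a n) := by
    have h3 : ∑ n ∈ Finset.Icc 1 ⌊x⌋₊, a n =
        ∑ n ∈ Finset.Icc 1 ⌊x⌋₊, (if x < n then 0 else a n) := by
      refine Finset.sum_congr rfl fun n hn ↦ (if_neg ?_).symm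
      rw [← Nat.floor_lt hx, not_lt]
      exact (Finset.mem_Icc.1 hn).2
    rw [h3]
    refine hasSum_sum_of_ne_finset_zero fun n hn ↦ ?_
    split_ifs with h
    · rfl
    · rw [← Nat.floor_lt hx, not_lt] at h
      have : n = 0 := by
        rw [Finset.mem_Icc] at hn
        omega
      simp [ha, this]
  rw [neg_add']
  refine (h1.sub h2).congr_fun fun n ↦ ?_
  split_ifs <;> simp [ha]

open ArithmeticFunction in
lemma DirichletCharacter.exists_norm_logDeriv_add_sum_le {q : ℕ} [NeZero q]
    {χ : DirichletCharacter ℂ q} (hq : 1 < q) (hχ : χ ≠ 1)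
    (hne : ∀ s : ℂ, 1 / 2 < s.re → LFunction χ s ≠ 0) :
    ∃ C : ℝ, 0 < C ∧ ∀ s : ℂ, 1 < s.re → ∀ x : ℝ, 1 ≤ x →
      ‖deriv (LFunction χ) s / LFunction χ s +
        ∑ n ∈ Finset.Icc 1 ⌊x⌋₊, (vonMangoldt n : ℂ) * χ (n : ZMod q) / (n : ℂ) ^ s‖ ≤
      C * (1 + Real.log (|s.im| + 4) * x ^ (-(1 / 2) : ℝ)) * x ^ (1 - s.re) := by
  obtain ⟨C, hC, h⟩ := exists_norm_sum_vonMangoldt_smoothed_le hq hχ hne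
  set c := Real.log 4 + 4 with hc
  have hc0 : 0 < c := by have := Real.log_pos (x := 4) (by norm_num); positivity
  refine ⟨C + Real.exp 4 * (5 * c), by positivity, fun s hs x hx ↦ ?_⟩
  have hx0 : 0 < x := by linarith
  set L := Real.log (|s.im| + 4) with hL
  have hL1 : 1 ≤ L := one_le_log_abs_add_four s.im
  have htail := hasSum_vonMangoldt_tail χ hs hx0.le
  set D := deriv (LFunction χ) s / LFunction χ s +
    ∑ n ∈ Finset.Icc 1 ⌊x⌋₊, (vonMangoldt n : ℂ) * χ (n : ZMod q) / (n : ℂ) ^ s with hD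
  set X := x ^ (1 - s.re) with hX
  have hX0 : 0 < X := by positivity
  set W := x ^ (-(1 / 2) : ℝ) with hW
  have hW0 : 0 < W := by positivity
  have hE : 1 ≤ Real.exp 4 := Real.one_le_exp (by norm_num)
  have hLW : 0 < L * W := by positivity
  rcases le_total s.re 2 with hs2 | hs2
  · obtain ⟨S, hS, hsum⟩ := h s hs hs2 (Real.log x) (Real.log_nonneg hx)
    have hexp : Real.exp (-(s.re - 1 / 2) * Real.log x) = W * X := by
      rw [hW, hX, ← Real.rpow_add hx0, Real.rpow_def_of_pos hx0]
      congr 1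
      ring
    rw [hexp] at hS
    have hdiff := hsum.sub (htail.mul_right ((2 * √Real.pi : ℝ) : ℂ))
    have hbound := norm_le_of_hasSum_of_norm_sum_range_le hdiff
      (g := fun n ↦ Real.exp 4 *
        (vonMangoldt n / (n : ℝ) ^ s.re * Real.exp (-2 * |Real.log x - Real.log n|)))
      (B := Real.exp 4 * (5 * c * X)) (fun n ↦ by
        rcases n.eq_zero_or_pos with rfl | hn
        · simp
        have hn0 : (0 : ℝ) < n := by exact_mod_cast hn
        have h1 := abs_integral_Ioi_gaussian_sub_ite_le (Real.log x) (Real.log n)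
        simp_rw [Real.log_lt_log_iff hx0 hn0] at h1
        have e : ∀ (a : ℂ) (r : ℝ), a * (r : ℂ) -
            (if x < n then a else 0) * ((2 * √Real.pi : ℝ) : ℂ) =
            a * ((r - (if x < n then 2 * √Real.pi else 0) : ℝ) : ℂ) := by
          intro a r
          split_ifs <;> push_cast <;> ring
        rw [e, norm_mul, norm_real, Real.norm_eq_abs, mul_left_comm]
        have h2 := norm_vonMangoldt_mul_div_cpow_le χ s n
        have h3 : 0 ≤ vonMangoldt n / (n : ℝ) ^ s.re := (norm_nonneg _).trans h2
        gcongr)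
      (fun N ↦ by
        rw [← Finset.mul_sum]
        gcongr
        exact sum_range_vonMangoldt_mul_exp_le hx (by linarith) hs2 N)
    have hpi : 1 ≤ 2 * √Real.pi := by
      have : 1 ≤ √Real.pi := Real.one_le_sqrt.2 (by linarith [Real.pi_gt_three])
      linarith
    rw [neg_mul, sub_neg_eq_add] at hbound
    have h4 : ‖D * ((2 * √Real.pi : ℝ) : ℂ)‖ ≤ Real.exp 4 * (5 * c * X) + C * L * (W * X) := by
      have := norm_sub_le (S + D * ((2 * √Real.pi : ℝ) : ℂ)) S
      rw [add_sub_cancel_left] at this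
      linarith
    rw [norm_mul, norm_real, Real.norm_eq_abs, abs_of_nonneg (by positivity)] at h4
    have h5 : ‖D‖ ≤ ‖D‖ * (2 * √Real.pi) := le_mul_of_one_le_right (norm_nonneg _) hpi
    have h6 : 0 ≤ C * X := by positivity
    have h7 : 0 ≤ Real.exp 4 * (5 * c) * (L * W) * X := by positivity
    nlinarith
  · have hbound := norm_le_of_hasSum_of_norm_sum_range_le htail
      (g := fun n : ℕ ↦ if x < n then vonMangoldt n / (n : ℝ) ^ s.re else 0)
      (B := 4 * c * X) (fun n ↦ by
        split_ifs
        · exact norm_vonMangoldt_mul_div_cpow_le χ s n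
        · simp)
      (fun N ↦ sum_range_vonMangoldt_div_rpow_le hx hs2 N)
    rw [norm_neg] at hbound
    refine hbound.trans (mul_le_mul_of_nonneg_right ?_ hX0.le)
    have : c ≤ Real.exp 4 * c := le_mul_of_one_le_left hc0.le hE
    have h1 : C + Real.exp 4 * (5 * c) ≤
        (C + Real.exp 4 * (5 * c)) * (1 + L * W) :=
      le_mul_of_one_le_right (by positivity) (by linarith)
    linarith

/-- Assuming GRH for `χ`: for `T ≥ 4`, `σ ≥ 1` and `T ≤ t ≤ 2T`,
`−(L'/L)(σ+it,χ) = ∑_{n ≤ (log T)²} Λ(n) χ(n)/n^{σ+it} + O((log T)^{2−2σ})`. -/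
theorem log_deriv_approx (q : ℕ) [NeZero q] (hq : 2 < q)
    (χ : DirichletCharacter ℂ q) (hχ : χ.IsPrimitive)
    (hGRH : ∀ s : ℂ, LFunction χ s = 0 → 0 < s.re → s.re < 1 → s.re = 1 / 2) :
    ∃ C : ℝ, 0 < C ∧
      ∀ T : ℝ, 4 ≤ T → ∀ σ t : ℝ, 1 ≤ σ → T ≤ t → t ≤ 2 * T →
        ‖deriv (LFunction χ) (σ + t * I) / LFunction χ (σ + t * I) +
            ∑ n ∈ Finset.Icc 1 ⌊(Real.log T) ^ 2⌋₊,
              (ArithmeticFunction.vonMangoldt n : ℂ) * χ (n : ZMod q) /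
                (n : ℂ) ^ ((σ : ℂ) + t * I)‖ ≤
          C * Real.log T ^ (2 - 2 * σ) := by
  have hχ1 : χ ≠ 1 := by
    rintro rfl
    rw [isPrimitive_def, conductor_one] at hχ
    omega
  have hne : ∀ s : ℂ, 1 / 2 < s.re → LFunction χ s ≠ 0 := by
    intro s hs h0
    rcases lt_or_ge s.re 1 with h1 | h1
    · exact hs.ne' (hGRH s h0 (by linarith) h1)
    · exact LFunction_ne_zero_of_one_le_re χ (Or.inl hχ1) h1 h0
  obtain ⟨C, hC, h⟩ := exists_norm_logDeriv_add_sum_le (by omega : 1 < q) hχ1 hne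
  refine ⟨C * 3, by positivity, fun T hT σ t hσ htT ht2 ↦ ?_⟩
  have hlog : 1 ≤ Real.log T := by
    rw [Real.le_log_iff_exp_le (by linarith)]
    linarith [Real.exp_one_lt_d9]
  have hlogt : Real.log (|t| + 4) ≤ 2 * Real.log T := by
    rw [← Real.log_rpow (by linarith), Real.rpow_two, abs_of_nonneg (by linarith)]
    exact Real.log_le_log (by linarith) (by nlinarith)
  have hsqrt : ((Real.log T) ^ 2) ^ (-(1 / 2) : ℝ) = (Real.log T)⁻¹ := by
    rw [← Real.rpow_two, ← Real.rpow_mul (by linarith)]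
    norm_num [Real.rpow_neg_one]
  have hgt : ∀ σ : ℝ, 1 < σ →
      ‖deriv (LFunction χ) (σ + t * I) / LFunction χ (σ + t * I) +
        ∑ n ∈ Finset.Icc 1 ⌊(Real.log T) ^ 2⌋₊,
          (ArithmeticFunction.vonMangoldt n : ℂ) * χ (n : ZMod q) /
            (n : ℂ) ^ ((σ : ℂ) + t * I)‖ ≤ C * 3 * Real.log T ^ (2 - 2 * σ) := by
    intro σ hσ
    refine (h (σ + t * I) (by simpa using hσ) (Real.log T ^ 2) (one_le_pow₀ hlog)).trans ?_
    have him : (σ + t * I : ℂ).im = t := by simp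
    have hre : (σ + t * I : ℂ).re = σ := by simp
    have hpow : ((Real.log T) ^ 2) ^ (1 - σ) = Real.log T ^ (2 - 2 * σ) := by
      rw [← Real.rpow_two, ← Real.rpow_mul (by linarith)]
      congr 1
      ring
    rw [him, hre, hsqrt, hpow]
    gcongr
    have : Real.log (|t| + 4) * (Real.log T)⁻¹ ≤ 2 := by
      rw [← div_eq_mul_inv, div_le_iff₀ (by linarith)]
      exact hlogt
    linarith
  rcases hσ.lt_or_eq with hσ | rfl
  · exact hgt σ hσ
  have hZ : Differentiable ℂ (LFunction χ) := differentiable_LFunction hχ1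
  refine ContinuousWithinAt.closure_le (s := Set.Ioi (1 : ℝ)) (x := 1) (by simp) ?_ ?_ hgt
  · refine ContinuousAt.continuousWithinAt (ContinuousAt.norm (ContinuousAt.add
      (ContinuousAt.div ?_ ?_ (hne _ (by simp; norm_num))) ?_))
    · exact (hZ.deriv.continuous.comp (by fun_prop)).continuousAt
    · exact (hZ.continuous.comp (by fun_prop)).continuousAt
    · refine tendsto_finsetSum _ fun n hn ↦ ?_
      have hn0 : (n : ℂ) ≠ 0 := by
        have := (Finset.mem_Icc.1 hn).1
        exact_mod_cast (by omega : n ≠ 0)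
      refine ContinuousAt.div continuousAt_const ?_ ?_
      · exact (Continuous.const_cpow (by fun_prop) (Or.inl hn0)).continuousAt
      · simp [cpow_eq_zero_iff, hn0]
  · refine ContinuousAt.continuousWithinAt (continuousAt_const.mul ?_)
    exact (Continuous.rpow continuous_const (by fun_prop)
      (fun _ ↦ Or.inl (by linarith))).continuousAt
end

section
/- Assume GRH for χ, i.e. every zero s of L(s,χ) with 0 < Re(s) < 1 satisfies Re(s) = 1/2. Then there exists a constant C > 0 (depending only on q and χ) such that for all reals T ≥ 4 and all s = σ + it with σ ≥ 1 and T ≤ t ≤ 2T, one has L(s,χ) ≠ 0 and |log|L(s,χ)| − Re(∑_{1 < n ≤ (log T)²} Λ(n)·χ(n)/(n^s·log n))| ≤ C/log(log T). -/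
open Complex DirichletCharacter Finset

open MeasureTheory Filter Topology Metric Asymptotics

open scoped ArithmeticFunction.vonMangoldt ArithmeticFunction.Moebius

/-- The Poisson kernel of a half-plane at distance `b` from the boundary line. -/
noncomputable def halfPlaneKernel (b v : ℝ) : ℝ := b / Real.pi * (b ^ 2 + v ^ 2)⁻¹

lemma halfPlaneKernel_nonneg {b : ℝ} (hb : 0 < b) (v : ℝ) : 0 ≤ halfPlaneKernel b v := by
  unfold halfPlaneKernel; positivity

lemma continuous_halfPlaneKernel {b : ℝ} (hb : 0 < b) : Continuous (halfPlaneKernel b) := by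
  unfold halfPlaneKernel
  refine continuous_const.mul (Continuous.inv₀ (by fun_prop) fun v ↦ ?_)
  positivity

lemma integral_halfPlaneKernel {b : ℝ} (hb : 0 < b) : ∫ v, halfPlaneKernel b v = 1 := by
  have h (v : ℝ) : halfPlaneKernel b v = (b * Real.pi)⁻¹ * (1 + (v / b) ^ 2)⁻¹ := by
    unfold halfPlaneKernel
    have : b ^ 2 + v ^ 2 ≠ 0 := by positivity
    have : 1 + (v / b) ^ 2 ≠ 0 := by positivity
    field_simp
  simp_rw [h]
  rw [integral_const_mul, Measure.integral_comp_div (fun x : ℝ ↦ (1 + x ^ 2)⁻¹),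
    integral_univ_inv_one_add_sq, abs_of_pos hb, smul_eq_mul]
  have := Real.pi_pos
  field_simp

lemma integrable_halfPlaneKernel_smul {b K : ℝ} (hb : 0 < b) {g : ℝ → ℂ} (hg : Continuous g)
    (hK : ∀ v, ‖g v‖ ≤ K * √(1 + |v|)) :
    Integrable fun v ↦ halfPlaneKernel b v • g v := by
  have hdom : Integrable (fun v : ℝ ↦
      (b / Real.pi * ((1 + b ^ 2) / b ^ 2 * 2) * K) * (1 + ‖v‖) ^ (-(3 / 2 : ℝ))) :=
    (integrable_one_add_norm (by norm_num)).const_mul _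
  refine hdom.mono' (by have := continuous_halfPlaneKernel hb; fun_prop) (ae_of_all _ fun v ↦ ?_)
  have hK0 : 0 ≤ K * √(1 + |v|) := (norm_nonneg _).trans (hK v)
  rw [norm_smul, Real.norm_of_nonneg (halfPlaneKernel_nonneg hb v)]
  have hrp : (1 + ‖v‖) ^ (-(3 / 2 : ℝ)) = √(1 + |v|) * ((1 + |v|) ^ 2)⁻¹ := by
    have : (0 : ℝ) < 1 + |v| := by positivity
    rw [Real.sqrt_eq_rpow, ← Real.rpow_natCast, ← Real.rpow_neg this.le, ← Real.rpow_add this,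
      Real.norm_eq_abs]
    norm_num
  have hinv : (b ^ 2 + v ^ 2)⁻¹ ≤ ((1 + b ^ 2) / b ^ 2 * 2) * ((1 + |v|) ^ 2)⁻¹ := by
    rw [← div_eq_mul_inv, le_div_iff₀ (by positivity), inv_mul_le_iff₀ (by positivity),
      div_mul_eq_mul_div, mul_div_assoc', le_div_iff₀ (by positivity)]
    have h1 : (1 + |v|) ^ 2 ≤ 2 * (1 + v ^ 2) := by nlinarith [sq_abs v, sq_nonneg (1 - |v|)]
    nlinarith [mul_le_mul_of_nonneg_right h1 (sq_nonneg b), sq_nonneg (b * v), sq_nonneg (b ^ 2),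
      sq_nonneg v]
  unfold halfPlaneKernel
  calc b / Real.pi * (b ^ 2 + v ^ 2)⁻¹ * ‖g v‖
      ≤ b / Real.pi * (((1 + b ^ 2) / b ^ 2 * 2) * ((1 + |v|) ^ 2)⁻¹) * (K * √(1 + |v|)) := by
        gcongr
        exact hK v
    _ = _ := by rw [hrp]; ring

/-- Rectangle form of the Cauchy theorem used for the Poisson formula. -/
lemma tendsto_integral_left_side_zero {h : ℂ → ℂ} {b C : ℝ} (hb : 0 < b)
    (hd : ∀ w : ℂ, -b ≤ w.re → DifferentiableAt ℂ h w)
    (hC : ∀ R : ℝ, max 1 b ≤ R → ∀ w : ℂ, -b ≤ w.re → R ≤ ‖w‖ → ‖w‖ ≤ 2 * R →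
      ‖h w‖ ≤ C * √R / R ^ 2) :
    Tendsto (fun R : ℝ ↦ ∫ y in (-R)..R, h (-b + y * I)) atTop (𝓝 0) := by
  have hlim : Tendsto (fun R : ℝ ↦ 6 * C * (√R)⁻¹) atTop (𝓝 0) := by
    simpa using (tendsto_inv_atTop_zero.comp Real.tendsto_sqrt_atTop).const_mul (6 * C)
  refine squeeze_zero_norm' ?_ hlim
  filter_upwards [eventually_ge_atTop (max 1 b)] with R hR
  have hR1 : 1 ≤ R := (le_max_left _ _).trans hR
  have hRb : b ≤ R := (le_max_right _ _).trans hR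
  have hrect := Complex.integral_boundary_rect_eq_zero_of_differentiableOn h
    (⟨-b, -R⟩ : ℂ) (⟨R, R⟩ : ℂ) (fun w hw ↦ by
      refine (hd w ?_).differentiableWithinAt
      have := hw.1
      simp only [Set.mem_preimage] at this
      rw [Set.uIcc_of_le (by linarith)] at this
      exact this.1)
  simp only [smul_eq_mul] at hrect
  have hbot : ‖∫ x : ℝ in (-b)..R, h (x + (-R : ℝ) * I)‖ ≤ C * √R / R ^ 2 * (2 * R) := by
    refine (intervalIntegral.norm_integral_le_of_norm_le_const (C := C * √R / R ^ 2) ?_).trans ?_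
    · intro x hx
      rw [Set.uIoc_of_le (by linarith)] at hx
      refine hC R hR _ (by simpa using hx.1.le) ?_ ?_
      · simpa [abs_of_nonneg (by linarith : 0 ≤ R)] using
          Complex.abs_im_le_norm ((x : ℂ) + (-R : ℝ) * I)
      · refine (norm_add_le _ _).trans ?_
        simp only [norm_mul, norm_real, Complex.norm_I, mul_one, Real.norm_eq_abs, abs_neg]
        rw [abs_of_nonneg (by linarith : 0 ≤ R)]
        linarith [abs_le.2 ⟨by linarith [hx.1] , hx.2⟩]
    · have hn := (norm_nonneg _).trans (hC R hR R (by simp; linarith)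
        (by simp [abs_of_nonneg (by linarith : 0 ≤ R)])
        (by simp [abs_of_nonneg (by linarith : 0 ≤ R)]; linarith))
      rw [abs_of_nonneg (by linarith)]
      gcongr
      linarith
  have htop : ‖∫ x : ℝ in (-b)..R, h (x + R * I)‖ ≤ C * √R / R ^ 2 * (2 * R) := by
    refine (intervalIntegral.norm_integral_le_of_norm_le_const (C := C * √R / R ^ 2) ?_).trans ?_
    · intro x hx
      rw [Set.uIoc_of_le (by linarith)] at hx
      refine hC R hR _ (by simpa using hx.1.le) ?_ ?_
      · simpa [abs_of_nonneg (by linarith : 0 ≤ R)] using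
          Complex.abs_im_le_norm ((x : ℂ) + R * I)
      · refine (norm_add_le _ _).trans ?_
        simp only [norm_mul, norm_real, Complex.norm_I, mul_one, Real.norm_eq_abs]
        rw [abs_of_nonneg (by linarith : 0 ≤ R)]
        linarith [abs_le.2 ⟨by linarith [hx.1] , hx.2⟩]
    · have hn := (norm_nonneg _).trans (hC R hR R (by simp; linarith)
        (by simp [abs_of_nonneg (by linarith : 0 ≤ R)])
        (by simp [abs_of_nonneg (by linarith : 0 ≤ R)]; linarith))
      rw [abs_of_nonneg (by linarith)]
      gcongr
      linarith
  have hright : ‖∫ y : ℝ in (-R)..R, h (R + y * I)‖ ≤ C * √R / R ^ 2 * (2 * R) := by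
    refine (intervalIntegral.norm_integral_le_of_norm_le_const (C := C * √R / R ^ 2) ?_).trans ?_
    · intro x hx
      rw [Set.uIoc_of_le (by linarith)] at hx
      refine hC R hR _ (by simp; linarith) ?_ ?_
      · simpa [abs_of_nonneg (by linarith : 0 ≤ R)] using
          Complex.abs_re_le_norm ((R : ℂ) + x * I)
      · refine (norm_add_le _ _).trans ?_
        simp only [norm_mul, norm_real, Complex.norm_I, mul_one, Real.norm_eq_abs]
        rw [abs_of_nonneg (by linarith : 0 ≤ R)]
        linarith [abs_le.2 ⟨by linarith [hx.1] , hx.2⟩]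
    · rw [abs_of_nonneg (by linarith)]
      exact le_of_eq (by ring)
  have hleft : (∫ y in (-R)..R, h (-b + y * I)) = -I * (∫ x : ℝ in (-b)..R, h (x + (-R : ℝ) * I))
      + I * (∫ x : ℝ in (-b)..R, h (x + R * I)) + ∫ y : ℝ in (-R)..R, h (R + y * I) := by
    push_cast at hrect ⊢
    linear_combination I * hrect + ((∫ y in (-R)..R, h (-b + y * I)) -
      ∫ y : ℝ in (-R)..R, h (R + y * I)) * I_sq
  rw [hleft]
  refine (norm_add₃_le).trans ?_
  rw [norm_mul, norm_mul, norm_neg, Complex.norm_I, one_mul, one_mul]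
  have hfin : C * √R / R ^ 2 * (2 * R) = 2 * C * (√R)⁻¹ := by
    have : √R ≠ 0 := by positivity
    have h2 : √R ^ 2 = R := Real.sq_sqrt (by linarith)
    field_simp
    rw [h2]
  linarith

lemma halfPlaneKernel_poisson_zero {g : ℂ → ℂ} {b K : ℝ} (hb : 0 < b)
    (hg : ∀ w : ℂ, -b ≤ w.re → DifferentiableAt ℂ g w)
    (hK : ∀ w : ℂ, -b ≤ w.re → ‖g w‖ ≤ K * √(1 + ‖w‖)) :
    Integrable (fun v : ℝ ↦ halfPlaneKernel b v • g (-b + v * I)) ∧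
      ∫ v : ℝ, halfPlaneKernel b v • g (-b + v * I) = g 0 := by
  have hK0 : 0 ≤ K := by
    have := (norm_nonneg _).trans (hK 0 (by simp; linarith))
    simpa using this
  have hline : ∀ v : ℝ, -b ≤ (-b + v * I : ℂ).re := fun v ↦ by simp
  have hcont : Continuous fun v : ℝ ↦ g (-b + v * I) := by
    refine continuous_iff_continuousAt.2 fun v ↦ ?_
    exact (hg _ (hline v)).continuousAt.comp
      (f := fun v : ℝ ↦ (-b + v * I : ℂ)) (by fun_prop)
  have hgint : Integrable (fun v : ℝ ↦ halfPlaneKernel b v • g (-b + v * I)) := by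
    refine integrable_halfPlaneKernel_smul (K := K * √(1 + b)) hb hcont fun v ↦ ?_
    refine (hK _ (hline v)).trans ?_
    rw [mul_assoc, ← Real.sqrt_mul (by positivity)]
    gcongr
    refine (add_le_add_right (norm_add_le _ _) _).trans ?_
    simp only [norm_neg, norm_mul, norm_real, Complex.norm_I, mul_one, Real.norm_eq_abs,
      abs_of_pos hb]
    nlinarith [abs_nonneg v]
  refine ⟨hgint, ?_⟩
  have hintk : Integrable (fun v : ℝ ↦ halfPlaneKernel b v • g 0) :=
    integrable_halfPlaneKernel_smul (K := ‖g 0‖) hb continuous_const fun v ↦ by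
      refine le_mul_of_one_le_right (norm_nonneg _) ?_
      rw [Real.one_le_sqrt]
      linarith [abs_nonneg v]
  let h : ℂ → ℂ := fun w ↦ dslope g 0 w * (w + 2 * b)⁻¹
  have hne : ∀ w : ℂ, -b ≤ w.re → w + 2 * b ≠ 0 := fun w hw h0 ↦ by
    have := congrArg Complex.re h0
    simp at this
    linarith
  have hd : ∀ w : ℂ, -b ≤ w.re → DifferentiableAt ℂ h w := by
    intro w hw
    refine DifferentiableAt.mul ?_ (DifferentiableAt.inv (by fun_prop) (hne w hw))
    by_cases hw0 : w = 0
    · subst hw0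
      have hU : {w : ℂ | -b < w.re} ∈ 𝓝 (0 : ℂ) :=
        (isOpen_lt continuous_const Complex.continuous_re).mem_nhds (by simpa using hb)
      exact ((Complex.differentiableOn_dslope hU).2 fun z hz ↦
        (hg z (le_of_lt hz)).differentiableWithinAt).differentiableAt hU
    · exact (differentiableAt_dslope_of_ne hw0).2 (hg w hw)
  have hform : ∀ w : ℂ, w ≠ 0 → h w = (g w - g 0) / w * (w + 2 * b)⁻¹ := by
    intro w hw
    simp only [h]
    rw [dslope_of_ne _ hw, slope_def_field, sub_zero]
  have hC : ∀ R : ℝ, max 1 b ≤ R → ∀ w : ℂ, -b ≤ w.re → R ≤ ‖w‖ → ‖w‖ ≤ 2 * R →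
      ‖h w‖ ≤ (K * √3 + ‖g 0‖) * √R / R ^ 2 := by
    intro R hR w hw h1 h2
    have hR1 : 1 ≤ R := (le_max_left _ _).trans hR
    have hw0 : w ≠ 0 := norm_pos_iff.1 (by linarith)
    have hw2 : ‖w‖ ≤ ‖w + 2 * b‖ := by
      rw [← sq_le_sq₀ (norm_nonneg _) (norm_nonneg _), Complex.sq_norm, Complex.sq_norm,
        normSq_apply, normSq_apply]
      simp
      nlinarith
    have hnum : ‖g w - g 0‖ ≤ (K * √3 + ‖g 0‖) * √R := by
      have hg1 : ‖g w‖ ≤ K * √3 * √R := by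
        refine (hK w hw).trans ?_
        rw [mul_assoc, ← Real.sqrt_mul (by norm_num)]
        gcongr
        linarith
      have hg0 : ‖g 0‖ ≤ ‖g 0‖ * √R :=
        le_mul_of_one_le_right (norm_nonneg _) (Real.one_le_sqrt.2 hR1)
      linarith [norm_sub_le (g w) (g 0)]
    have hden : R ^ 2 ≤ ‖w‖ * ‖w + 2 * b‖ := by nlinarith
    rw [hform w hw0, norm_mul, norm_div, norm_inv, ← div_eq_mul_inv, div_div]
    gcongr
  have hlim := tendsto_integral_left_side_zero hb hd hC
  have hker : ∀ v : ℝ, h (-b + v * I) =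
      -(Real.pi / b : ℝ) • (halfPlaneKernel b v • g (-b + v * I) - halfPlaneKernel b v • g 0) := by
    intro v
    have hw0 : (-b + v * I : ℂ) ≠ 0 := fun h0 ↦ by
      have := congrArg Complex.re h0
      simp at this
      linarith
    have hw2 := hne _ (hline v)
    rw [hform _ hw0, ← smul_sub, smul_smul]
    have hk : -(Real.pi / b) * halfPlaneKernel b v = -(b ^ 2 + v ^ 2)⁻¹ := by
      unfold halfPlaneKernel
      have := Real.pi_pos
      field_simp
    have hprod : (-b + v * I : ℂ) * (-b + v * I + 2 * b) = -((b ^ 2 + v ^ 2 : ℝ) : ℂ) := by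
      push_cast
      linear_combination (v : ℂ) ^ 2 * I_sq
    rw [hk, ← div_eq_mul_inv, div_div, hprod, Complex.real_smul]
    push_cast
    rw [div_neg, div_eq_mul_inv]
    ring
  have hintd := hgint.sub hintk
  have hlim2 := intervalIntegral_tendsto_integral (hintd.smul (-(Real.pi / b : ℝ)))
    tendsto_neg_atTop_atBot tendsto_id
  have hzero := tendsto_nhds_unique hlim2 (by
    refine hlim.congr fun R ↦ ?_
    refine intervalIntegral.integral_congr fun v _ ↦ ?_
    simpa using hker v)
  simp only [Pi.smul_apply, Pi.sub_apply] at hzero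
  rw [integral_smul, integral_sub hgint hintk, integral_smul_const, integral_halfPlaneKernel hb,
    one_smul, smul_eq_zero] at hzero
  refine sub_eq_zero.1 (hzero.resolve_left ?_)
  exact neg_ne_zero.2 (div_pos Real.pi_pos hb).ne'

/-- The Poisson formula on a half-plane for holomorphic functions of sublinear growth. -/
lemma halfPlaneKernel_poisson {f : ℂ → ℂ} {α K : ℝ} {s : ℂ} (hs : α < s.re)
    (hf : ∀ z : ℂ, α ≤ z.re → DifferentiableAt ℂ f z)
    (hK : ∀ z : ℂ, α ≤ z.re → ‖f z‖ ≤ K * √(1 + ‖z‖)) :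
    Integrable (fun v : ℝ ↦ halfPlaneKernel (s.re - α) v • f (α + s.im * I + v * I)) ∧
      ∫ v : ℝ, halfPlaneKernel (s.re - α) v • f (α + s.im * I + v * I) = f s := by
  have hK0 : 0 ≤ K := nonneg_of_mul_nonneg_left ((norm_nonneg _).trans (hK s hs.le))
    (by positivity)
  have key := halfPlaneKernel_poisson_zero (g := fun w ↦ f (s + w)) (b := s.re - α)
    (K := K * √(1 + ‖s‖)) (by linarith)
    (fun w hw ↦ (hf (s + w) (by simp; linarith)).comp w (by fun_prop))
    (fun w hw ↦ by
      refine (hK (s + w) (by simp; linarith)).trans ?_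
      rw [mul_assoc, ← Real.sqrt_mul (by positivity)]
      gcongr
      nlinarith [norm_add_le s w, norm_nonneg s, norm_nonneg w])
  have harg : ∀ v : ℝ, s + (-((s.re - α : ℝ) : ℂ) + v * I) = α + s.im * I + v * I := by
    intro v
    apply Complex.ext <;> simp
  simpa only [harg, add_zero] using key

lemma norm_logDeriv_le_of_ne_zero {f : ℂ → ℂ} (hf : Differentiable ℂ f) {m : ℝ} (hm : 0 ≤ m)
    (hb : ∀ z ∈ closedBall (0 : ℂ) (7 / 4), ‖f z‖ ≤ ‖f 0‖ * Real.exp m)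
    (hne : ∀ z ∈ ball (0 : ℂ) (13 / 8), f z ≠ 0) {z : ℂ} (hz : ‖z‖ ≤ 3 / 2) :
    ‖logDeriv f z‖ ≤ 800 * (m + 1) := by
  have hdl : DifferentiableOn ℂ (logDeriv f) (ball (0 : ℂ) (13 / 8)) := fun w hw ↦
    (DifferentiableAt.div (hf.analyticAt w).deriv.differentiableAt (hf w)
      (hne w hw)).differentiableWithinAt
  obtain ⟨F, hF0, hF⟩ := hdl.isExactOn_ball.with_val_at (0 : ℂ) (0 : ℂ)
  have h0mem : (0 : ℂ) ∈ ball (0 : ℂ) (13 / 8) := by simp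
  have hexp : ∀ w ∈ ball (0 : ℂ) (13 / 8), f w * cexp (-F w) = f 0 := by
    intro w hw
    have hd : ∀ u ∈ ball (0 : ℂ) (13 / 8),
        HasDerivAt (fun u ↦ f u * cexp (-F u)) 0 u := by
      intro u hu
      have hfu := hne u hu
      refine ((hf u).hasDerivAt.fun_mul (hF u hu).fun_neg.cexp).congr_deriv ?_
      rw [logDeriv_apply]
      field_simp
      ring
    have := (isOpen_ball (x := (0 : ℂ)) (ε := 13 / 8)).is_const_of_deriv_eq_zero
      (convex_ball _ _).isPreconnected
      (fun u hu ↦ (hd u hu).differentiableAt.differentiableWithinAt)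
      (fun u hu ↦ (hd u hu).deriv) hw h0mem
    simpa [hF0] using this
  have hre : ∀ w ∈ ball (0 : ℂ) (13 / 8), (F w).re ≤ m + 1 := by
    intro w hw
    have h1 : f w = f 0 * cexp (F w) := by
      rw [← hexp w hw, mul_assoc, ← Complex.exp_add]; simp
    have h2 := hb w (ball_subset_closedBall (ball_subset_ball (by norm_num) hw))
    rw [h1, norm_mul, Complex.norm_exp] at h2
    have h3 := le_of_mul_le_mul_left h2 (norm_pos_iff.2 (hne 0 h0mem))
    linarith [Real.exp_le_exp.1 h3]
  have hFd : DifferentiableOn ℂ F (ball (0 : ℂ) (13 / 8)) := fun w hw ↦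
    (hF w hw).differentiableAt.differentiableWithinAt
  have hsub : closedBall z (1 / 16) ⊆ closedBall (0 : ℂ) (25 / 16) := by
    refine closedBall_subset_closedBall' ?_
    rw [dist_zero_right]
    linarith
  have hsub' : closedBall (0 : ℂ) (25 / 16) ⊆ ball (0 : ℂ) (13 / 8) :=
    closedBall_subset_ball (by norm_num)
  have hFb : ∀ w ∈ sphere z (1 / 16), ‖F w‖ ≤ 50 * (m + 1) := by
    intro w hw
    have hw1 := hsub (sphere_subset_closedBall hw)
    have hw2 := hsub' hw1
    have h4 := borelCaratheodory_zero (M := m + 1) (by linarith) hFd (fun u hu ↦ hre u hu)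
      (by norm_num) hw2 hF0
    rw [mem_closedBall_zero_iff] at hw1
    refine h4.trans ?_
    rw [div_le_iff₀ (by linarith)]
    nlinarith
  have hcl : closure (ball z (1 / 16)) ⊆ ball (0 : ℂ) (13 / 8) := by
    rw [closure_ball _ (by norm_num)]
    exact hsub.trans hsub'
  have h5 := Complex.norm_deriv_le_of_forall_mem_sphere_norm_le (by norm_num)
    ((hFd.mono hcl).diffContOnCl) hFb
  rw [(hF z (hsub' (by rw [mem_closedBall_zero_iff]; linarith))).deriv] at h5
  refine h5.trans (le_of_eq ?_)
  ring

/-- Removing a zero of an entire function by a Blaschke factor of the disc of radius `7 / 4`. -/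
lemma exists_blaschke_quotient {f : ℂ → ℂ} (hf : Differentiable ℂ f) {B : ℝ} {ρ : ℂ}
    (hb : ∀ z ∈ closedBall (0 : ℂ) (7 / 4), ‖f z‖ ≤ B) (hfρ : f ρ = 0) :
    ∃ g : ℂ → ℂ, Differentiable ℂ g ∧
      (∀ z, f z * ((7 / 4) ^ 2 - starRingEnd ℂ ρ * z) = (z - ρ) * (7 / 4) * g z) ∧
      ∀ z ∈ closedBall (0 : ℂ) (7 / 4), ‖g z‖ ≤ B := by
  have hds : Differentiable ℂ (dslope f ρ) := by
    rw [← differentiableOn_univ, Complex.differentiableOn_dslope univ_mem,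
      differentiableOn_univ]
    exact hf
  have hfac : ∀ z, f z = (z - ρ) * dslope f ρ z := fun z ↦ by
    have := sub_smul_dslope f ρ z
    rw [hfρ, sub_zero, smul_eq_mul] at this
    exact this.symm
  refine ⟨fun z ↦ dslope f ρ z * ((7 / 4) ^ 2 - starRingEnd ℂ ρ * z) / (7 / 4), by fun_prop,
    fun z ↦ by rw [hfac z]; ring, ?_⟩
  have hfr : ∀ z ∈ frontier (ball (0 : ℂ) (7 / 4)),
      ‖dslope f ρ z * ((7 / 4) ^ 2 - starRingEnd ℂ ρ * z) / (7 / 4)‖ ≤ B := by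
    intro z hz
    rw [frontier_ball _ (by norm_num), mem_sphere_zero_iff_norm] at hz
    have hzz : ((7 / 4) ^ 2 : ℂ) = starRingEnd ℂ z * z := by
      rw [← Complex.normSq_eq_conj_mul_self, Complex.normSq_eq_norm_sq, hz]
      push_cast
      norm_num
    rw [hzz, ← sub_mul, ← map_sub, norm_div, norm_mul, norm_mul, Complex.norm_conj, hz]
    refine le_trans (le_of_eq ?_) (hb z (by simp [hz]))
    rw [hfac z, norm_mul]
    norm_num
    ring
  intro z hz
  refine Complex.norm_le_of_forall_mem_frontier_norm_le (U := ball (0 : ℂ) (7 / 4))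
    isBounded_ball (Differentiable.diffContOnCl (by fun_prop)) hfr ?_
  rwa [closure_ball _ (by norm_num)]

/-- If the zeros of `f` lie to the left of the line `re z = a`, then to the right of that line
`re (f' / f)` is bounded below in terms of the growth of `f`. -/
lemma logDeriv_bounds_right_of_zeros {a : ℝ} (N : ℕ) : ∀ (f : ℂ → ℂ), Differentiable ℂ f →
    ∀ m : ℝ, 0 ≤ m → m ≤ N * (1 / 14) → f 0 ≠ 0 →
    (∀ z ∈ closedBall (0 : ℂ) (7 / 4), ‖f z‖ ≤ ‖f 0‖ * Real.exp m) →
    (∀ ρ ∈ ball (0 : ℂ) (13 / 8), f ρ = 0 → ρ.re ≤ a) →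
    ∀ z : ℂ, ‖z‖ ≤ 3 / 2 → a < z.re →
      -(800 * (m + 1)) ≤ (logDeriv f z).re ∧
        ‖logDeriv f z‖ ≤ 800 * (m + 1) * (1 + (z.re - a)⁻¹) := by
  induction N with
  | zero | succ N ih => ?_
  all_goals
    intro f hf m hm hmN hf0 hb hz0 z hz haz
    have hda : 0 < (z.re - a)⁻¹ := inv_pos.2 (by linarith)
    by_cases hne : ∀ z ∈ ball (0 : ℂ) (13 / 8), f z ≠ 0
    · have h := norm_logDeriv_le_of_ne_zero hf hm hb hne hz
      refine ⟨(neg_le_neg h).trans (neg_le_of_abs_le (Complex.abs_re_le_norm _)), h.trans ?_⟩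
      refine le_mul_of_one_le_right (by positivity) (by linarith)
    push Not at hne
    obtain ⟨ρ, hρ, hfρ⟩ := hne
    have hρa := hz0 ρ hρ hfρ
    rw [mem_ball_zero_iff] at hρ
    obtain ⟨g, hg, hfg, hgb⟩ := exists_blaschke_quotient hf hb hfρ
    have hρ0 : ρ ≠ 0 := by rintro rfl; exact hf0 hfρ
    have hg0 : ‖f 0‖ * Real.exp (1 / 14) ≤ ‖g 0‖ := by
      have h1 := congrArg norm (hfg 0)
      simp only [mul_zero, sub_zero, zero_sub, norm_mul, norm_neg, norm_pow] at h1
      norm_num at h1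
      have h2 : Real.exp (1 / 14) ≤ 14 / 13 := by
        have := Real.one_sub_inv_le_log_of_pos (show (0 : ℝ) < 14 / 13 by norm_num)
        rw [← Real.le_log_iff_exp_le (by norm_num)]
        norm_num at this ⊢
        linarith
      nlinarith [norm_nonneg (f 0), norm_nonneg (g 0)]
    have hg0' : 0 < ‖g 0‖ := lt_of_lt_of_le (by positivity) hg0
    have hgb' : ∀ z ∈ closedBall (0 : ℂ) (7 / 4), ‖g z‖ ≤ ‖g 0‖ * Real.exp (m - 1 / 14) := by
      intro z hz
      refine (hgb z hz).trans ?_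
      have : Real.exp m = Real.exp (1 / 14) * Real.exp (m - 1 / 14) := by
        rw [← Real.exp_add]; ring_nf
      rw [this, ← mul_assoc]
      gcongr
    have hm' : 0 ≤ m - 1 / 14 := by
      have h1 := hgb' 0 (mem_closedBall_self (by norm_num))
      have h2 : 1 ≤ Real.exp (m - 1 / 14) := by
        by_contra! h
        nlinarith
      simpa using h2
  · norm_num at hmN
    linarith
  · push_cast at hmN
    have hden : ∀ w : ℂ, ‖w‖ < 13 / 8 → ((7 / 4) ^ 2 - starRingEnd ℂ ρ * w : ℂ) ≠ 0 := by
      intro w hw h0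
      have h1 := congrArg norm (sub_eq_zero.1 h0)
      rw [norm_mul, Complex.norm_conj] at h1
      norm_num at h1
      nlinarith [norm_nonneg ρ, norm_nonneg w]
    have hgz : ∀ w ∈ ball (0 : ℂ) (13 / 8), g w = 0 → w.re ≤ a := by
      intro w hw hgw
      refine hz0 w hw ?_
      have h1 := hfg w
      rw [hgw, mul_zero] at h1
      exact (mul_eq_zero.1 h1).resolve_right (hden w (by simpa using hw))
    obtain ⟨ih1, ih2⟩ := ih g hg (m - 1 / 14) hm' (by linarith) (norm_pos_iff.1 hg0') hgb' hgz
      z hz haz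
    have hzρ : z - ρ ≠ 0 := fun h0 ↦ by
      have := congrArg Complex.re h0
      simp at this
      linarith
    have hzd := hden z (by linarith)
    have hgz0 : g z ≠ 0 := fun h0 ↦ by
      linarith [hgz z (by rw [mem_ball_zero_iff]; linarith) h0]
    have hlog : logDeriv f z = logDeriv g z + (z - ρ)⁻¹ +
        starRingEnd ℂ ρ / ((7 / 4) ^ 2 - starRingEnd ℂ ρ * z) := by
      have hfz : f z ≠ 0 := fun h0 ↦ by
        linarith [hz0 z (by rw [mem_ball_zero_iff]; linarith) h0]
      have hd1 := (hf z).hasDerivAt.fun_mul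
        (((hasDerivAt_id z).const_mul (starRingEnd ℂ ρ)).const_sub ((7 / 4) ^ 2))
      have hd2 := (((hasDerivAt_id z).sub_const ρ).mul_const (7 / 4)).fun_mul (hg z).hasDerivAt
      have h1 := hd1.unique (hd2.congr_of_eventuallyEq (.of_forall hfg))
      simp only [id_eq, mul_one, one_mul] at h1
      have h2 := hfg z
      rw [logDeriv_apply, logDeriv_apply]
      have h3 : deriv f z / f z - starRingEnd ℂ ρ / ((7 / 4) ^ 2 - starRingEnd ℂ ρ * z) =
          (deriv f z * ((7 / 4) ^ 2 - starRingEnd ℂ ρ * z) + f z * -starRingEnd ℂ ρ) /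
            (f z * ((7 / 4) ^ 2 - starRingEnd ℂ ρ * z)) := by
        rw [div_sub_div _ _ hfz hzd]
        ring
      have h4 : (7 / 4 * g z + (z - ρ) * (7 / 4) * deriv g z) / ((z - ρ) * (7 / 4) * g z) =
          deriv g z / g z + (z - ρ)⁻¹ := by
        field_simp
        ring
      rw [h1, h2, h4] at h3
      linear_combination h3
    have hbl : ‖starRingEnd ℂ ρ / ((7 / 4) ^ 2 - starRingEnd ℂ ρ * z)‖ ≤ 4 := by
      rw [norm_div, Complex.norm_conj, div_le_iff₀ (norm_pos_iff.2 hzd)]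
      have h1 : (7 / 4) ^ 2 - ‖ρ‖ * ‖z‖ ≤ ‖((7 / 4) ^ 2 - starRingEnd ℂ ρ * z : ℂ)‖ := by
        refine le_trans (le_of_eq ?_) (norm_sub_norm_le _ _)
        rw [norm_mul, Complex.norm_conj]
        norm_num
      nlinarith [norm_nonneg ρ, norm_nonneg z]
    have hinv_re : 0 ≤ ((z - ρ)⁻¹).re := by
      rw [Complex.inv_re]
      refine div_nonneg ?_ (normSq_nonneg _)
      simp
      linarith
    have hinv_norm : ‖(z - ρ)⁻¹‖ ≤ (z.re - a)⁻¹ := by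
      rw [norm_inv]
      refine inv_anti₀ (by linarith) (le_trans ?_ (Complex.re_le_norm _))
      simp
      linarith
    rw [hlog]
    constructor
    · simp only [add_re]
      have := neg_le_of_abs_le ((Complex.abs_re_le_norm _).trans hbl)
      linarith
    · refine norm_add₃_le.trans ?_
      nlinarith

lemma sum_range_natCast_eq_sum_zmod {q : ℕ} [NeZero q] (F : ZMod q → ℂ) :
    ∑ k ∈ range q, F k = ∑ a, F a :=
  Finset.sum_nbij' (fun k ↦ (k : ZMod q)) ZMod.val (by simp)
    (fun a _ ↦ Finset.mem_range.2 a.val_lt)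
    (fun k hk ↦ ZMod.val_cast_of_lt (Finset.mem_range.1 hk)) (by simp) (by simp)

lemma norm_sum_Icc_character_le {q : ℕ} [NeZero q] {χ : DirichletCharacter ℂ q} (hχ : χ ≠ 1)
    (n : ℕ) : ‖∑ k ∈ Icc 1 n, χ k‖ ≤ q + 1 := by
  have hper (n : ℕ) : ∑ k ∈ range (n + q), χ k = ∑ k ∈ range n, χ k := by
    rw [Finset.sum_range_add, add_eq_left]
    simp only [Nat.cast_add]
    rw [sum_range_natCast_eq_sum_zmod (fun a : ZMod q ↦ χ (n + a))]
    exact (Equiv.sum_comp (Equiv.addLeft (n : ZMod q)) χ).trans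
      (MulChar.sum_eq_zero_of_ne_one hχ)
  have hmul (m r : ℕ) : ∑ k ∈ range (r + q * m), χ k = ∑ k ∈ range r, χ k := by
    induction m with
    | zero => simp
    | succ m ih => rw [mul_add, mul_one, ← add_assoc, hper, ih]
  have hle (n : ℕ) : ‖∑ k ∈ range n, χ k‖ ≤ q := by
    rw [← Nat.mod_add_div n q, hmul]
    refine (norm_sum_le _ _).trans ((sum_le_card_nsmul _ _ 1 fun k _ ↦ χ.norm_le_one _).trans ?_)
    simpa using (Nat.mod_lt n (NeZero.pos q)).le
  have h0 : ∑ k ∈ Icc 1 n, χ k = ∑ k ∈ range (n + 1), χ k - χ 0 := by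
    rw [Finset.sum_range_succ', Finset.range_eq_Ico, Finset.sum_Ico_add' (fun k ↦ χ (k : ℕ)) 0 n 1]
    simp [Finset.Ico_add_one_right_eq_Icc]
  rw [h0]
  exact (norm_sub_le _ _).trans (add_le_add (hle _) (χ.norm_le_one _))

/-- For a non-trivial character, `L(s, χ) = s ∫ S(t) t ^ (-s - 1) dt` on `re s > 0`. -/
lemma exists_norm_LFunction_le {q : ℕ} [NeZero q] {χ : DirichletCharacter ℂ q} (hχ : χ ≠ 1) :
    ∃ A : ℝ, ∀ s : ℂ, 1 / 4 ≤ s.re → ‖LFunction χ s‖ ≤ A * ‖s‖ := by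
  set S : ℝ → ℂ := (Set.Ioi 1).indicator fun t ↦ ∑ k ∈ Icc 1 ⌊t⌋₊, χ k with hSdef
  have hSle (t : ℝ) : ‖S t‖ ≤ q + 1 :=
    (norm_indicator_le_norm_self _ _).trans (norm_sum_Icc_character_le hχ _)
  have hSmeas : Measurable S :=
    ((measurable_from_nat (f := fun n : ℕ ↦ ∑ k ∈ Icc 1 n, χ k)).comp
      Nat.measurable_floor).indicator measurableSet_Ioi
  have hmel (s : ℂ) : mellin S (-s) =
      ∫ t in Set.Ioi (1 : ℝ), (∑ k ∈ Icc 1 ⌊t⌋₊, χ k) * (t : ℂ) ^ (-(s + 1)) := by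
    rw [mellin, setIntegral_eq_of_subset_of_forall_sdiff_eq_zero measurableSet_Ioi
      (Set.Ioi_subset_Ioi zero_le_one) fun t ht ↦ by simp [S, Set.indicator_of_notMem ht.2]]
    refine setIntegral_congr_fun measurableSet_Ioi fun t ht ↦ ?_
    simp only [hSdef, Set.indicator_of_mem ht, smul_eq_mul]
    ring_nf
  have hdiff (s : ℂ) (hs : 0 < s.re) : DifferentiableAt ℂ (fun s ↦ s * mellin S (-s)) s := by
    refine differentiableAt_id.mul
      (DifferentiableAt.comp (g := mellin S) (f := fun s ↦ -s) s ?_ (by fun_prop))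
    refine mellin_differentiableAt_of_isBigO_rpow (a := 0) (b := -s.re - 1) ?_ ?_ (by simpa) ?_
      (by simp)
    · refine LocallyIntegrable.locallyIntegrableOn ?_ _
      refine (locallyIntegrable_const ((q : ℝ) + 1)).mono hSmeas.aestronglyMeasurable
        (.of_forall fun t ↦ (hSle t).trans (Real.le_norm_self _))
    · exact IsBigO.of_bound (q + 1) (.of_forall fun t ↦ by simpa using hSle t)
    · refine IsBigO.of_bound 0 ?_
      filter_upwards [mem_nhdsWithin_of_mem_nhds (Iio_mem_nhds zero_lt_one)] with t ht
      rw [hSdef, Set.indicator_of_notMem (by simpa using le_of_lt ht)]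
      simp
  have hO : (fun n : ℕ ↦ ∑ k ∈ Icc 1 n, χ k) =O[atTop] fun n : ℕ ↦ (n : ℝ) ^ (0 : ℝ) :=
    IsBigO.of_bound (q + 1) (.of_forall fun n ↦ by simpa using norm_sum_Icc_character_le hχ n)
  have hU : IsOpen {s : ℂ | 0 < s.re} := isOpen_lt continuous_const Complex.continuous_re
  have heq : Set.EqOn (LFunction χ) (fun s ↦ s * mellin S (-s)) {s : ℂ | 0 < s.re} := by
    refine AnalyticOnNhd.eqOn_of_preconnected_of_eventuallyEq (z₀ := 2)
      ((differentiable_LFunction hχ).differentiableOn.analyticOnNhd hU)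
      (DifferentiableOn.analyticOnNhd (fun s hs ↦ (hdiff s hs).differentiableWithinAt) hU)
      (convex_halfSpace_re_gt 0).isPreconnected (by simp) ?_
    filter_upwards [(isOpen_lt continuous_const Complex.continuous_re).mem_nhds
      (show (1 : ℝ) < (2 : ℂ).re by simp)] with s hs
    rw [LFunction_eq_LSeries χ hs, hmel]
    exact LSeries_eq_mul_integral _ le_rfl (zero_lt_one.trans hs)
      (LSeriesSummable_of_one_lt_re χ hs) hO
  refine ⟨4 * (q + 1), fun s hs ↦ ?_⟩
  have hs0 : 0 < s.re := by linarith
  rw [heq hs0, norm_mul, mul_comm]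
  gcongr
  rw [hmel]
  have hlt : -(s.re + 1) < -1 := by linarith
  refine (norm_integral_le_of_norm_le ((integrableOn_Ioi_rpow_of_lt hlt one_pos).const_mul
    ((q : ℝ) + 1)) ?_).trans ?_
  · refine (ae_restrict_mem measurableSet_Ioi).mono fun t ht ↦ ?_
    rw [norm_mul, norm_cpow_eq_rpow_re_of_pos (zero_lt_one.trans ht)]
    simp only [neg_re, add_re, one_re]
    refine mul_le_mul_of_nonneg_right ?_ (Real.rpow_nonneg (zero_lt_one.trans ht).le _)
    exact norm_sum_Icc_character_le hχ _
  · rw [integral_const_mul, integral_Ioi_rpow_of_lt hlt one_pos, mul_comm]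
    gcongr
    simp
    rw [inv_le_comm₀ hs0 (by norm_num)]
    linarith

lemma norm_LSeries_le_tsum {f g : ℕ → ℂ} {s s₀ : ℂ} (hfg : ∀ n, ‖f n‖ ≤ ‖g n‖)
    (hg : LSeriesSummable g s₀) (hs : s₀.re ≤ s.re) :
    ‖LSeries f s‖ ≤ ∑' n, ‖LSeries.term g s₀ n‖ :=
  tsum_of_norm_bounded hg.norm.hasSum fun n ↦
    (LSeries.norm_term_le s (hfg n)).trans (LSeries.norm_term_le_of_re_le_re g hs n)

lemma logDeriv_LFunction_eq_neg_LSeries {q : ℕ} [NeZero q] (χ : DirichletCharacter ℂ q) {s : ℂ}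
    (hs : 1 < s.re) :
    logDeriv (LFunction χ) s = -LSeries ((fun n : ℕ ↦ χ n) * fun n ↦ (Λ n : ℂ)) s := by
  rw [LSeries_twist_vonMangoldt_eq χ hs, logDeriv_apply, deriv_LFunction_eq_deriv_LSeries χ hs,
    LFunction_eq_LSeries χ hs, neg_div, neg_neg]

lemma exists_norm_logDeriv_LFunction_le {q : ℕ} [NeZero q] (χ : DirichletCharacter ℂ q) :
    ∃ K : ℝ, ∀ s : ℂ, 2 ≤ s.re → ‖logDeriv (LFunction χ) s‖ ≤ K := by
  refine ⟨∑' n, ‖LSeries.term (fun n ↦ (Λ n : ℂ)) 2 n‖, fun s hs ↦ ?_⟩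
  rw [logDeriv_LFunction_eq_neg_LSeries χ (by linarith), norm_neg]
  refine norm_LSeries_le_tsum (fun n ↦ ?_)
    (ArithmeticFunction.LSeriesSummable_vonMangoldt (by simp)) (by simpa using hs)
  rw [Pi.mul_apply, norm_mul]
  exact mul_le_of_le_one_left (norm_nonneg _) (χ.norm_le_one _)

lemma exists_one_le_mul_norm_LFunction {q : ℕ} [NeZero q] (χ : DirichletCharacter ℂ q) :
    ∃ K : ℝ, ∀ s : ℂ, 2 ≤ s.re → 1 ≤ K * ‖LFunction χ s‖ := by
  refine ⟨∑' n, ‖LSeries.term (fun n ↦ (μ n : ℂ)) 2 n‖, fun s hs ↦ ?_⟩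
  have hs1 : 1 < s.re := by linarith
  have h := congrArg norm (DirichletCharacter.LSeries.mul_mu_eq_one χ hs1)
  rw [norm_mul, norm_one, mul_comm, ← LFunction_eq_LSeries χ hs1] at h
  rw [← h]
  gcongr
  refine norm_LSeries_le_tsum (fun n ↦ ?_)
    (ArithmeticFunction.LSeriesSummable_moebius_iff.2 (by simp)) (by simpa using hs)
  rw [Pi.mul_apply, norm_mul]
  exact mul_le_of_le_one_left (norm_nonneg _) (χ.norm_le_one _)

lemma one_le_log_norm_add_five {s : ℂ} (hs : 0 ≤ s.re) : 1 ≤ Real.log ‖s + 5‖ := by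
  have h : 5 ≤ ‖s + 5‖ := le_trans (by simpa using hs) (Complex.re_le_norm (s + 5))
  rw [Real.le_log_iff_exp_le (by linarith)]
  linarith [Real.exp_one_lt_d9]

lemma exists_logDeriv_LFunction_bounds {q : ℕ} [NeZero q] {χ : DirichletCharacter ℂ q}
    (hχ : χ ≠ 1) (hz : ∀ s : ℂ, 1 / 2 < s.re → LFunction χ s ≠ 0) :
    ∃ C : ℝ, 0 < C ∧ ∀ s : ℂ, 1 / 2 < s.re →
      -(C * Real.log ‖s + 5‖) ≤ (logDeriv (LFunction χ) s).re ∧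
      ‖logDeriv (LFunction χ) s‖ ≤ C * Real.log ‖s + 5‖ * (1 + (s.re - 1 / 2)⁻¹) := by
  obtain ⟨K₁, hK₁⟩ := exists_norm_logDeriv_LFunction_le χ
  obtain ⟨K₂, hK₂⟩ := exists_one_le_mul_norm_LFunction χ
  obtain ⟨A, hA⟩ := exists_norm_LFunction_le hχ
  set B : ℝ := max 1 (A * 2 * K₂) with hB
  have hB1 : 1 ≤ B := le_max_left _ _
  refine ⟨max 1 (max K₁ (800 * (Real.log B + 2))), lt_max_of_lt_left one_pos, fun s hs ↦ ?_⟩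
  have hs5 := one_le_log_norm_add_five (s := s) (by linarith)
  set C : ℝ := max 1 (max K₁ (800 * (Real.log B + 2))) with hC
  have hC1 : 1 ≤ C := le_max_left _ _
  have hCK : K₁ ≤ C := (le_max_left _ _).trans (le_max_right _ _)
  have hCB : 800 * (Real.log B + 2) ≤ C := (le_max_right _ _).trans (le_max_right _ _)
  have hinv : 0 < (s.re - 1 / 2)⁻¹ := inv_pos.2 (by linarith)
  rcases le_total 2 s.re with h2 | h2
  · have h := (hK₁ s h2).trans (hCK.trans (le_mul_of_one_le_right (by positivity) hs5))
    refine ⟨(neg_le_neg h).trans (neg_le_of_abs_le (Complex.abs_re_le_norm _)), h.trans ?_⟩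
    exact le_mul_of_one_le_right (by positivity) (by linarith)
  set c : ℂ := 2 + s.im * I with hc
  have hcre : c.re = 2 := by simp [c]
  have hx5 : 5 ≤ ‖s + 5‖ := le_trans (by simp; linarith) (Complex.re_le_norm (s + 5))
  have him : |s.im| ≤ ‖s + 5‖ := le_trans (by simp) (Complex.abs_im_le_norm (s + 5))
  have hcn : ‖c‖ ≤ 2 + ‖s + 5‖ := (norm_add_le _ _).trans (by simpa using him)
  have hL := differentiable_LFunction hχ
  have hX : 0 < B * ‖s + 5‖ := by positivity
  set m : ℝ := Real.log (B * ‖s + 5‖) with hm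
  have hm0 : 0 ≤ m := Real.log_nonneg (by nlinarith)
  obtain ⟨N, hN⟩ := exists_nat_ge (14 * m)
  have hc0 : LFunction χ c ≠ 0 := hz c (by rw [hcre]; norm_num)
  have hA0 : 0 ≤ A := nonneg_of_mul_nonneg_left ((norm_nonneg _).trans
    (hA c (by rw [hcre]; norm_num))) (norm_pos_iff.2 fun h ↦ by simp [h] at hcre)
  have key := logDeriv_bounds_right_of_zeros (a := -(3 / 2)) N (fun w ↦ LFunction χ (c + w))
    (by fun_prop) m hm0 (by linarith) (by simpa using hc0) (fun w hw ↦ by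
      rw [mem_closedBall_zero_iff] at hw
      have hwre := (abs_le.1 ((Complex.abs_re_le_norm w).trans hw)).1
      rw [hm, Real.exp_log hX, add_zero]
      have h1 := hK₂ c hcre.ge
      calc ‖LFunction χ (c + w)‖ ≤ A * ‖c + w‖ := hA _ (by rw [add_re, hcre]; linarith)
        _ ≤ A * (2 * ‖s + 5‖) := by
          gcongr
          linarith [norm_add_le c w]
        _ = A * 2 * 1 * ‖s + 5‖ := by ring
        _ ≤ A * 2 * (K₂ * ‖LFunction χ c‖) * ‖s + 5‖ := by gcongr
        _ = ‖LFunction χ c‖ * (A * 2 * K₂ * ‖s + 5‖) := by ring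
        _ ≤ ‖LFunction χ c‖ * (B * ‖s + 5‖) := by
          gcongr
          exact le_max_right _ _)
    (fun ρ _ hρ ↦ by
      by_contra! h
      exact hz _ (by rw [add_re, hcre]; linarith) hρ)
    ((s.re - 2 : ℝ) : ℂ) (by
      rw [norm_real, Real.norm_eq_abs, abs_le]
      constructor <;> linarith) (by rw [ofReal_re]; linarith)
  have hcs : c + ((s.re - 2 : ℝ) : ℂ) = s := by
    apply Complex.ext <;> simp [c]
  have hlog : logDeriv (fun w ↦ LFunction χ (c + w)) ((s.re - 2 : ℝ) : ℂ) =
      logDeriv (LFunction χ) s := by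
    rw [logDeriv_apply, logDeriv_apply, deriv_comp_const_add, hcs]
  have hmC : 800 * (m + 1) ≤ C * Real.log ‖s + 5‖ := by
    have h1 : m = Real.log B + Real.log ‖s + 5‖ := Real.log_mul (by positivity) (by positivity)
    have h2 := Real.log_nonneg hB1
    nlinarith
  rw [hlog, ofReal_re] at key
  refine ⟨by linarith [key.1], key.2.trans ?_⟩
  rw [show s.re - 2 - -(3 / 2) = s.re - 1 / 2 by ring]
  gcongr

/-- If `|re G| ≤ re (G + W)` on a half-plane, then the remainder of an approximation of `-G` by a
Dirichlet polynomial which decays like its frequency cut-off is controlled by `re (G + W)`. -/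
lemma norm_add_dirichletPolynomial_le {ι : Type*} {G W : ℂ → ℂ} {α K ℓ : ℝ} {s : ℂ}
    (S : Finset ι) (c : ι → ℂ) (l : ι → ℝ) (hs : α < s.re) (hℓ : 0 ≤ ℓ) (hl : ∀ n ∈ S, l n ≤ ℓ)
    (hG : ∀ z : ℂ, α ≤ z.re → DifferentiableAt ℂ G z)
    (hW : ∀ z : ℂ, α ≤ z.re → DifferentiableAt ℂ W z)
    (hGK : ∀ z : ℂ, α ≤ z.re → ‖G z‖ ≤ K * √(1 + ‖z‖))
    (hWK : ∀ z : ℂ, α ≤ z.re → ‖W z‖ ≤ K * √(1 + ‖z‖))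
    (hre : ∀ z : ℂ, α ≤ z.re → |(G z).re| ≤ (G z + W z).re)
    (hR : ∀ z : ℂ, α ≤ z.re →
      ‖G z + ∑ n ∈ S, c n * cexp (-(z * l n))‖ * Real.exp ((z.re - α) * ℓ) ≤ K * √(1 + ‖z‖)) :
    ‖G s + ∑ n ∈ S, c n * cexp (-(s * l n))‖ ≤ Real.exp (-((s.re - α) * ℓ)) *
      (2 * (G s + W s).re + ‖G s‖ +
        ∑ n ∈ S, ‖c n‖ * Real.exp (-(α * l n)) * Real.exp ((s.re - α) * (l n - ℓ))) := by
  set R : ℂ → ℂ := fun z ↦ G z + ∑ n ∈ S, c n * cexp (-(z * l n)) with hRdef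
  set b : ℝ := s.re - α with hb
  have hb0 : 0 < b := by linarith
  have hline (v : ℝ) : α ≤ (α + s.im * I + v * I : ℂ).re := by simp
  have hpt (v : ℝ) : (α + s.im * I + v * I : ℂ) - α - s.im * I = v * I := by ring
  have hsb : s - α - s.im * I = (b : ℂ) := by apply Complex.ext <;> simp [b]
  have hnorm (z : ℂ) (r : ℝ) : ‖cexp ((z - α - s.im * I) * r)‖ = Real.exp ((z.re - α) * r) := by
    rw [Complex.norm_exp]
    simp
  have hK0 : 0 ≤ K := nonneg_of_mul_nonneg_left ((norm_nonneg _).trans (hGK s hs.le))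
    (by positivity)
  obtain ⟨i1, h1⟩ := halfPlaneKernel_poisson (K := K)
    (f := fun z ↦ R z * cexp ((z - α - s.im * I) * ℓ)) hs
    (fun z hz ↦ by have := hG z hz; fun_prop) (fun z hz ↦ by
      rw [norm_mul, hnorm]
      exact hR z hz)
  obtain ⟨i2, h2⟩ := halfPlaneKernel_poisson (K := K)
    (f := fun z ↦ G z * cexp ((z - α - s.im * I) * (-ℓ : ℝ))) hs
    (fun z hz ↦ by have := hG z hz; fun_prop) (fun z hz ↦ by
      rw [norm_mul, hnorm]
      refine le_trans (mul_le_of_le_one_right (norm_nonneg _) ?_) (hGK z hz)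
      rw [Real.exp_le_one_iff]
      nlinarith)
  obtain ⟨i3, h3⟩ := halfPlaneKernel_poisson (K := 2 * K)
    (f := fun z ↦ G z + W z) hs (fun z hz ↦ (hG z hz).add (hW z hz)) (fun z hz ↦ by
      linarith [norm_add_le (G z) (W z), hGK z hz, hWK z hz])
  have h4 (n) (hn : n ∈ S) := halfPlaneKernel_poisson (K := 1)
    (f := fun z ↦ cexp ((z - α - s.im * I) * (l n - ℓ : ℝ))) hs
    (fun z hz ↦ by fun_prop) (fun z hz ↦ by
      rw [hnorm, one_mul]
      refine le_trans (Real.exp_le_one_iff.2 ?_)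
        (Real.one_le_sqrt.2 (by linarith [norm_nonneg z]))
      exact mul_nonpos_of_nonneg_of_nonpos (by linarith) (by linarith [hl n hn]))
  simp only [hpt, hsb, ← hb] at i1 h1 i2 h2 i3 h3 h4
  set D : ℝ → ℂ := fun v ↦
    halfPlaneKernel b v • (R (α + s.im * I + v * I) * cexp (v * I * ℓ)) +
      starRingEnd ℂ (halfPlaneKernel b v •
        (G (α + s.im * I + v * I) * cexp (v * I * (-ℓ : ℝ)))) -
      ∑ n ∈ S, c n * cexp (-((α + s.im * I) * l n)) *
        starRingEnd ℂ (halfPlaneKernel b v • cexp (v * I * (l n - ℓ : ℝ))) with hD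
  have hDnorm (v : ℝ) :
      ‖D v‖ ≤ 2 * (halfPlaneKernel b v •
        (G (α + s.im * I + v * I) + W (α + s.im * I + v * I))).re := by
    have hconj (r : ℝ) : starRingEnd ℂ (cexp (v * I * r)) = cexp (-(v * I * r)) := by
      rw [← Complex.exp_conj]
      simp
    have hDv : D v = halfPlaneKernel b v •
        ((2 * (G (α + s.im * I + v * I)).re : ℝ) * cexp (v * I * ℓ)) := by
      have hsum : ∑ n ∈ S, c n * cexp (-((α + s.im * I) * l n)) *
          starRingEnd ℂ (halfPlaneKernel b v • cexp (v * I * (l n - ℓ : ℝ))) =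
          halfPlaneKernel b v * (∑ n ∈ S, c n * cexp (-((α + s.im * I + v * I) * l n))) *
            cexp (v * I * ℓ) := by
        rw [Finset.mul_sum, Finset.sum_mul]
        refine Finset.sum_congr rfl fun n _ ↦ ?_
        rw [Complex.real_smul, map_mul, Complex.conj_ofReal, hconj]
        have : cexp (-((α + s.im * I + v * I) * l n)) * cexp (v * I * ℓ) =
            cexp (-((α + s.im * I) * l n)) * cexp (-(v * I * (l n - ℓ : ℝ))) := by
          rw [← Complex.exp_add, ← Complex.exp_add]
          push_cast
          ring_nf
        linear_combination -(c n * halfPlaneKernel b v) * this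
      have hexp : cexp (-(v * I * (-ℓ : ℝ))) = cexp (v * I * ℓ) := by
        push_cast
        ring_nf
      simp only [hD]
      rw [hsum, ← Complex.add_conj]
      simp only [Complex.real_smul, map_mul, Complex.conj_ofReal, hconj, hexp, hRdef]
      ring
    have hk := halfPlaneKernel_nonneg hb0 v
    rw [hDv, norm_smul, norm_mul, Complex.smul_re, Real.norm_of_nonneg hk, norm_real,
      Real.norm_eq_abs, abs_mul, abs_two, Complex.norm_exp]
    have hkre := mul_le_mul_of_nonneg_left (hre _ (hline v)) hk
    have hexp : Real.exp (v * I * ℓ : ℂ).re = 1 := by simp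
    rw [hexp, smul_eq_mul]
    linarith
  have hDint : ∫ v, D v = R s * cexp (b * ℓ) + starRingEnd ℂ (G s * cexp (b * (-ℓ : ℝ))) -
      ∑ n ∈ S, c n * cexp (-((α + s.im * I) * l n)) *
        starRingEnd ℂ (cexp (b * (l n - ℓ : ℝ))) := by
    have i4 (n) (hn : n ∈ S) : Integrable fun v ↦ c n * cexp (-((α + s.im * I) * l n)) *
        starRingEnd ℂ (halfPlaneKernel b v • cexp (v * I * (l n - ℓ : ℝ))) :=
      ((LinearIsometryEquiv.integrable_comp_iff conjLIE).2 (h4 n hn).1).const_mul _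
    have i2' : Integrable fun v ↦ starRingEnd ℂ (halfPlaneKernel b v •
        (G (α + s.im * I + v * I) * cexp (v * I * (-ℓ : ℝ)))) :=
      (LinearIsometryEquiv.integrable_comp_iff conjLIE).2 i2
    simp only [hD]
    rw [integral_sub (i1.fun_add i2') (integrable_finsetSum _ i4), integral_add i1 i2',
      integral_finsetSum _ i4, integral_conj, h1, h2]
    congr 1
    refine Finset.sum_congr rfl fun n hn ↦ ?_
    rw [integral_const_mul, integral_conj, (h4 n hn).2]
  have hDle : ‖∫ v, D v‖ ≤ 2 * (G s + W s).re := by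
    have := norm_integral_le_of_norm_le (i3.re.const_mul 2) (.of_forall hDnorm)
    refine this.trans (le_of_eq ?_)
    rw [integral_const_mul]
    congr 1
    rw [← h3]
    exact integral_re i3
  have hmain : ‖R s * cexp (b * ℓ)‖ ≤ 2 * (G s + W s).re + ‖G s‖ +
      ∑ n ∈ S, ‖c n‖ * Real.exp (-(α * l n)) * Real.exp (b * (l n - ℓ)) := by
    have h5 : R s * cexp (b * ℓ) = (∫ v, D v) - starRingEnd ℂ (G s * cexp (b * (-ℓ : ℝ))) +
        ∑ n ∈ S, c n * cexp (-((α + s.im * I) * l n)) *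
          starRingEnd ℂ (cexp (b * (l n - ℓ : ℝ))) := by
      rw [hDint]
      ring
    rw [h5]
    refine (norm_add_le _ _).trans (add_le_add ((norm_sub_le _ _).trans (add_le_add hDle ?_))
      ((norm_sum_le _ _).trans (Finset.sum_le_sum fun n _ ↦ ?_)))
    · rw [Complex.norm_conj, norm_mul, ← ofReal_mul, Complex.norm_exp, ofReal_re]
      refine mul_le_of_le_one_right (norm_nonneg _) (Real.exp_le_one_iff.2 ?_)
      nlinarith
    · rw [norm_mul, norm_mul, Complex.norm_conj, ← ofReal_mul, Complex.norm_exp, Complex.norm_exp,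
        ofReal_re]
      simp
  rw [norm_mul, ← ofReal_mul, Complex.norm_exp, ofReal_re, mul_comm] at hmain
  rw [Real.exp_neg, ← div_eq_inv_mul, le_div_iff₀' (Real.exp_pos _)]
  exact hmain

lemma norm_LSeries_sub_sum_mul_exp_le {f : ℕ → ℂ} {s s₀ : ℂ} {ℓ : ℝ} (S : Finset ℕ)
    (hf : LSeriesSummable f s₀) (hs : s₀.re ≤ s.re)
    (hS : ∀ n ∉ S, n ≠ 0 → f n ≠ 0 → ℓ ≤ Real.log n) :
    ‖LSeries f s - ∑ n ∈ S, LSeries.term f s n‖ * Real.exp ((s.re - s₀.re) * ℓ) ≤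
      ∑' n, ‖LSeries.term f s₀ n‖ := by
  have h1 := (hf.of_re_le_re hs).sum_add_tsum_compl (s := S)
  rw [← eq_sub_iff_add_eq'] at h1
  have hterm (n : ((S : Set ℕ)ᶜ : Set ℕ)) : ‖LSeries.term f s n‖ ≤
      Real.exp (-((s.re - s₀.re) * ℓ)) * ‖LSeries.term f s₀ n‖ := by
    rw [LSeries.norm_term_eq, LSeries.norm_term_eq]
    split_ifs with hn
    · simp
    by_cases hfn : f n = 0
    · simp [hfn]
    have hn0 : (0 : ℝ) < (n : ℕ) := by exact_mod_cast Nat.pos_of_ne_zero hn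
    have hl := hS n n.2 hn hfn
    rw [div_eq_mul_inv, div_eq_mul_inv, ← Real.rpow_neg hn0.le, ← Real.rpow_neg hn0.le,
      Real.rpow_def_of_pos hn0, Real.rpow_def_of_pos hn0, mul_left_comm, ← Real.exp_add]
    gcongr
    nlinarith
  have h2 : ‖LSeries f s - ∑ n ∈ S, LSeries.term f s n‖ ≤
      Real.exp (-((s.re - s₀.re) * ℓ)) * ∑' n, ‖LSeries.term f s₀ n‖ := by
    rw [LSeries, ← h1]
    refine (tsum_of_norm_bounded ((hf.norm.subtype _).mul_left _).hasSum hterm).trans ?_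
    rw [tsum_mul_left]
    gcongr
    exact Summable.tsum_subtype_le _ _ (fun _ ↦ norm_nonneg _) hf.norm
  rw [Real.exp_neg, ← div_eq_inv_mul, le_div_iff₀ (Real.exp_pos _)] at h2
  exact h2

lemma log_norm_add_five_le {z : ℂ} (hz : 0 ≤ z.re) : Real.log ‖z + 5‖ ≤ 6 * √(1 + ‖z‖) := by
  have h5 : 5 ≤ ‖z + 5‖ := le_trans (by simpa using hz) (Complex.re_le_norm (z + 5))
  have h1 : ‖z + 5‖ ≤ 3 ^ 2 * (1 + ‖z‖) := by
    have := norm_add_le z 5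
    norm_num at this
    linarith [norm_nonneg z]
  have h2 : Real.log √‖z + 5‖ ≤ √‖z + 5‖ := Real.log_le_self (Real.sqrt_nonneg _)
  rw [Real.log_sqrt (by linarith)] at h2
  have h3 := Real.sqrt_le_sqrt h1
  rw [Real.sqrt_mul (by norm_num), Real.sqrt_sq (by norm_num)] at h3
  linarith

lemma term_eq_mul_cexp (f : ℕ → ℂ) (s : ℂ) {n : ℕ} (hn : n ≠ 0) :
    LSeries.term f s n = f n * cexp (-(s * Real.log n)) := by
  rw [LSeries.term_of_ne_zero hn, div_eq_mul_inv, ← Complex.cpow_neg,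
    Complex.cpow_def_of_ne_zero (Nat.cast_ne_zero.2 hn), Complex.natCast_log]
  ring_nf

lemma norm_character_mul_vonMangoldt_le {q : ℕ} (χ : DirichletCharacter ℂ q) (n : ℕ) :
    ‖χ n * (Λ n : ℂ)‖ ≤ Λ n := by
  rw [norm_mul, norm_real, Real.norm_of_nonneg ArithmeticFunction.vonMangoldt_nonneg]
  exact mul_le_of_le_one_left ArithmeticFunction.vonMangoldt_nonneg (χ.norm_le_one _)

/-- A bound for `L'/L` approximated by the Dirichlet polynomial of length `exp ℓ`, in terms of
the bounds for `L'/L` in a half-plane free of zeros. -/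
lemma norm_logDeriv_LFunction_add_sum_le {q : ℕ} [NeZero q] {χ : DirichletCharacter ℂ q}
    (hχ : χ ≠ 1) (hz : ∀ s : ℂ, 1 / 2 < s.re → LFunction χ s ≠ 0) {C : ℝ} (hC : 0 < C)
    (hb : ∀ s : ℂ, 1 / 2 < s.re → -(C * Real.log ‖s + 5‖) ≤ (logDeriv (LFunction χ) s).re ∧
      ‖logDeriv (LFunction χ) s‖ ≤ C * Real.log ‖s + 5‖ * (1 + (s.re - 1 / 2)⁻¹))
    {α ℓ : ℝ} {N : ℕ} (hα : 1 / 2 < α) (hα1 : α < 1) (hℓ : 0 ≤ ℓ)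
    (hN : ∀ n ∈ Ioc 1 N, Real.log n ≤ ℓ) (hN' : ∀ n : ℕ, N < n → ℓ ≤ Real.log n)
    {s : ℂ} (hs : 1 ≤ s.re) :
    ‖logDeriv (LFunction χ) s + ∑ n ∈ Ioc 1 N, χ n * (Λ n : ℂ) * cexp (-(s * Real.log n))‖ ≤
      Real.exp (-((s.re - α) * ℓ)) * (13 * C * Real.log ‖s + 5‖ +
        ∑ n ∈ Ioc 1 N, Λ n * Real.exp (-(α * Real.log n)) *
          Real.exp ((s.re - α) * (Real.log n - ℓ))) := by
  have hL := differentiable_LFunction hχ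
  set f : ℕ → ℂ := fun n ↦ χ n * (Λ n : ℂ) with hf
  have hfs : LSeriesSummable f 2 := LSeriesSummable_twist_vonMangoldt χ (by simp)
  set M : ℝ := ∑' n, ‖LSeries.term f 2 n‖ with hM
  have hM0 : 0 ≤ M := tsum_nonneg fun _ ↦ norm_nonneg _
  have hPsum (z : ℂ) : ∑ n ∈ Ioc 1 N, f n * cexp (-(z * Real.log n)) =
      ∑ n ∈ Ioc 1 N, LSeries.term f z n :=
    Finset.sum_congr rfl fun n hn ↦
      (term_eq_mul_cexp f z (by have := (Finset.mem_Ioc.1 hn).1; lia)).symm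
  have hPle (z : ℂ) (hz : 0 ≤ z.re) :
      ‖∑ n ∈ Ioc 1 N, f n * cexp (-(z * Real.log n))‖ ≤ ∑ n ∈ Ioc 1 N, Λ n := by
    refine (norm_sum_le _ _).trans (Finset.sum_le_sum fun n hn ↦ ?_)
    rw [norm_mul, Complex.norm_exp]
    refine (mul_le_of_le_one_right (norm_nonneg _) (Real.exp_le_one_iff.2 ?_)).trans
      (norm_character_mul_vonMangoldt_le χ n)
    rw [neg_re, re_mul_ofReal, neg_nonpos]
    exact mul_nonneg hz (Real.log_natCast_nonneg n)
  set H : ℝ := ∑ n ∈ Ioc 1 N, Λ n with hH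
  have hH0 : 0 ≤ H := Finset.sum_nonneg fun _ _ ↦ ArithmeticFunction.vonMangoldt_nonneg
  set K₀ : ℝ := 60 * C * (1 + (α - 1 / 2)⁻¹) with hK₀
  have hinv : 0 < (α - 1 / 2)⁻¹ := inv_pos.2 (by linarith)
  have hK₀0 : 0 ≤ K₀ := by positivity
  set E : ℝ := Real.exp ((2 - α) * ℓ) with hE
  have hE1 : 1 ≤ E := Real.one_le_exp (mul_nonneg (by linarith) hℓ)
  have hGle (z : ℂ) (hz : α ≤ z.re) : ‖logDeriv (LFunction χ) z‖ ≤ K₀ * √(1 + ‖z‖) := by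
    have h5 := log_norm_add_five_le (z := z) (by linarith)
    have h1 := one_le_log_norm_add_five (s := z) (by linarith)
    have h2 : 0 < (z.re - 1 / 2)⁻¹ := inv_pos.2 (by linarith)
    calc _ ≤ C * Real.log ‖z + 5‖ * (1 + (z.re - 1 / 2)⁻¹) := (hb z (by linarith)).2
      _ ≤ C * (6 * √(1 + ‖z‖)) * (1 + (α - 1 / 2)⁻¹) := by gcongr
      _ ≤ C * (60 * √(1 + ‖z‖)) * (1 + (α - 1 / 2)⁻¹) := by gcongr; norm_num
      _ = _ := by ring
  have hsqrt (z : ℂ) : 1 ≤ √(1 + ‖z‖) := Real.one_le_sqrt.2 (by linarith [norm_nonneg z])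
  have hR (z : ℂ) (hz : α ≤ z.re) :
      ‖logDeriv (LFunction χ) z + ∑ n ∈ Ioc 1 N, f n * cexp (-(z * Real.log n))‖ *
        Real.exp ((z.re - α) * ℓ) ≤ (K₀ + H + M) * E * √(1 + ‖z‖) := by
    rcases le_total 2 z.re with h2 | h2
    · have h := norm_LSeries_sub_sum_mul_exp_le (s := z) (ℓ := ℓ) (Ioc 1 N) hfs (by simpa using h2)
        fun n hn hn0 hfn ↦ hN' n <| by
          by_contra! hnN
          obtain rfl : n = 1 := by
            rw [Finset.mem_Ioc] at hn
            lia
          simp [hf] at hfn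
      rw [re_ofNat] at h
      have hG : logDeriv (LFunction χ) z = -LSeries f z :=
        logDeriv_LFunction_eq_neg_LSeries χ (by linarith)
      rw [hG, hPsum, ← norm_neg, neg_add, neg_neg, ← sub_eq_add_neg,
        show (z.re - α) * ℓ = (z.re - 2) * ℓ + (2 - α) * ℓ by ring, Real.exp_add, ← mul_assoc]
      have hM' : M ≤ K₀ + H + M := by linarith
      calc _ ≤ M * E * 1 := by rw [mul_one]; gcongr
        _ ≤ _ := mul_le_mul (mul_le_mul_of_nonneg_right hM' (by positivity)) (hsqrt z)
            zero_le_one (by positivity)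
    · have h3 : Real.exp ((z.re - α) * ℓ) ≤ E := by
        rw [hE]
        gcongr
      calc _ ≤ (K₀ * √(1 + ‖z‖) + H * 1) * E := by
            gcongr
            refine (norm_add_le _ _).trans (add_le_add (hGle z hz) ?_)
            rw [mul_one]
            exact hPle z (by linarith)
        _ ≤ (K₀ * √(1 + ‖z‖) + H * √(1 + ‖z‖) + M * √(1 + ‖z‖)) * E := by
            have := mul_nonneg hM0 (Real.sqrt_nonneg (1 + ‖z‖))
            have := mul_le_mul_of_nonneg_left (hsqrt z) hH0
            exact mul_le_mul_of_nonneg_right (by linarith) (by positivity)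
        _ = _ := by ring
  have key := norm_add_dirichletPolynomial_le (G := logDeriv (LFunction χ))
    (W := fun z ↦ (2 * C : ℝ) * Complex.log (z + 5)) (K := (K₀ + H + M) * E) (Ioc 1 N) f
    (fun n ↦ Real.log n) (hα1.trans_le hs) hℓ hN
    (fun z hz' ↦ (hL.analyticAt z).deriv.differentiableAt.div (hL z) (hz z (by linarith)))
    (fun z hz ↦ by
      refine (DifferentiableAt.clog (by fun_prop) ?_).const_mul _
      exact Or.inl (by simp; linarith))
    (fun z hz ↦ (hGle z hz).trans (by gcongr; nlinarith))
    (fun z hz ↦ by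
      have h5 := log_norm_add_five_le (z := z) (by linarith)
      have h1 := one_le_log_norm_add_five (s := z) (by linarith)
      have harg : ‖Complex.log (z + 5)‖ ≤ 5 * Real.log ‖z + 5‖ := by
        refine (Complex.norm_le_abs_re_add_abs_im _).trans ?_
        rw [Complex.log_re, Complex.log_im, abs_of_pos (by linarith)]
        linarith [Complex.abs_arg_le_pi (z + 5), Real.pi_lt_four]
      rw [norm_mul, norm_real, Real.norm_of_nonneg (by positivity)]
      have hCK : 60 * C ≤ (K₀ + H + M) * E := by
        have h6 : 60 * C ≤ K₀ := le_mul_of_one_le_right (by positivity) (by linarith)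
        nlinarith
      calc _ ≤ 2 * C * (5 * (6 * √(1 + ‖z‖))) := by gcongr; linarith
        _ = 60 * C * √(1 + ‖z‖) := by ring
        _ ≤ _ := by gcongr)
    (fun z hz ↦ by
      have h1 := one_le_log_norm_add_five (s := z) (by linarith)
      have h2 := (hb z (by linarith)).1
      rw [add_re, re_ofReal_mul, Complex.log_re, abs_le]
      constructor <;> nlinarith)
    hR
  refine key.trans ?_
  gcongr
  · have h1 := one_le_log_norm_add_five (s := s) (by linarith)
    have h2 : (s.re - 1 / 2)⁻¹ ≤ 2 := by
      rw [inv_le_comm₀ (by linarith) (by norm_num)]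
      linarith
    have h3 : ‖logDeriv (LFunction χ) s‖ ≤ 3 * (C * Real.log ‖s + 5‖) := by
      refine (hb s (by linarith)).2.trans ?_
      have := mul_pos hC (zero_lt_one.trans_le h1)
      nlinarith
    have h4 := (Complex.re_le_norm _).trans h3
    rw [add_re, re_ofReal_mul, Complex.log_re]
    linarith
  · exact norm_character_mul_vonMangoldt_le χ _

lemma half_le_two_mul_log_log {T : ℝ} (hT : 4 ≤ T) : 1 / 2 ≤ 2 * Real.log (Real.log T) := by
  have h4 : (4 / 3 : ℝ) ≤ Real.log T := by
    refine le_trans ?_ (Real.log_le_log (by norm_num) hT)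
    rw [show (4 : ℝ) = 2 ^ 2 by norm_num, Real.log_pow]
    push_cast
    linarith [Real.log_two_gt_d9]
  have h1 := Real.one_sub_inv_le_log_of_pos (zero_lt_one.trans_le (by linarith : 1 ≤ Real.log T))
  have h2 : (Real.log T)⁻¹ ≤ (4 / 3 : ℝ)⁻¹ := inv_anti₀ (by norm_num) h4
  linarith

lemma log_norm_add_five_le_re_mul_log {T : ℝ} (hT : 4 ≤ T) {s : ℂ} (hs : 1 ≤ s.re)
    (hTs : T ≤ s.im) (hsT : s.im ≤ 2 * T) : Real.log ‖s + 5‖ ≤ 3 * s.re * Real.log T := by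
  have hT1 : 1 ≤ Real.log T := by
    rw [Real.le_log_iff_exp_le (by linarith)]
    linarith [Real.exp_one_lt_d9]
  have h1 : ‖s + 5‖ ≤ s.re * T ^ 2 := by
    refine (Complex.norm_le_abs_re_add_abs_im _).trans ?_
    rw [add_re, add_im, re_ofNat, im_ofNat, abs_of_pos (by linarith), abs_of_nonneg (by linarith)]
    have h2 : 2 * T + 6 ≤ T ^ 2 := by nlinarith
    nlinarith
  have h5 : 0 < ‖s + 5‖ := norm_pos_iff.2 fun h ↦ by
    have := congrArg Complex.re h
    simp at this
    linarith
  refine (Real.log_le_log h5 h1).trans ?_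
  rw [Real.log_mul (by linarith) (by positivity), Real.log_pow]
  push_cast
  nlinarith [Real.log_le_sub_one_of_pos (zero_lt_one.trans_le hs)]

lemma exp_le_two {x : ℝ} (hx : x ≤ 1 / 4) : Real.exp x ≤ 2 := by
  rw [← Real.le_log_iff_exp_le (by norm_num)]
  linarith [Real.log_two_gt_d9]

/-- Bound for `L'/L` approximated by the Dirichlet polynomial of length `(log T)²`, under the
hypothesis that `L(s, χ)` has no zeros in `Re s > 1/2`. -/
lemma exists_norm_logDeriv_LFunction_add_sum_le {q : ℕ} [NeZero q] {χ : DirichletCharacter ℂ q}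
    (hχ : χ ≠ 1) (hz : ∀ s : ℂ, 1 / 2 < s.re → LFunction χ s ≠ 0) :
    ∃ C : ℝ, 0 < C ∧ ∀ T : ℝ, 4 ≤ T → ∀ s : ℂ, 1 ≤ s.re → T ≤ s.im → s.im ≤ 2 * T →
      ‖logDeriv (LFunction χ) s +
          ∑ n ∈ Ioc 1 ⌊Real.log T ^ 2⌋₊, χ n * (Λ n : ℂ) * cexp (-(s * Real.log n))‖ ≤
        C * s.re * Real.exp (-((s.re - 1) * (2 * Real.log (Real.log T)))) := by
  obtain ⟨C, hC, hb⟩ := exists_logDeriv_LFunction_bounds hχ hz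
  refine ⟨78 * C + 12, by positivity, fun T hT s hs hTs hsT ↦ ?_⟩
  have hℓ2 := half_le_two_mul_log_log hT
  set ℓ : ℝ := 2 * Real.log (Real.log T) with hℓ
  have hT0 : 0 < Real.log T := Real.log_pos (by linarith)
  have hexpℓ : Real.exp (ℓ / 2) = Real.log T := by
    rw [hℓ, mul_div_cancel_left₀ _ two_ne_zero, Real.exp_log hT0]
  have hexpℓ' : Real.exp ℓ = Real.log T ^ 2 := by
    rw [← hexpℓ, ← Real.exp_nat_mul]
    congr 1
    push_cast
    ring
  set N := ⌊Real.log T ^ 2⌋₊ with hNdef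
  have hN (n) (hn : n ∈ Ioc 1 N) : Real.log n ≤ ℓ := by
    rw [Finset.mem_Ioc] at hn
    rw [Real.log_le_iff_le_exp (by exact_mod_cast (by lia : 0 < n)), hexpℓ']
    exact (Nat.le_floor_iff (by positivity)).1 hn.2
  have hN' (n : ℕ) (hn : N < n) : ℓ ≤ Real.log n := by
    rw [Real.le_log_iff_exp_le (by exact_mod_cast (by lia : 0 < n)), hexpℓ']
    exact (Nat.lt_of_floor_lt hn).le
  have hδ : (8 * ℓ)⁻¹ ≤ 1 / 4 := by
    rw [inv_le_comm₀ (by linarith) (by norm_num)]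
    linarith
  have hδ0 : 0 < (8 * ℓ)⁻¹ := inv_pos.2 (by linarith)
  have hδℓ : (8 * ℓ)⁻¹ * ℓ = 1 / 8 := by
    field_simp
  set α : ℝ := 1 / 2 + (8 * ℓ)⁻¹ with hα
  have hαℓ : α * ℓ = ℓ / 2 + 1 / 8 := by
    rw [hα, add_mul, hδℓ]
    ring
  refine (norm_logDeriv_LFunction_add_sum_le hχ hz hC hb (α := α) (ℓ := ℓ) (by linarith)
    (by linarith) (by linarith) hN hN' hs).trans ?_
  set u := s.re with hu
  set X := Real.exp (-((u - 1) * ℓ)) with hX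
  have h1 : Real.exp (-((u - α) * ℓ)) * Real.log T ≤ 2 * X := by
    rw [← hexpℓ, ← Real.exp_add, show -((u - α) * ℓ) + ℓ / 2 = 1 / 8 + -((u - 1) * ℓ) by
      linear_combination hαℓ, Real.exp_add]
    gcongr
    exact exp_le_two (by norm_num)
  have h2 (n) (hn : n ∈ Ioc 1 N) : Real.exp (-((u - α) * ℓ)) * (Λ n * Real.exp (-(α * Real.log n)) *
      Real.exp ((u - α) * (Real.log n - ℓ))) ≤ 2 * (X * Real.exp (-ℓ)) * Λ n := by
    have hl := hN n hn
    have hl0 := Real.log_natCast_nonneg n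
    have hexp : -((u - α) * ℓ) + -(α * Real.log n) + (u - α) * (Real.log n - ℓ) ≤
        1 / 4 + (-((u - 1) * ℓ) + -ℓ) := by
      rcases le_total 0 (u - 2 * α) with h | h
      · nlinarith [mul_nonneg h (sub_nonneg.2 hl)]
      · nlinarith [mul_nonneg (neg_nonneg.2 h) hl0]
    have h := Real.exp_le_exp.2 hexp
    rw [Real.exp_add, Real.exp_add, Real.exp_add, Real.exp_add] at h
    replace h := h.trans (mul_le_mul_of_nonneg_right (exp_le_two le_rfl) (by positivity))
    calc _ = Real.exp (-((u - α) * ℓ)) * Real.exp (-(α * Real.log n)) *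
          Real.exp ((u - α) * (Real.log n - ℓ)) * Λ n := by ring
      _ ≤ _ := mul_le_mul_of_nonneg_right h ArithmeticFunction.vonMangoldt_nonneg
  have hψ : ∑ n ∈ Ioc 1 N, Λ n ≤ 6 * Real.exp ℓ := by
    rw [hexpℓ']
    have h6 : Real.log 4 + 4 ≤ 6 := by
      rw [show (4 : ℝ) = 2 ^ 2 by norm_num, Real.log_pow]
      push_cast
      linarith [Real.log_two_lt_d9]
    calc _ ≤ Chebyshev.psi (Real.log T ^ 2) :=
          Finset.sum_le_sum_of_subset_of_nonneg (Finset.Ioc_subset_Ioc_left zero_le_one)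
            fun _ _ _ ↦ ArithmeticFunction.vonMangoldt_nonneg
      _ ≤ (Real.log 4 + 4) * Real.log T ^ 2 := Chebyshev.psi_le_const_mul_self (by positivity)
      _ ≤ _ := by gcongr
  rw [mul_add, Finset.mul_sum]
  have h3 := log_norm_add_five_le_re_mul_log hT hs hTs hsT
  have h4 : Real.exp (-((u - α) * ℓ)) * (13 * C * Real.log ‖s + 5‖) ≤ 78 * C * u * X := by
    calc _ ≤ Real.exp (-((u - α) * ℓ)) * (13 * C * (3 * u * Real.log T)) := by gcongr
      _ = 39 * C * u * (Real.exp (-((u - α) * ℓ)) * Real.log T) := by ring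
      _ ≤ 39 * C * u * (2 * X) := by gcongr
      _ = _ := by ring
  have h5 : 2 * (X * Real.exp (-ℓ)) * ∑ n ∈ Ioc 1 N, Λ n ≤ 12 * u * X := by
    calc _ ≤ 2 * (X * Real.exp (-ℓ)) * (6 * Real.exp ℓ) := by gcongr
      _ = 12 * 1 * X := by
        rw [Real.exp_neg]
        field_simp
        ring
      _ ≤ _ := by gcongr
  rw [Finset.mul_sum] at h5
  linarith [Finset.sum_le_sum h2]

/-- A function on a half-line tending to zero is bounded by any majorant tending to zero whose
derivative dominates. -/
lemma abs_le_of_abs_deriv_le_neg_of_tendsto {h h' M M' : ℝ → ℝ} {a : ℝ}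
    (hh : ∀ u, a ≤ u → HasDerivAt h (h' u) u) (hM : ∀ u, a ≤ u → HasDerivAt M (M' u) u)
    (hle : ∀ u, a ≤ u → |h' u| ≤ -M' u) (hh0 : Tendsto h atTop (𝓝 0))
    (hM0 : Tendsto M atTop (𝓝 0)) {u : ℝ} (hu : a ≤ u) : |h u| ≤ M u := by
  have key {g g' : ℝ → ℝ} (hg : ∀ u, a ≤ u → HasDerivAt g (g' u) u) (hle : ∀ u, a ≤ u → g' u ≤ 0)
      (hg0 : Tendsto g atTop (𝓝 0)) : 0 ≤ g u := by
    have hanti : AntitoneOn g (Set.Ici a) := by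
      refine antitoneOn_of_deriv_nonpos (convex_Ici a)
        (fun v hv ↦ (hg v hv).continuousAt.continuousWithinAt)
        (fun v hv ↦ (hg v (interior_subset hv)).differentiableAt.differentiableWithinAt)
        fun v hv ↦ ?_
      rw [(hg v (interior_subset hv)).deriv]
      exact hle v (interior_subset hv)
    exact le_of_tendsto hg0 ((eventually_ge_atTop u).mono fun v hv ↦ hanti hu (hu.trans hv) hv)
  rw [abs_le]
  constructor
  · have := key (g := fun v ↦ M v + h v) (fun v hv ↦ (hM v hv).add (hh v hv))
      (fun v hv ↦ by linarith [le_of_abs_le (hle v hv)]) (by simpa using hM0.add hh0)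
    linarith
  · have := key (g := fun v ↦ M v - h v) (fun v hv ↦ (hM v hv).sub (hh v hv))
      (fun v hv ↦ by linarith [neg_le_of_abs_le (hle v hv)]) (by simpa using hM0.sub hh0)
    linarith

lemma abs_le_div_of_abs_deriv_le_mul_exp {h h' : ℝ → ℝ} {C ℓ : ℝ} (hC : 0 ≤ C) (hℓ : 1 / 2 ≤ ℓ)
    (hh : ∀ u, 1 ≤ u → HasDerivAt h (h' u) u)
    (hle : ∀ u, 1 ≤ u → |h' u| ≤ C * u * Real.exp (-((u - 1) * ℓ)))
    (hh0 : Tendsto h atTop (𝓝 0)) {u : ℝ} (hu : 1 ≤ u) : |h u| ≤ 9 * C / ℓ := by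
  have hℓ0 : 0 < ℓ := by linarith
  have hM (v : ℝ) : HasDerivAt (fun v ↦ 3 * C / ℓ * ((v + 2) * Real.exp (-((v - 1) * ℓ))))
      (-(3 * C / ℓ * (((v + 2) * ℓ - 1) * Real.exp (-((v - 1) * ℓ))))) v := by
    have h1 : HasDerivAt (fun v ↦ -((v - 1) * ℓ)) (-ℓ) v := by
      exact (((hasDerivAt_id v).sub_const 1).mul_const ℓ).neg.congr_deriv (by ring)
    refine ((((hasDerivAt_id v).add_const 2).mul h1.exp).const_mul (3 * C / ℓ)).congr_deriv ?_
    simp only [id]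
    field_simp
    ring
  have hM0 : Tendsto (fun v ↦ 3 * C / ℓ * ((v + 2) * Real.exp (-((v - 1) * ℓ)))) atTop (𝓝 0) := by
    have hx : Tendsto (fun v ↦ (v - 1) * ℓ) atTop atTop :=
      (tendsto_atTop_add_const_right _ (-1) tendsto_id).atTop_mul_const hℓ0
    have h1 := (Real.tendsto_pow_mul_exp_neg_atTop_nhds_zero 1).comp hx
    have h2 := (Real.tendsto_exp_neg_atTop_nhds_zero).comp hx
    have h3 := ((h1.const_mul ℓ⁻¹).add (h2.const_mul 3)).const_mul (3 * C / ℓ)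
    simp only [mul_zero, add_zero] at h3
    refine h3.congr fun v ↦ ?_
    simp only [Function.comp_apply, pow_one]
    field_simp
    ring
  refine (abs_le_of_abs_deriv_le_neg_of_tendsto hh (fun v _ ↦ hM v) (fun v hv ↦ ?_) hh0 hM0
    hu).trans ?_
  · refine (hle v hv).trans ?_
    rw [neg_neg, ← mul_assoc]
    refine mul_le_mul_of_nonneg_right ?_ (Real.exp_nonneg _)
    rw [div_mul_eq_mul_div, le_div_iff₀ hℓ0]
    have : v * ℓ ≤ 3 * ((v + 2) * ℓ - 1) := by nlinarith
    nlinarith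
  · have h1 : (u + 2) * Real.exp (-((u - 1) * ℓ)) ≤ 3 := by
      rw [Real.exp_neg, ← div_eq_mul_inv, div_le_iff₀ (Real.exp_pos _)]
      nlinarith [Real.add_one_le_exp ((u - 1) * ℓ)]
    calc _ ≤ 3 * C / ℓ * 3 := by gcongr
      _ = _ := by ring

lemma tendsto_LFunction_add_mul_I {q : ℕ} [NeZero q] (χ : DirichletCharacter ℂ q) (t : ℝ) :
    Tendsto (fun u : ℝ ↦ LFunction χ (u + t * I)) atTop (𝓝 1) := by
  have hfs : LSeriesSummable (fun n : ℕ ↦ χ n) 2 := LSeriesSummable_of_one_lt_re χ (by simp)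
  have hexp : Tendsto (fun u : ℝ ↦ (∑' n, ‖LSeries.term (fun n : ℕ ↦ χ n) 2 n‖) *
      Real.exp (-((u - 2) * Real.log 2))) atTop (𝓝 0) := by
    have hx : Tendsto (fun u : ℝ ↦ (u - 2) * Real.log 2) atTop atTop :=
      (tendsto_atTop_add_const_right _ (-2) tendsto_id).atTop_mul_const (Real.log_pos one_lt_two)
    simpa using (Real.tendsto_exp_neg_atTop_nhds_zero.comp hx).const_mul _
  rw [tendsto_iff_norm_sub_tendsto_zero]
  refine squeeze_zero' (Eventually.of_forall fun _ ↦ norm_nonneg _) ?_ hexp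
  filter_upwards [eventually_ge_atTop 2] with u hu
  have hre : ((u : ℂ) + t * I).re = u := by simp
  have h := norm_LSeries_sub_sum_mul_exp_le (s := u + t * I) (ℓ := Real.log 2) {1} hfs
    (by rw [hre]; simpa using hu) fun n hn hn0 _ ↦ by
      have : 2 ≤ n := by
        rw [Finset.mem_singleton] at hn
        lia
      exact Real.log_le_log two_pos (by exact_mod_cast this)
  rw [hre, re_ofNat, Finset.sum_singleton, LSeries.term_of_ne_zero one_ne_zero] at h
  rw [LFunction_eq_LSeries χ (by rw [hre]; linarith), Real.exp_neg, ← div_eq_mul_inv,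
    le_div_iff₀ (Real.exp_pos _)]
  simpa using h

lemma HasDerivAt.log_norm {g : ℝ → ℂ} {g' : ℂ} {u : ℝ} (hg : HasDerivAt g g' u) (h0 : g u ≠ 0) :
    HasDerivAt (fun v ↦ Real.log ‖g v‖) (g' / g u).re u := by
  have hn : ‖g u‖ ≠ 0 := norm_ne_zero_iff.2 h0
  have h := (hg.norm_sq.log (pow_ne_zero 2 hn)).const_mul (1 / 2)
  refine (h.congr_deriv ?_).congr_of_eventuallyEq (Eventually.of_forall fun v ↦ ?_)
  · rw [Complex.inner, div_eq_mul_inv g', Complex.inv_def, ← mul_assoc, re_mul_ofReal,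
      Complex.normSq_eq_norm_sq, mul_comm g']
    field_simp
  · simp only [Real.log_pow]
    push_cast
    ring

lemma hasDerivAt_ofReal_add_mul_I (t u : ℝ) : HasDerivAt (fun v : ℝ ↦ (v : ℂ) + t * I) 1 u :=
  (hasDerivAt_id u).ofReal_comp.add_const _

lemma hasDerivAt_cexp_neg_mul_I (a : ℂ) (l t u : ℝ) :
    HasDerivAt (fun v : ℝ ↦ a * cexp (-(((v : ℂ) + t * I) * l)))
      (a * (cexp (-(((u : ℂ) + t * I) * l)) * -l)) u := by
  refine ((((hasDerivAt_ofReal_add_mul_I t u).mul_const (l : ℂ)).neg.cexp).const_mul a).congr_deriv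
    ?_
  simp

lemma tendsto_cexp_neg_mul_I (a : ℂ) {l : ℝ} (hl : 0 < l) (t : ℝ) :
    Tendsto (fun v : ℝ ↦ a * cexp (-(((v : ℂ) + t * I) * l))) atTop (𝓝 0) := by
  rw [← mul_zero a]
  refine Tendsto.const_mul a (tendsto_zero_iff_norm_tendsto_zero.2 ?_)
  refine (Real.tendsto_exp_neg_atTop_nhds_zero.comp (tendsto_id.atTop_mul_const hl)).congr
    fun v ↦ ?_
  rw [Complex.norm_exp]
  simp

/-- Assuming GRH for `χ`: for `T ≥ 4`, `σ ≥ 1` and `T ≤ t ≤ 2T`, `L(σ+it,χ) ≠ 0` and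
`log |L(σ+it,χ)| = Re ∑_{1 < n ≤ (log T)²} Λ(n) χ(n)/(n^{σ+it} log n) + O(1/log log T)`. -/
theorem log_L_approx (q : ℕ) [NeZero q] (hq : 2 < q)
    (χ : DirichletCharacter ℂ q) (hχ : χ.IsPrimitive)
    (hGRH : ∀ s : ℂ, LFunction χ s = 0 → 0 < s.re → s.re < 1 → s.re = 1 / 2) :
    ∃ C : ℝ, 0 < C ∧
      ∀ T : ℝ, 4 ≤ T → ∀ σ t : ℝ, 1 ≤ σ → T ≤ t → t ≤ 2 * T →
        LFunction χ ((σ : ℂ) + t * I) ≠ 0 ∧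
        |Real.log ‖LFunction χ ((σ : ℂ) + t * I)‖ -
            (∑ n ∈ Finset.Ioc 1 ⌊(Real.log T) ^ 2⌋₊,
              (ArithmeticFunction.vonMangoldt n : ℂ) * χ (n : ZMod q) /
                ((n : ℂ) ^ ((σ : ℂ) + t * I) * (Real.log n : ℂ))).re| ≤
          C / Real.log (Real.log T) := by
  have hχ1 : χ ≠ 1 := by
    rintro rfl
    have h : conductor (1 : DirichletCharacter ℂ q) = q := hχ
    rw [conductor_one] at h
    lia
  have hz (s : ℂ) (hs : 1 / 2 < s.re) : LFunction χ s ≠ 0 := fun h0 ↦ by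
    rcases le_or_gt 1 s.re with h1 | h1
    · exact LFunction_ne_zero_of_one_le_re χ (Or.inl hχ1) h1 h0
    · exact hs.ne' (hGRH s h0 (by linarith) h1)
  obtain ⟨C, hC, hb⟩ := exists_norm_logDeriv_LFunction_add_sum_le hχ1 hz
  refine ⟨9 * C / 2, by positivity, fun T hT σ t hσ hTt htT ↦
    ⟨hz _ (by simp; linarith), ?_⟩⟩
  have hℓ := half_le_two_mul_log_log hT
  set N := ⌊Real.log T ^ 2⌋₊
  have hlog (n) (hn : n ∈ Ioc 1 N) : 0 < Real.log n :=
    Real.log_pos (by exact_mod_cast (Finset.mem_Ioc.1 hn).1)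
  have hsum (u : ℝ) : ∑ n ∈ Ioc 1 N, (Λ n : ℂ) * χ n / ((n : ℂ) ^ ((u : ℂ) + t * I) *
      (Real.log n : ℂ)) = ∑ n ∈ Ioc 1 N, χ n * Λ n / (Real.log n : ℂ) *
        cexp (-(((u : ℂ) + t * I) * Real.log n)) := by
    refine Finset.sum_congr rfl fun n hn ↦ ?_
    have hn0 : n ≠ 0 := by
      have := (Finset.mem_Ioc.1 hn).1
      lia
    have h := term_eq_mul_cexp (fun n ↦ χ n * Λ n / (Real.log n : ℂ)) ((u : ℂ) + t * I) hn0
    rw [LSeries.term_of_ne_zero hn0] at h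
    rw [← h, mul_comm (χ _), div_div, mul_comm ((Real.log n : ℝ) : ℂ)]
  have key := abs_le_div_of_abs_deriv_le_mul_exp (C := C) (u := σ)
    (h := fun u ↦ Real.log ‖LFunction χ ((u : ℂ) + t * I)‖ -
      (∑ n ∈ Ioc 1 N, χ n * Λ n / (Real.log n : ℂ) *
        cexp (-(((u : ℂ) + t * I) * Real.log n))).re)
    (h' := fun u ↦ (logDeriv (LFunction χ) ((u : ℂ) + t * I) + ∑ n ∈ Ioc 1 N,
      χ n * (Λ n : ℂ) * cexp (-(((u : ℂ) + t * I) * Real.log n))).re)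
    hC.le hℓ (fun u hu ↦ ?_) (fun u hu ↦ ?_) ?_ hσ
  · rw [hsum]
    refine key.trans_eq ?_
    rw [div_div]
  · have h1 := ((differentiable_LFunction hχ1 ((u : ℂ) + t * I)).hasDerivAt.comp u
      (hasDerivAt_ofReal_add_mul_I t u)).log_norm (hz _ (by simp; linarith))
    have h2 := Complex.reCLM.hasFDerivAt.comp_hasDerivAt u
      (HasDerivAt.fun_sum fun n (_ : n ∈ Ioc 1 N) ↦
        hasDerivAt_cexp_neg_mul_I (χ n * Λ n / (Real.log n : ℂ)) (Real.log n) t u)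
    refine (h1.sub h2).congr_deriv ?_
    rw [add_re, mul_one, Complex.reCLM_apply, sub_eq_add_neg, ← neg_re, ← Finset.sum_neg_distrib]
    congr 2
    refine Finset.sum_congr rfl fun n hn ↦ ?_
    have := Complex.ofReal_ne_zero.2 (hlog n hn).ne'
    field_simp
  · have := hb T hT ((u : ℂ) + t * I) (by simpa using hu) (by simpa using hTt) (by simpa using htT)
    refine (Complex.abs_re_le_norm _).trans (this.trans_eq ?_)
    simp
  · have h1 := (tendsto_LFunction_add_mul_I χ t).norm.log (by simp)
    have h2 := (Complex.continuous_re.tendsto _).comp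
      (tendsto_finsetSum (Ioc 1 N) fun n hn ↦
        tendsto_cexp_neg_mul_I (χ n * Λ n / (Real.log n : ℂ)) (hlog n hn) t)
    simpa using h1.sub h2
end
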